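/- Let d ∈ {1,2}, s ≥ 0 and μ ∈ (0,1]. There is a constant C = C(s,d), independent of μ, such that for all Schwartz functions f, g on ℝ^d, the commutator [J^s √T_μ(D), f] g = J^s √T_μ(D)(f g) − f · (J^s √T_μ(D) g) satisfies ‖[J^s √T_μ(D), f] g‖_{L^2} ≤ C ( ‖∇f‖_{L^∞} ‖J^{s−1} g‖_{L^2} + ‖J^s f‖_{L^2} ‖g‖_{L^∞} ). -/

import Mathlib

noncomputable section

open MeasureTheory SchwartzMap
open scoped FourierTransform ENNReal

/-- The Japanese bracket `⟨x⟩ = (1 + x²)^{1/2}`. -/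
def jap (x : ℝ) : ℝ := (1 + x ^ 2) ^ ((1 : ℝ) / 2)

/-- The radial symbol `T_μ(ξ) = tanh(√μ |ξ|)/(√μ |ξ|)` for `ξ ≠ 0`, with value `1` at `0`,
expressed through `r = |ξ|`. -/
def Tsymb (μ r : ℝ) : ℝ :=
  if r = 0 then 1 else Real.tanh (Real.sqrt μ * r) / (Real.sqrt μ * r)

/-- Generic Fourier multiplier `a(D) g = (a(ξ) ĝ(ξ))^∨` with real symbol `a` on `ℝ^d`. -/
def fmulD (d : ℕ) (a : EuclideanSpace ℝ (Fin d) → ℝ) (g : EuclideanSpace ℝ (Fin d) → ℂ) :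
    EuclideanSpace ℝ (Fin d) → ℂ :=
  𝓕⁻ (fun ξ => ((a ξ : ℝ) : ℂ) * 𝓕 g ξ)

/-- The operator `J^s √T_μ(D)`, with symbol `⟨ξ⟩^s T_μ(ξ)^{1/2}`. -/
def JsqrtT (d : ℕ) (μ s : ℝ) (g : EuclideanSpace ℝ (Fin d) → ℂ) :
    EuclideanSpace ℝ (Fin d) → ℂ :=
  fmulD d (fun ξ => jap ‖ξ‖ ^ s * Real.sqrt (Tsymb μ ‖ξ‖)) g

/-- The Bessel potential `J^s`, with symbol `⟨ξ⟩^s`. -/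
def besselD (d : ℕ) (s : ℝ) (g : EuclideanSpace ℝ (Fin d) → ℂ) :
    EuclideanSpace ℝ (Fin d) → ℂ :=
  fmulD d (fun ξ => jap ‖ξ‖ ^ s) g

namespace KP

/-- The ambient Euclidean space. -/
abbrev V (d : ℕ) := EuclideanSpace ℝ (Fin d)

/-- Complex Schwartz functions. -/
abbrev Sch (d : ℕ) := 𝓢(V d, ℂ)

variable {d : ℕ}

/-- Pointwise product of Schwartz functions. -/
def mulS (u v : Sch d) : Sch d := SchwartzMap.pairing (ContinuousLinearMap.mul ℂ ℂ) u v

@[simp] lemma mulS_apply (u v : Sch d) (x : V d) : mulS u v x = u x * v x := rfl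

/-- Fourier multiplier with a Schwartz symbol. -/
def Op (m u : Sch d) : Sch d := 𝓕⁻ (mulS m (𝓕 u))

/-- Kernel of a Fourier multiplier. -/
def ker (m : Sch d) : Sch d := 𝓕⁻ m

lemma fourier_Op (m u : Sch d) : 𝓕 (Op m u) = mulS m (𝓕 u) := by
  simp [Op]

lemma fourier_Op_apply (m u : Sch d) (ξ : V d) : 𝓕 (Op m u) ξ = m ξ * 𝓕 u ξ := by
  rw [fourier_Op]; rfl

lemma ext_fourier {u v : Sch d} (h : ∀ ξ, 𝓕 u ξ = 𝓕 v ξ) : u = v := by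
  have : 𝓕 u = 𝓕 v := SchwartzMap.ext h
  have h2 := congrArg (fun w : Sch d => 𝓕⁻ w) this
  simpa using h2

lemma Op_apply (m u : Sch d) (x : V d) : Op m u x = ∫ z, ker m z * u (x - z) := by
  have h1 : Op m u = SchwartzMap.convolution (ContinuousLinearMap.mul ℂ ℂ) (ker m) u := by
    apply ext_fourier
    intro ξ
    rw [fourier_Op_apply, SchwartzMap.fourier_convolution]
    simp [ker]
  rw [h1, SchwartzMap.convolution_apply]
  rfl

/-- L¹ norm of the kernel. -/
def W0 (m : Sch d) : ℝ := ∫ z, ‖ker m z‖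

/-- First moment of the kernel. -/
def W1 (m : Sch d) : ℝ := ∫ z, ‖z‖ * ‖ker m z‖

lemma W0_nonneg (m : Sch d) : 0 ≤ W0 m := integral_nonneg fun _ => norm_nonneg _
lemma W1_nonneg (m : Sch d) : 0 ≤ W1 m := integral_nonneg fun _ => by positivity

lemma int_W0 (m : Sch d) : Integrable (fun z => ‖ker m z‖) := (ker m).integrable.norm
lemma int_W1 (m : Sch d) : Integrable (fun z => ‖z‖ * ‖ker m z‖) := by
  simpa using (ker m).integrable_pow_mul volume 1

/-- L² norm. -/
def n2 (u : Sch d) : ℝ := ‖u.toLp 2 volume‖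

lemma n2_nonneg (u : Sch d) : 0 ≤ n2 u := norm_nonneg _

lemma n2_sq (u : Sch d) : n2 u ^ 2 = ∫ x, ‖u x‖ ^ 2 := by
  have h := SchwartzMap.norm_toLp' (f := u) (p := 2) (μ := volume) (by simp) (by simp)
  rw [n2, h]
  have h0 : 0 ≤ ∫ x, ‖u x‖ ^ 2 := integral_nonneg fun _ => by positivity
  simp only [ENNReal.toReal_ofNat, Real.rpow_ofNat]
  rw [← Real.rpow_natCast, ← Real.rpow_mul h0]
  norm_num

lemma int_sq (u : Sch d) : Integrable (fun x => ‖u x‖ ^ 2) := (u.memLp 2 volume).integrable_norm_pow (by simp)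

lemma n2_fourier (u : Sch d) : n2 (𝓕 u) = n2 u := by simp [n2]

lemma n2_add (u v : Sch d) : n2 (u + v) ≤ n2 u + n2 v := by
  have : (u + v).toLp 2 volume = u.toLp 2 volume + v.toLp 2 volume :=
    map_add (SchwartzMap.toLpCLM ℂ ℂ 2 volume) u v
  rw [n2, this]; exact norm_add_le _ _

lemma n2_smul (c : ℂ) (u : Sch d) : n2 (c • u) = ‖c‖ * n2 u := by
  have : (c • u).toLp 2 volume = c • u.toLp 2 volume :=
    map_smul (SchwartzMap.toLpCLM ℂ ℂ 2 volume) c u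
  rw [n2, this, norm_smul, n2]

lemma n2_zero : n2 (0 : Sch d) = 0 := by
  have := n2_smul (0:ℂ) (0 : Sch d)
  simpa using this

lemma n2_neg (u : Sch d) : n2 (-u) = n2 u := by
  have := n2_smul (-1:ℂ) u
  simpa using this

lemma n2_sub (u v : Sch d) : n2 (u - v) ≤ n2 u + n2 v := by
  rw [sub_eq_add_neg]; exact (n2_add _ _).trans (by rw [n2_neg])

lemma n2_sum {ι : Type*} (s : Finset ι) (u : ι → Sch d) : n2 (∑ i ∈ s, u i) ≤ ∑ i ∈ s, n2 (u i) := by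
  classical
  induction s using Finset.induction_on with
  | empty => simp [n2_zero]
  | insert a s ha ih =>
    rw [Finset.sum_insert ha, Finset.sum_insert ha]
    exact (n2_add _ _).trans (by gcongr)

lemma n2_le_of_sq {u : Sch d} {c : ℝ} (hc : 0 ≤ c) (h : n2 u ^ 2 ≤ c ^ 2) : n2 u ≤ c :=
  le_of_sq_le_sq h hc

lemma n2_le_mul {u v : Sch d} {c : ℝ} (hc : 0 ≤ c) (h : ∀ x, ‖u x‖ ≤ c * ‖v x‖) :
    n2 u ≤ c * n2 v := by
  apply n2_le_of_sq (mul_nonneg hc (n2_nonneg _))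
  rw [mul_pow, n2_sq, n2_sq, ← integral_const_mul]
  apply integral_mono (int_sq u) ((int_sq v).const_mul _)
  intro x
  have := pow_le_pow_left₀ (norm_nonneg _) (h x) 2
  simpa [mul_pow] using this

lemma n2_le_mul_fourier {u v : Sch d} {c : ℝ} (hc : 0 ≤ c) (h : ∀ x, ‖𝓕 u x‖ ≤ c * ‖𝓕 v x‖) :
    n2 u ≤ c * n2 v := by
  rw [← n2_fourier u, ← n2_fourier v]; exact n2_le_mul hc h

lemma n2_mulS_right (u v : Sch d) {B : ℝ} (hB : 0 ≤ B) (h : ∀ x, ‖v x‖ ≤ B) :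
    n2 (mulS u v) ≤ B * n2 u :=
  n2_le_mul hB fun x => by
    rw [mulS_apply, norm_mul, mul_comm]; gcongr; exact h x

lemma n2_mulS_left (u v : Sch d) {B : ℝ} (hB : 0 ≤ B) (h : ∀ x, ‖u x‖ ≤ B) :
    n2 (mulS u v) ≤ B * n2 v :=
  n2_le_mul hB fun x => by
    rw [mulS_apply, norm_mul]; gcongr; exact h x

/-- Cauchy-Schwarz. -/
lemma cs (u v : Sch d) : ∫ x, ‖u x‖ * ‖v x‖ ≤ n2 u * n2 v := by
  have h := integral_mul_le_Lp_mul_Lq_of_nonneg (μ := volume) (p := 2) (q := 2)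
    (f := fun x => ‖u x‖) (g := fun x => ‖v x‖) (by constructor <;> norm_num)
    (Filter.Eventually.of_forall fun _ => norm_nonneg _)
    (Filter.Eventually.of_forall fun _ => norm_nonneg _)
    (by simpa using (u.memLp 2 volume).norm) (by simpa using (v.memLp 2 volume).norm)
  have e : ∀ u : Sch d, (∫ x, ‖u x‖ ^ (2:ℝ)) ^ (1/(2:ℝ)) = n2 u := by
    intro u
    simp only [Real.rpow_ofNat]
    rw [← n2_sq, ← Real.sqrt_eq_rpow, Real.sqrt_sq (n2_nonneg _)]
  rwa [e, e] at h

lemma int_mul_norm (u v : Sch d) : Integrable (fun x => ‖u x‖ * ‖v x‖) := by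
  simpa using (mulS u v).integrable.norm

/-- Sup bound for a Schwartz function. -/
lemma exists_bdd (u : Sch d) : ∃ B, 0 ≤ B ∧ ∀ x, ‖u x‖ ≤ B := by
  obtain ⟨C, hC⟩ := u.decay 0 0
  exact ⟨C, hC.1.le, by simpa using hC.2⟩

lemma norm_Op_le (m u : Sch d) {B : ℝ} (h : ∀ x, ‖u x‖ ≤ B) (x : V d) :
    ‖Op m u x‖ ≤ W0 m * B := by
  rw [Op_apply, W0, ← integral_mul_const]
  apply norm_integral_le_of_norm_le ((int_W0 m).mul_const _)
  filter_upwards with z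
  rw [norm_mul]; gcongr; exact h _

lemma int_Op (m u : Sch d) (x : V d) : Integrable (fun z => ker m z * u (x - z)) := by
  obtain ⟨B, hB, h⟩ := exists_bdd u
  apply ((int_W0 m).mul_const B).mono'
  · apply Continuous.aestronglyMeasurable
    exact (ker m).continuous.mul (u.continuous.comp (by fun_prop))
  · filter_upwards with z
    rw [norm_mul]; gcongr; exact h _

lemma Op_lip (m u : Sch d) {A : ℝ} (h : ∀ x y, ‖u x - u y‖ ≤ A * ‖x - y‖) (x y : V d) :
    ‖Op m u x - Op m u y‖ ≤ (W0 m * A) * ‖x - y‖ := by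
  rw [Op_apply, Op_apply, ← integral_sub (int_Op m u x) (int_Op m u y), W0,
    ← integral_mul_const, ← integral_mul_const]
  apply norm_integral_le_of_norm_le (((int_W0 m).mul_const _).mul_const _)
  filter_upwards with z
  rw [← mul_sub, norm_mul, mul_assoc]; gcongr
  simpa using h (x - z) (y - z)

lemma integral_ker (m : Sch d) : ∫ z, ker m z = m 0 := by
  have h : 𝓕 (ker m) 0 = m 0 := by simp [ker]
  rw [← h, SchwartzMap.fourier_coe, Real.fourier_eq]
  simp

/-- A symbol vanishing at the origin applied to a Lipschitz function. -/
lemma norm_Op_le_lip (m u : Sch d) (hm : m 0 = 0) {A : ℝ}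
    (h : ∀ x y, ‖u x - u y‖ ≤ A * ‖x - y‖) (x : V d) :
    ‖Op m u x‖ ≤ W1 m * A := by
  have e : Op m u x = ∫ z, ker m z * (u (x - z) - u x) := by
    simp_rw [mul_sub]
    rw [integral_sub (int_Op m u x) ((ker m).integrable.mul_const _), ← Op_apply,
      integral_mul_const, integral_ker, hm]; simp
  rw [e, W1, ← integral_mul_const]
  apply norm_integral_le_of_norm_le ((int_W1 m).mul_const _)
  filter_upwards with z
  rw [norm_mul]
  have := h (x - z) x
  simp only [sub_sub_cancel_left, norm_neg] at this
  calc ‖ker m z‖ * ‖u (x - z) - u x‖ ≤ ‖ker m z‖ * (A * ‖z‖) := by gcongr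
    _ = _ := by ring

lemma n2_Op_le (m u : Sch d) {c : ℝ} (hc : 0 ≤ c) (h : ∀ ξ, ‖m ξ‖ ≤ c) : n2 (Op m u) ≤ c * n2 u :=
  n2_le_mul_fourier hc fun ξ => by
    rw [fourier_Op_apply, norm_mul]; gcongr; exact h ξ

/-- Translate of a Schwartz function. -/
def tr (z : V d) (u : Sch d) : Sch d := SchwartzMap.compSubConstCLM ℂ z u

@[simp] lemma tr_apply (z : V d) (u : Sch d) (x : V d) : tr z u x = u (x - z) := by
  simp [tr]

lemma n2_tr (z : V d) (u : Sch d) : n2 (tr z u) = n2 u := by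
  have : n2 (tr z u) ^ 2 = n2 u ^ 2 := by
    rw [n2_sq, n2_sq]
    simp only [tr_apply]
    exact integral_sub_right_eq_self (fun x => ‖u x‖ ^ 2) z
  exact (pow_left_inj₀ (n2_nonneg _) (n2_nonneg _) (by norm_num)).1 this

/-- The commutator as a Schwartz function. -/
def comm (m f g : Sch d) : Sch d := Op m (mulS f g) - mulS f (Op m g)

/-- Fubini-type bound. -/
lemma young_dual (k : V d → ℝ) (hk : Integrable k) (hk0 : ∀ z, 0 ≤ k z) (hkc : Continuous k)
    (u g : Sch d) (h : ∀ x, ‖u x‖ ≤ ∫ z, k z * ‖g (x - z)‖) :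
    n2 u ≤ (∫ z, k z) * n2 g := by
  obtain ⟨B, hB, hg⟩ := exists_bdd g
  have hInteg : Integrable (fun p : V d × V d => ‖u p.1‖ * (k p.2 * ‖g (p.1 - p.2)‖))
      (volume.prod volume) := by
    have h1 : Integrable (fun p : V d × V d => ‖u p.1‖ * k p.2) (volume.prod volume) :=
      u.integrable.norm.mul_prod hk
    apply (h1.mul_const B).mono'
    · apply Continuous.aestronglyMeasurable
      have := u.continuous
      have := g.continuous
      fun_prop
    · filter_upwards with p
      rw [Real.norm_of_nonneg (mul_nonneg (norm_nonneg _) (mul_nonneg (hk0 _) (norm_nonneg _))),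
        ← mul_assoc]
      gcongr
      · exact mul_nonneg (norm_nonneg _) (hk0 _)
      · exact hg _
  have key : n2 u ^ 2 ≤ (∫ z, k z) * n2 g * n2 u := by
    calc n2 u ^ 2 = ∫ x, ‖u x‖ ^ 2 := n2_sq u
      _ ≤ ∫ x, ∫ z, ‖u x‖ * (k z * ‖g (x - z)‖) := by
          apply integral_mono (int_sq u) hInteg.integral_prod_left
          intro x
          simp only []
          rw [integral_const_mul, sq]
          gcongr
          exact h x
      _ = ∫ z, ∫ x, ‖u x‖ * (k z * ‖g (x - z)‖) := integral_integral_swap hInteg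
      _ ≤ ∫ z, k z * (n2 u * n2 g) := by
          apply integral_mono hInteg.integral_prod_right (hk.mul_const _)
          intro z
          simp only []
          have e : ∀ x, ‖u x‖ * (k z * ‖g (x - z)‖) = k z * (‖u x‖ * ‖tr z g x‖) := by
            intro x; simp; ring
          simp_rw [e]
          rw [integral_const_mul]
          gcongr
          · exact hk0 z
          · exact (cs u (tr z g)).trans (by rw [n2_tr])
      _ = _ := by rw [integral_mul_const]; ring
  have hK : 0 ≤ ∫ z, k z := integral_nonneg hk0
  by_cases h0 : n2 u = 0
  · rw [h0]; exact mul_nonneg hK (n2_nonneg _)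
  · have hp : 0 < n2 u := lt_of_le_of_ne (n2_nonneg _) (Ne.symm h0)
    rw [sq] at key
    exact le_of_mul_le_mul_right key hp

lemma n2_comm_le (m f g : Sch d) {A : ℝ} (hA : 0 ≤ A) (h : ∀ x y, ‖f x - f y‖ ≤ A * ‖x - y‖) :
    n2 (comm m f g) ≤ W1 m * A * n2 g := by
  have e : (∫ z, (‖z‖ * ‖ker m z‖) * A) = W1 m * A := by rw [integral_mul_const, W1]
  rw [← e]
  apply young_dual _ ((int_W1 m).mul_const A) (fun z => by positivity)
  · have := (ker m).continuous; fun_prop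
  · intro x
    have e2 : comm m f g x = ∫ z, ker m z * (f (x - z) - f x) * g (x - z) := by
      have : ∀ z, ker m z * (f (x - z) - f x) * g (x - z)
          = ker m z * (mulS f g) (x - z) - f x * (ker m z * g (x - z)) := by
        intro z; simp; ring
      simp_rw [this]
      rw [integral_sub (int_Op m _ x) ((int_Op m g x).const_mul _), integral_const_mul,
        ← Op_apply, ← Op_apply]
      simp [comm]
    rw [e2]
    obtain ⟨B, hB, hg⟩ := exists_bdd g
    apply norm_integral_le_of_norm_le
    · apply (((int_W1 m).mul_const A).mul_const B).mono'
      · apply Continuous.aestronglyMeasurable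
        have := (ker m).continuous
        have := g.continuous
        fun_prop
      · filter_upwards with z
        rw [Real.norm_of_nonneg (by positivity)]
        gcongr
        exact hg _
    · filter_upwards with z
      rw [norm_mul, norm_mul]
      have := h (x - z) x
      simp only [sub_sub_cancel_left, norm_neg] at this
      refine mul_le_mul_of_nonneg_right ?_ (norm_nonneg _)
      calc ‖ker m z‖ * ‖f (x - z) - f x‖ ≤ ‖ker m z‖ * (A * ‖z‖) := by gcongr
        _ = _ := by ring

end KP

namespace KP

variable {d : ℕ}

open ComplexConjugate

/-! ### Fourier side facts -/

lemma fourier_fourier_apply (u : Sch d) (x : V d) : 𝓕 (𝓕 u) x = u (-x) := by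
  have h : (𝓕⁻ (𝓕 u) : Sch d) = u := by simp
  have h2 := congrArg (fun w : Sch d => w (-x)) h
  change (𝓕⁻ (𝓕 u) : Sch d) (-x) = u (-x) at h2
  rw [← h2, SchwartzMap.fourierInv_apply_eq]
  simp [SchwartzMap.compCLMOfContinuousLinearEquiv_apply]

lemma fourierInv_eq_fourier_neg (u : Sch d) (x : V d) : (𝓕⁻ u : Sch d) x = 𝓕 u (-x) := by
  rw [SchwartzMap.fourierInv_apply_eq]
  simp [SchwartzMap.compCLMOfContinuousLinearEquiv_apply]

lemma fourier_mulS (u v : Sch d) (ξ : V d) :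
    𝓕 (mulS u v) ξ = ∫ η, 𝓕 u η * 𝓕 v (ξ - η) := by
  have h1 : 𝓕 (mulS u v) = SchwartzMap.convolution (ContinuousLinearMap.mul ℂ ℂ) (𝓕 u) (𝓕 v) := by
    have h2 : mulS u v
        = 𝓕⁻ (SchwartzMap.convolution (ContinuousLinearMap.mul ℂ ℂ) (𝓕 u) (𝓕 v)) := by
      ext x
      rw [fourierInv_eq_fourier_neg, SchwartzMap.fourier_convolution]
      simp [fourier_fourier_apply]
    rw [h2]; simp
  rw [h1, SchwartzMap.convolution_apply]
  rfl

lemma fourier_mulS_ne {u v : Sch d} {ξ : V d} (h : 𝓕 (mulS u v) ξ ≠ 0) :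
    ∃ a b, a + b = ξ ∧ 𝓕 u a ≠ 0 ∧ 𝓕 v b ≠ 0 := by
  by_contra hc
  push Not at hc
  apply h
  rw [fourier_mulS]
  have : ∀ η, 𝓕 u η * 𝓕 v (ξ - η) = 0 := by
    intro η
    by_cases h0 : 𝓕 u η = 0
    · simp [h0]
    · rw [hc η (ξ - η) (by abel) h0, mul_zero]
  simp [this]

lemma mulS_comm (u v : Sch d) : mulS u v = mulS v u := by ext x; simp [mul_comm]
lemma mulS_add (u v w : Sch d) : mulS u (v + w) = mulS u v + mulS u w := by
  ext x; simp [mul_add]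
lemma add_mulS (u v w : Sch d) : mulS (u + v) w = mulS u w + mulS v w := by
  ext x; simp [add_mul]
lemma mulS_sub (u v w : Sch d) : mulS u (v - w) = mulS u v - mulS u w := by
  ext x; simp [mul_sub]
lemma sub_mulS (u v w : Sch d) : mulS (u - v) w = mulS u w - mulS v w := by
  ext x; simp [sub_mul]
lemma mulS_assoc (u v w : Sch d) : mulS (mulS u v) w = mulS u (mulS v w) := by
  ext x; simp [mul_assoc]

lemma sum_apply {ι : Type*} (s : Finset ι) (u : ι → Sch d) (x : V d) :
    (∑ i ∈ s, u i) x = ∑ i ∈ s, u i x := by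
  classical
  induction s using Finset.induction_on with
  | empty => simp
  | insert a s ha ih => rw [Finset.sum_insert ha, Finset.sum_insert ha]; simp [ih]

lemma fourier_sum {ι : Type*} (s : Finset ι) (u : ι → Sch d) (x : V d) :
    𝓕 (∑ i ∈ s, u i) x = ∑ i ∈ s, 𝓕 (u i) x := by
  have : 𝓕 (∑ i ∈ s, u i) = ∑ i ∈ s, 𝓕 (u i) :=
    map_sum (FourierTransform.fourierCLM ℂ (Sch d)) u s
  rw [this, sum_apply]

lemma fourier_addS (u v : Sch d) (x : V d) : 𝓕 (u + v) x = 𝓕 u x + 𝓕 v x := by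
  rw [FourierTransform.fourier_add]; rfl

lemma fourier_subS (u v : Sch d) (x : V d) : 𝓕 (u - v) x = 𝓕 u x - 𝓕 v x := by
  have : 𝓕 (u - v) = 𝓕 u - 𝓕 v := map_sub (FourierTransform.fourierCLM ℂ (Sch d)) u v
  rw [this]; rfl

lemma fourier_smulS (c : ℂ) (u : Sch d) (x : V d) : 𝓕 (c • u) x = c * 𝓕 u x := by
  rw [FourierTransform.fourier_smul]; rfl

lemma Op_add (m u v : Sch d) : Op m (u + v) = Op m u + Op m v := by
  apply ext_fourier; intro ξ
  simp only [fourier_Op_apply, fourier_addS, mul_add]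

lemma Op_sub (m u v : Sch d) : Op m (u - v) = Op m u - Op m v := by
  apply ext_fourier; intro ξ
  simp only [fourier_Op_apply, fourier_subS, mul_sub]

lemma Op_smul (c : ℂ) (m u : Sch d) : Op m (c • u) = c • Op m u := by
  apply ext_fourier; intro ξ
  simp only [fourier_Op_apply, fourier_smulS]; ring

lemma smul_Op (c : ℂ) (m u : Sch d) : Op (c • m) u = c • Op m u := by
  apply ext_fourier; intro ξ
  simp only [fourier_Op_apply, fourier_smulS]; simp; ring

lemma add_Op (m m' u : Sch d) : Op (m + m') u = Op m u + Op m' u := by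
  apply ext_fourier; intro ξ
  simp only [fourier_Op_apply, fourier_addS]; simp [add_mul]

lemma sub_Op (m m' u : Sch d) : Op (m - m') u = Op m u - Op m' u := by
  apply ext_fourier; intro ξ
  simp only [fourier_Op_apply, fourier_subS]; simp [sub_mul]

lemma Op_sum {ι : Type*} (s : Finset ι) (m : Sch d) (u : ι → Sch d) :
    Op m (∑ i ∈ s, u i) = ∑ i ∈ s, Op m (u i) := by
  apply ext_fourier; intro ξ
  simp only [fourier_Op_apply, fourier_sum, Finset.mul_sum]

lemma Op_Op (m m' u : Sch d) : Op m (Op m' u) = Op (mulS m m') u := by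
  apply ext_fourier; intro ξ
  simp only [fourier_Op_apply, mulS_apply, mul_assoc]

/-- Two symbols agreeing on the spectrum of `u` give the same result. -/
lemma Op_congr {m m' u : Sch d} (h : ∀ ξ, 𝓕 u ξ ≠ 0 → m ξ = m' ξ) : Op m u = Op m' u := by
  apply ext_fourier; intro ξ
  simp only [fourier_Op_apply]
  by_cases h0 : 𝓕 u ξ = 0
  · simp [h0]
  · rw [h ξ h0]

lemma Op_eq_self {m u : Sch d} (h : ∀ ξ, 𝓕 u ξ ≠ 0 → m ξ = 1) : Op m u = u := by
  apply ext_fourier; intro ξ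
  simp only [fourier_Op_apply]
  by_cases h0 : 𝓕 u ξ = 0
  · simp [h0]
  · rw [h ξ h0, one_mul]

/-- Complex conjugation. -/
def conjS (u : Sch d) : Sch d :=
  SchwartzMap.postcompCLM (𝕜 := ℝ) (Complex.conjCLE : ℂ →L[ℝ] ℂ) u

@[simp] lemma conjS_apply (u : Sch d) (x : V d) : conjS u x = conj (u x) := rfl

lemma fourier_conjS (u : Sch d) (ξ : V d) : 𝓕 (conjS u) ξ = conj (𝓕 u (-ξ)) := by
  rw [SchwartzMap.fourier_coe, SchwartzMap.fourier_coe, Real.fourier_eq, Real.fourier_eq,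
    ← integral_conj]
  congr 1
  ext x
  simp [Circle.smul_def, ← Circle.coe_inv_eq_conj]
  left
  rw [AddChar.map_neg_eq_inv]; simp

lemma n2_conjS (u : Sch d) : n2 (conjS u) = n2 u := by
  have : n2 (conjS u) ^ 2 = n2 u ^ 2 := by
    rw [n2_sq, n2_sq]; simp
  exact (pow_left_inj₀ (n2_nonneg _) (n2_nonneg _) (by norm_num)).1 this

lemma fourier_tr (z : V d) (u : Sch d) (ξ : V d) :
    𝓕 (tr z u) ξ = Complex.exp (-(2 * Real.pi * inner ℝ z ξ : ℝ) * Complex.I) * 𝓕 u ξ := by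
  rw [SchwartzMap.fourier_coe, SchwartzMap.fourier_coe, Real.fourier_eq', Real.fourier_eq',
    ← integral_const_mul]
  rw [← integral_add_right_eq_self _ z]
  congr 1
  ext x
  simp only [tr_apply, add_sub_cancel_right, smul_eq_mul, ← mul_assoc, ← Complex.exp_add]
  congr 2
  rw [inner_add_left]; push_cast; ring

/-- The homogeneous first-order energy. -/
def E1 (u : Sch d) : ℝ := ∫ ξ, ‖ξ‖ ^ 2 * ‖𝓕 u ξ‖ ^ 2

lemma int_E1 (u : Sch d) : Integrable (fun ξ => ‖ξ‖ ^ 2 * ‖𝓕 u ξ‖ ^ 2) := by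
  obtain ⟨B, hB, h⟩ := exists_bdd (𝓕 u)
  have := ((𝓕 u).integrable_pow_mul volume 2).mul_const B
  apply this.mono'
  · apply Continuous.aestronglyMeasurable
    have := (𝓕 u).continuous
    fun_prop
  · filter_upwards with ξ
    rw [Real.norm_of_nonneg (by positivity), sq ‖𝓕 u ξ‖, ← mul_assoc]
    gcongr
    exact h ξ

lemma E1_nonneg (u : Sch d) : 0 ≤ E1 u := integral_nonneg fun _ => by positivity

lemma n2_tr_sub (z : V d) (u : Sch d) :
    n2 (tr z u - u) ≤ 2 * Real.pi * ‖z‖ * Real.sqrt (E1 u) := by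
  apply n2_le_of_sq (by positivity)
  rw [mul_pow, Real.sq_sqrt (E1_nonneg u), ← n2_fourier, n2_sq, E1, ← integral_const_mul]
  apply integral_mono (int_sq _) ((int_E1 u).const_mul _)
  intro ξ
  simp only
  rw [fourier_subS, fourier_tr, ← sub_one_mul, norm_mul, mul_pow, ← mul_assoc]
  refine mul_le_mul_of_nonneg_right ?_ (by positivity)
  rw [← mul_pow]
  refine pow_le_pow_left₀ (norm_nonneg _) ?_ 2
  have := Real.norm_exp_I_mul_ofReal_sub_one_le (x := -(2 * Real.pi * inner ℝ z ξ))
  rw [mul_comm, ← Complex.ofReal_neg]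
  refine this.trans ?_
  rw [norm_neg, norm_mul, Real.norm_of_nonneg (by positivity), mul_assoc (2 * Real.pi)]
  gcongr
  exact norm_inner_le_norm z ξ

/-! ### Weighted norms -/

/-- Bessel potential on Schwartz functions. -/
def Jb (θ : ℝ) (u : Sch d) : Sch d :=
  𝓕⁻ (SchwartzMap.smulLeftCLM ℂ (fun ξ : V d => (1 + ‖ξ‖ ^ 2) ^ (θ / 2)) (𝓕 u))

lemma fourier_Jb (θ : ℝ) (u : Sch d) (ξ : V d) :
    𝓕 (Jb θ u) ξ = (((1 + ‖ξ‖ ^ 2) ^ (θ / 2) : ℝ) : ℂ) * 𝓕 u ξ := by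
  rw [Jb]
  simp [SchwartzMap.smulLeftCLM_apply_apply
    (Function.hasTemperateGrowth_one_add_norm_sq_rpow (V d) (θ / 2))]

/-- Sobolev norm. -/
def Hs (θ : ℝ) (u : Sch d) : ℝ := n2 (Jb θ u)

lemma Hs_nonneg (θ : ℝ) (u : Sch d) : 0 ≤ Hs θ u := n2_nonneg _

lemma norm_fourier_Jb_sq (θ : ℝ) (u : Sch d) (ξ : V d) :
    ‖𝓕 (Jb θ u) ξ‖ ^ 2 = (1 + ‖ξ‖ ^ 2) ^ θ * ‖𝓕 u ξ‖ ^ 2 := by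
  rw [fourier_Jb, norm_mul, mul_pow, Complex.norm_real, Real.norm_of_nonneg (by positivity),
    ← Real.rpow_natCast, ← Real.rpow_mul (by positivity)]
  congr 2; push_cast; ring

lemma Hs_sq (θ : ℝ) (u : Sch d) : Hs θ u ^ 2 = ∫ ξ, (1 + ‖ξ‖ ^ 2) ^ θ * ‖𝓕 u ξ‖ ^ 2 := by
  rw [Hs, ← n2_fourier, n2_sq]
  simp_rw [norm_fourier_Jb_sq]

lemma int_Hs (θ : ℝ) (u : Sch d) : Integrable (fun ξ => (1 + ‖ξ‖ ^ 2) ^ θ * ‖𝓕 u ξ‖ ^ 2) := by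
  have := int_sq (𝓕 (Jb θ u))
  simpa only [norm_fourier_Jb_sq] using this

lemma Hs_zero (u : Sch d) : Hs 0 u = n2 u := by
  have : Hs 0 u ^ 2 = n2 u ^ 2 := by
    rw [Hs_sq, ← n2_fourier u, n2_sq]; simp
  exact (pow_left_inj₀ (Hs_nonneg _ _) (n2_nonneg _) (by norm_num)).1 this

lemma n2_sq_F (u : Sch d) : n2 u ^ 2 = ∫ ξ, ‖𝓕 u ξ‖ ^ 2 := by rw [← n2_fourier, n2_sq]

/-- Weighted square sums. -/
lemma sum_n2_sq_le {ι : Type*} (s : Finset ι) (m : ι → Sch d) (c : ι → ℝ) {K θ : ℝ}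
    (u : Sch d) (h : ∀ ξ, ∑ i ∈ s, c i * ‖m i ξ‖ ^ 2 ≤ K * (1 + ‖ξ‖ ^ 2) ^ θ) :
    ∑ i ∈ s, c i * n2 (Op (m i) u) ^ 2 ≤ K * Hs θ u ^ 2 := by
  have hi : ∀ i ∈ s, Integrable (fun ξ => c i * ‖𝓕 (Op (m i) u) ξ‖ ^ 2) :=
    fun i _ => (int_sq _).const_mul _
  simp_rw [n2_sq_F, ← integral_const_mul, Hs_sq, ← integral_const_mul]
  rw [← integral_finsetSum s hi]
  apply integral_mono (integrable_finsetSum s hi) ((int_Hs θ u).const_mul K)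
  intro ξ
  simp only
  calc ∑ i ∈ s, c i * ‖𝓕 (Op (m i) u) ξ‖ ^ 2
      = (∑ i ∈ s, c i * ‖m i ξ‖ ^ 2) * ‖𝓕 u ξ‖ ^ 2 := by
        rw [Finset.sum_mul]; congr 1; ext i; rw [fourier_Op_apply, norm_mul]; ring
    _ ≤ _ := by rw [← mul_assoc]; gcongr; exact h ξ

/-- A single weighted bound. -/
lemma n2_Op_le_Hs (m u : Sch d) {K θ : ℝ} (hK : 0 ≤ K)
    (h : ∀ ξ, ‖m ξ‖ ^ 2 ≤ K ^ 2 * (1 + ‖ξ‖ ^ 2) ^ θ) :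
    n2 (Op m u) ≤ K * Hs θ u := by
  have := sum_n2_sq_le {()} (fun _ => m) (fun _ => 1) (K := K ^ 2) (θ := θ) u (by simpa using h)
  apply n2_le_of_sq (mul_nonneg hK (Hs_nonneg _ _))
  rw [mul_pow]
  simpa using this

lemma sum_E1_le {ι : Type*} (s : Finset ι) (m : ι → Sch d) (c : ι → ℝ) {K : ℝ}
    (u : Sch d) (h : ∀ ξ, ∑ i ∈ s, c i * (‖ξ‖ ^ 2 * ‖m i ξ‖ ^ 2) ≤ K) :
    ∑ i ∈ s, c i * E1 (Op (m i) u) ≤ K * n2 u ^ 2 := by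
  have hi : ∀ i ∈ s, Integrable (fun ξ => c i * (‖ξ‖ ^ 2 * ‖𝓕 (Op (m i) u) ξ‖ ^ 2)) :=
    fun i _ => (int_E1 _).const_mul _
  simp_rw [n2_sq_F, E1, ← integral_const_mul]
  rw [← integral_finsetSum s hi]
  apply integral_mono (integrable_finsetSum s hi) ((int_sq (𝓕 u)).const_mul K)
  intro ξ
  simp only
  calc ∑ i ∈ s, c i * (‖ξ‖ ^ 2 * ‖𝓕 (Op (m i) u) ξ‖ ^ 2)
      = (∑ i ∈ s, c i * (‖ξ‖ ^ 2 * ‖m i ξ‖ ^ 2)) * ‖𝓕 u ξ‖ ^ 2 := by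
        rw [Finset.sum_mul]; congr 1; ext i; rw [fourier_Op_apply, norm_mul]; ring
    _ ≤ _ := by gcongr; exact h ξ

/-! ### Almost orthogonality -/

lemma card_le_two (t : Finset ℕ) (h : ∀ i ∈ t, ∀ j ∈ t, i ≤ j + 1) : t.card ≤ 2 := by
  rcases t.eq_empty_or_nonempty with rfl | hne
  · simp
  · have hsub : t ⊆ {t.min' hne, t.min' hne + 1} := by
      intro i hi
      have h1 := Finset.min'_le t i hi
      have h2 := h i hi _ (Finset.min'_mem t hne)
      simp only [Finset.mem_insert, Finset.mem_singleton]; omega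
    exact (Finset.card_le_card hsub).trans Finset.card_le_two

lemma n2_sum_sq_le (s : Finset ℕ) (u : ℕ → Sch d)
    (h : ∀ ξ, ∀ i ∈ s, ∀ j ∈ s, 𝓕 (u i) ξ ≠ 0 → 𝓕 (u j) ξ ≠ 0 → i ≤ j + 1) :
    n2 (∑ i ∈ s, u i) ^ 2 ≤ 2 * ∑ i ∈ s, n2 (u i) ^ 2 := by
  have hi : ∀ i ∈ s, Integrable (fun ξ => ‖𝓕 (u i) ξ‖ ^ 2) := fun i _ => int_sq _
  simp_rw [n2_sq_F]
  rw [← integral_finsetSum s hi, ← integral_const_mul]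
  apply integral_mono (int_sq _) ((integrable_finsetSum s hi).const_mul _)
  intro ξ
  simp only
  classical
  set t := s.filter (fun i => 𝓕 (u i) ξ ≠ 0) with ht
  have hc : t.card ≤ 2 := by
    apply card_le_two
    intro i hi j hj
    rw [ht, Finset.mem_filter] at hi hj
    exact h ξ i hi.1 j hj.1 hi.2 hj.2
  have e1 : ∑ i ∈ s, 𝓕 (u i) ξ = ∑ i ∈ t, 𝓕 (u i) ξ := by
    rw [ht, Finset.sum_filter_ne_zero]
  rw [fourier_sum, e1]
  calc ‖∑ i ∈ t, 𝓕 (u i) ξ‖ ^ 2 ≤ (∑ i ∈ t, ‖𝓕 (u i) ξ‖) ^ 2 := by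
        gcongr; exact norm_sum_le _ _
    _ ≤ t.card * ∑ i ∈ t, ‖𝓕 (u i) ξ‖ ^ 2 := sq_sum_le_card_mul_sum_sq
    _ ≤ 2 * ∑ i ∈ s, ‖𝓕 (u i) ξ‖ ^ 2 := by
        gcongr
        · exact_mod_cast hc
        · exact Finset.filter_subset _ _

/-- Geometric sums. -/
lemma geo {q : ℝ} (hq : 0 < q) (hq1 : q ≠ 1) : ∃ K, 0 < K ∧ ∀ (t : Finset ℕ) (c : ℝ), 0 ≤ c →
    (∀ j ∈ t, q ^ j ≤ c) → ∑ j ∈ t, q ^ j ≤ K * c := by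
  rcases lt_or_gt_of_ne hq1 with h | h
  · refine ⟨(1 - q)⁻¹, by rw [inv_pos]; linarith, ?_⟩
    intro t c hc ht
    rcases t.eq_empty_or_nonempty with rfl | hne
    · simp; exact mul_nonneg (by rw [inv_nonneg]; linarith) hc
    · set a := t.min' hne
      have hsum := summable_geometric_of_lt_one hq.le h
      have h1 : ∑ j ∈ t, q ^ j = q ^ a * ∑ j ∈ t, q ^ (j - a) := by
        rw [Finset.mul_sum]
        apply Finset.sum_congr rfl
        intro j hj
        rw [← pow_add]; congr 1
        have := Finset.min'_le t j hj
        omega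
      have h2 : ∑ j ∈ t, q ^ (j - a) ≤ (1 - q)⁻¹ := by
        rw [← tsum_geometric_of_lt_one hq.le h]
        have : ∑ j ∈ t, q ^ (j - a) = ∑ i ∈ t.image (fun j => j - a), q ^ i := by
          rw [Finset.sum_image]
          intro x hx y hy hxy
          have := Finset.min'_le t x hx
          have := Finset.min'_le t y hy
          simp only at hxy
          omega
        rw [this]
        exact hsum.sum_le_tsum _ (fun _ _ => by positivity)
      rw [h1, mul_comm]
      have h3 := ht a (Finset.min'_mem t hne)
      have : 0 ≤ (1 - q)⁻¹ := by rw [inv_nonneg]; linarith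
      gcongr
  · refine ⟨q / (q - 1), by apply div_pos hq; linarith, ?_⟩
    intro t c hc ht
    have hq10 : 0 < q - 1 := by linarith
    rcases t.eq_empty_or_nonempty with rfl | hne
    · simp; positivity
    · set b := t.max' hne
      have h1 : ∑ j ∈ t, q ^ j ≤ ∑ j ∈ Finset.range (b + 1), q ^ j := by
        apply Finset.sum_le_sum_of_subset_of_nonneg
        · intro j hj
          have := Finset.le_max' t j hj
          simp only [Finset.mem_range]; omega
        · intros; positivity
      have h3 := ht b (Finset.max'_mem t hne)
      rw [geom_sum_eq hq1] at h1
      calc _ ≤ _ := h1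
        _ ≤ q ^ (b + 1) / (q - 1) := by gcongr; linarith
        _ = q / (q - 1) * q ^ b := by rw [pow_succ]; ring
        _ ≤ _ := by gcongr

end KP

namespace KP

variable {d : ℕ}

/-! ### Scaling -/

lemma ker_scale {m m' : Sch d} {l : ℝ} (hl : 0 < l) (h : ∀ ξ, m' ξ = m (l⁻¹ • ξ)) (z : V d) :
    ker m' z = ((l ^ d : ℝ) : ℂ) * ker m (l • z) := by
  rw [ker, ker, SchwartzMap.fourierInv_coe, SchwartzMap.fourierInv_coe, Real.fourierInv_eq',
    Real.fourierInv_eq']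
  have e : ∀ v : V d, Complex.exp (↑(2 * Real.pi * inner ℝ v z) * Complex.I) • m' v
      = (fun w : V d => Complex.exp (↑(2 * Real.pi * inner ℝ w (l • z)) * Complex.I) • m w)
        (l⁻¹ • v) := by
    intro v
    simp only [h]
    congr 5
    rw [inner_smul_left, inner_smul_right]
    simp
    field_simp
  simp_rw [e]
  rw [Measure.integral_comp_inv_smul volume (fun w : V d =>
    Complex.exp (↑(2 * Real.pi * inner ℝ w (l • z)) * Complex.I) • m w)]
  simp [abs_of_pos hl]

lemma W0_scale {m m' : Sch d} {l : ℝ} (hl : 0 < l) (h : ∀ ξ, m' ξ = m (l⁻¹ • ξ)) :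
    W0 m' = W0 m := by
  rw [W0, W0]
  simp_rw [ker_scale hl h, norm_mul]
  rw [integral_const_mul, Measure.integral_comp_smul volume (fun z => ‖ker m z‖)]
  simp [abs_of_pos hl]
  field_simp

lemma W1_scale {m m' : Sch d} {l : ℝ} (hl : 0 < l) (h : ∀ ξ, m' ξ = m (l⁻¹ • ξ)) :
    W1 m' = l⁻¹ * W1 m := by
  rw [W1, W1]
  have e : ∀ z : V d, ‖z‖ * ‖ker m' z‖ = (l ^ d * l⁻¹) *
      (fun w : V d => ‖w‖ * ‖ker m w‖) (l • z) := by
    intro z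
    simp only [ker_scale hl h, norm_mul, norm_smul, Real.norm_eq_abs, abs_of_pos hl]
    rw [Complex.norm_real, Real.norm_of_nonneg (by positivity)]
    field_simp
  simp_rw [e]
  rw [integral_const_mul, Measure.integral_comp_smul volume (fun w : V d => ‖w‖ * ‖ker m w‖)]
  simp [abs_of_pos hl]
  field_simp

/-! ### Making Schwartz functions out of bumps -/

/-- A real compactly supported smooth function as a Schwartz function. -/
def mkS (m : V d → ℝ) (h1 : ContDiff ℝ (⊤ : ℕ∞) m) (h2 : HasCompactSupport m) : Sch d :=
  HasCompactSupport.toSchwartzMap (f := fun ξ => (m ξ : ℂ))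
    (h2.comp_left (g := fun x : ℝ => (x : ℂ)) (by simp))
    (Complex.ofRealCLM.contDiff.comp h1)

@[simp] lemma mkS_apply (m : V d → ℝ) (h1 : ContDiff ℝ (⊤ : ℕ∞) m) (h2 : HasCompactSupport m)
    (ξ : V d) : mkS m h1 h2 ξ = (m ξ : ℂ) := rfl

lemma hcs_of {m : V d → ℝ} (R : ℝ) (h : ∀ ξ, m ξ ≠ 0 → ‖ξ‖ ≤ R) : HasCompactSupport m := by
  apply HasCompactSupport.of_support_subset_isCompact (isCompact_closedBall (0 : V d) R)
  intro ξ hξ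
  simpa using h ξ hξ

/-! ### The cutoffs -/

/-- angle function -/
def ang (ρ : ℝ) (ξ : V d) : ℝ :=
  Real.pi / 2 * Real.smoothTransition ((‖ξ‖ ^ 2 / ρ ^ 2 - 1) / 3)

/-- radial cutoff, `1` for `‖ξ‖ ≤ ρ`, `0` for `‖ξ‖ ≥ 2ρ`. -/
def cR (ρ : ℝ) (ξ : V d) : ℝ := Real.cos (ang ρ ξ)

/-- complementary cutoff -/
def sR (ρ : ℝ) (ξ : V d) : ℝ := Real.sin (ang ρ ξ)

lemma ang_contDiff (ρ : ℝ) : ContDiff ℝ (⊤ : ℕ∞) (ang ρ : V d → ℝ) := by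
  unfold ang
  apply contDiff_const.mul
  apply Real.smoothTransition.contDiff.comp
  exact (((contDiff_norm_sq ℝ).div_const _).sub contDiff_const).div_const _

lemma cR_contDiff (ρ : ℝ) : ContDiff ℝ (⊤ : ℕ∞) (cR ρ : V d → ℝ) :=
  Real.contDiff_cos.comp (ang_contDiff ρ)

lemma sR_contDiff (ρ : ℝ) : ContDiff ℝ (⊤ : ℕ∞) (sR ρ : V d → ℝ) :=
  Real.contDiff_sin.comp (ang_contDiff ρ)

lemma ang_small {ρ : ℝ} (hρ : 0 < ρ) {ξ : V d} (h : ‖ξ‖ ≤ ρ) : ang ρ ξ = 0 := by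
  rw [ang, Real.smoothTransition.zero_of_nonpos, mul_zero]
  have : ‖ξ‖ ^ 2 / ρ ^ 2 ≤ 1 := by
    rw [div_le_one (by positivity)]; gcongr
  linarith

lemma ang_big {ρ : ℝ} (hρ : 0 < ρ) {ξ : V d} (h : 2 * ρ ≤ ‖ξ‖) : ang ρ ξ = Real.pi / 2 := by
  rw [ang, Real.smoothTransition.one_of_one_le, mul_one]
  have : 4 ≤ ‖ξ‖ ^ 2 / ρ ^ 2 := by
    rw [le_div_iff₀ (by positivity)]; nlinarith
  linarith

lemma ang_mem (ρ : ℝ) (ξ : V d) : 0 ≤ ang ρ ξ ∧ ang ρ ξ ≤ Real.pi / 2 := by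
  have h0 := Real.smoothTransition.nonneg ((‖ξ‖ ^ 2 / ρ ^ 2 - 1) / 3)
  have h1 := Real.smoothTransition.le_one ((‖ξ‖ ^ 2 / ρ ^ 2 - 1) / 3)
  have hp := Real.pi_pos
  unfold ang
  constructor
  · positivity
  · nlinarith

lemma cR_one {ρ : ℝ} (hρ : 0 < ρ) {ξ : V d} (h : ‖ξ‖ ≤ ρ) : cR ρ ξ = 1 := by
  simp [cR, ang_small hρ h]
lemma sR_zero {ρ : ℝ} (hρ : 0 < ρ) {ξ : V d} (h : ‖ξ‖ ≤ ρ) : sR ρ ξ = 0 := by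
  simp [sR, ang_small hρ h]
lemma cR_zero {ρ : ℝ} (hρ : 0 < ρ) {ξ : V d} (h : 2 * ρ ≤ ‖ξ‖) : cR ρ ξ = 0 := by
  simp [cR, ang_big hρ h]
lemma cR_nonneg (ρ : ℝ) (ξ : V d) : 0 ≤ cR ρ ξ := by
  have := ang_mem ρ ξ
  exact Real.cos_nonneg_of_mem_Icc ⟨by linarith, this.2⟩
lemma cR_le (ρ : ℝ) (ξ : V d) : cR ρ ξ ≤ 1 := Real.cos_le_one _
lemma sR_le (ρ : ℝ) (ξ : V d) : sR ρ ξ ≤ 1 := Real.sin_le_one _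
lemma sR_nonneg (ρ : ℝ) (ξ : V d) : 0 ≤ sR ρ ξ := by
  have := ang_mem ρ ξ
  exact Real.sin_nonneg_of_nonneg_of_le_pi this.1 (by linarith)
lemma cR_sq_add (ρ : ℝ) (ξ : V d) : cR ρ ξ ^ 2 + sR ρ ξ ^ 2 = 1 := Real.cos_sq_add_sin_sq _

lemma cR_ne {ρ : ℝ} (hρ : 0 < ρ) {ξ : V d} (h : cR ρ ξ ≠ 0) : ‖ξ‖ ≤ 2 * ρ := by
  by_contra hc
  push Not at hc
  exact h (cR_zero hρ hc.le)
lemma sR_ne {ρ : ℝ} (hρ : 0 < ρ) {ξ : V d} (h : sR ρ ξ ≠ 0) : ρ ≤ ‖ξ‖ := by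
  by_contra hc
  push Not at hc
  exact h (sR_zero hρ hc.le)

lemma ang_scale {ρ l : ℝ} (hl : 0 < l) (ξ : V d) : ang (l * ρ) ξ = ang ρ (l⁻¹ • ξ) := by
  unfold ang
  rw [norm_smul, Real.norm_of_nonneg (by positivity)]
  congr 4
  field_simp
lemma cR_scale {ρ l : ℝ} (hl : 0 < l) (ξ : V d) : cR (l * ρ) ξ = cR ρ (l⁻¹ • ξ) := by
  rw [cR, cR, ang_scale hl]
lemma sR_scale {ρ l : ℝ} (hl : 0 < l) (ξ : V d) : sR (l * ρ) ξ = sR ρ (l⁻¹ • ξ) := by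
  rw [sR, sR, ang_scale hl]

/-- dyadic (base 16) scale -/
abbrev lam (k : ℕ) : ℝ := (16 : ℝ) ^ k

lemma lam_pos (k : ℕ) : 0 < lam k := by unfold lam; positivity

/-- real symbols -/
def phiR (k : ℕ) (ξ : V d) : ℝ := cR (lam k) ξ ^ 2
/-- square root of the annular symbol -/
def etaR : ℕ → V d → ℝ
  | 0, ξ => cR 1 ξ
  | (k + 1), ξ => cR (lam (k + 1)) ξ * sR (lam k) ξ
/-- fattened annular symbol -/
def chiR (k : ℕ) (ξ : V d) : ℝ := cR (4 * lam k) ξ * sR (lam k / 64) ξ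

lemma phiR_ne {k : ℕ} {ξ : V d} (h : phiR k ξ ≠ 0) : ‖ξ‖ ≤ 2 * lam k :=
  cR_ne (lam_pos k) (fun h0 => h (by simp [phiR, h0]))
lemma phiR_one {k : ℕ} {ξ : V d} (h : ‖ξ‖ ≤ lam k) : phiR k ξ = 1 := by
  simp [phiR, cR_one (lam_pos k) h]
lemma phiR_nonneg (k : ℕ) (ξ : V d) : 0 ≤ phiR k ξ := by unfold phiR; positivity
lemma phiR_le (k : ℕ) (ξ : V d) : phiR k ξ ≤ 1 := by
  unfold phiR; exact pow_le_one₀ (cR_nonneg _ _) (cR_le _ _)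

lemma etaR_ne {k : ℕ} {ξ : V d} (h : etaR k ξ ≠ 0) : ‖ξ‖ ≤ 2 * lam k := by
  cases k with
  | zero =>
    have := cR_ne one_pos h
    simpa using this
  | succ k => exact cR_ne (lam_pos _) (left_ne_zero_of_mul h)
lemma etaR_ne' {k : ℕ} {ξ : V d} (h : etaR (k + 1) ξ ≠ 0) : lam k ≤ ‖ξ‖ :=
  sR_ne (lam_pos _) (right_ne_zero_of_mul h)
lemma etaR_nonneg (k : ℕ) (ξ : V d) : 0 ≤ etaR k ξ := by
  cases k with
  | zero => exact cR_nonneg _ _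
  | succ k => exact mul_nonneg (cR_nonneg _ _) (sR_nonneg _ _)
lemma etaR_le (k : ℕ) (ξ : V d) : etaR k ξ ≤ 1 := by
  cases k with
  | zero => exact cR_le _ _
  | succ k => exact mul_le_one₀ (cR_le _ _) (sR_nonneg _ _) (sR_le _ _)

lemma chiR_ne {k : ℕ} {ξ : V d} (h : chiR k ξ ≠ 0) : lam k / 64 ≤ ‖ξ‖ ∧ ‖ξ‖ ≤ 8 * lam k := by
  have hl := lam_pos k
  constructor
  · exact sR_ne (by positivity) (right_ne_zero_of_mul h)
  · have := cR_ne (by positivity) (left_ne_zero_of_mul h)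
    linarith
lemma chiR_one {k : ℕ} {ξ : V d} (h1 : lam k / 32 ≤ ‖ξ‖) (h2 : ‖ξ‖ ≤ 4 * lam k) :
    chiR k ξ = 1 := by
  have hl := lam_pos k
  have e : sR (lam k / 64) ξ = 1 := by
    rw [sR, ang_big (by positivity) (by linarith), Real.sin_pi_div_two]
  rw [chiR, cR_one (by positivity) h2, e, one_mul]

lemma phiR_contDiff (k : ℕ) : ContDiff ℝ (⊤ : ℕ∞) (phiR k : V d → ℝ) := (cR_contDiff _).pow 2
lemma etaR_contDiff (k : ℕ) : ContDiff ℝ (⊤ : ℕ∞) (etaR k : V d → ℝ) := by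
  cases k with
  | zero => exact cR_contDiff _
  | succ k => exact (cR_contDiff _).mul (sR_contDiff _)
lemma chiR_contDiff (k : ℕ) : ContDiff ℝ (⊤ : ℕ∞) (chiR k : V d → ℝ) :=
  (cR_contDiff _).mul (sR_contDiff _)

lemma phiR_hcs (k : ℕ) : HasCompactSupport (phiR k : V d → ℝ) := hcs_of _ fun _ h => phiR_ne h
lemma etaR_hcs (k : ℕ) : HasCompactSupport (etaR k : V d → ℝ) := hcs_of _ fun _ h => etaR_ne h
lemma chiR_hcs (k : ℕ) : HasCompactSupport (chiR k : V d → ℝ) :=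
  hcs_of _ fun _ h => (chiR_ne h).2

/-- Schwartz versions -/
def phi (k : ℕ) : Sch d := mkS (phiR k) (phiR_contDiff k) (phiR_hcs k)
/-- Schwartz versions -/
def eta (k : ℕ) : Sch d := mkS (etaR k) (etaR_contDiff k) (etaR_hcs k)
/-- Schwartz versions -/
def psi (k : ℕ) : Sch d := mulS (eta k) (eta k)

lemma phi_apply (k : ℕ) (ξ : V d) : phi k ξ = (phiR k ξ : ℂ) := rfl
lemma eta_apply (k : ℕ) (ξ : V d) : eta k ξ = (etaR k ξ : ℂ) := rfl
lemma psi_apply (k : ℕ) (ξ : V d) : psi k ξ = ((etaR k ξ ^ 2 : ℝ) : ℂ) := by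
  simp [psi, eta_apply, sq]

lemma phiR_succ (k : ℕ) (ξ : V d) : phiR (k + 1) ξ = phiR k ξ + etaR (k + 1) ξ ^ 2 := by
  have h := cR_sq_add (lam k) ξ
  simp only [phiR, etaR]
  by_cases h0 : cR (lam k) ξ = 0
  · rw [h0] at h ⊢
    have : sR (lam k) ξ ^ 2 = 1 := by linarith
    rw [mul_pow, this]; ring
  · have h1 := cR_ne (lam_pos k) h0
    have h2 : cR (lam (k + 1)) ξ = 1 := by
      apply cR_one (lam_pos _)
      have := lam_pos k
      rw [lam, pow_succ]; linarith
    rw [h2]; linarith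

lemma phiR_zero (ξ : V d) : phiR 0 ξ = etaR 0 ξ ^ 2 := by
  simp [phiR, etaR]

lemma phi_succ (k : ℕ) : (phi (k + 1) : Sch d) = phi k + psi (k + 1) := by
  ext ξ
  simp only [_root_.add_apply, phi_apply, psi_apply, phiR_succ]
  push_cast; rfl

lemma phi_zero : (phi 0 : Sch d) = psi 0 := by
  ext ξ
  simp only [phi_apply, psi_apply, phiR_zero]

lemma W_phi (k : ℕ) : W0 (phi k : Sch d) = W0 (phi 0 : Sch d) ∧
    W1 (phi k : Sch d) = (lam k)⁻¹ * W1 (phi 0 : Sch d) := by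
  have h : ∀ ξ : V d, phi k ξ = phi 0 ((lam k)⁻¹ • ξ) := by
    intro ξ
    have := cR_scale (ρ := 1) (lam_pos k) ξ
    rw [mul_one] at this
    simp [phi_apply, phiR, this]
  exact ⟨W0_scale (lam_pos k) h, W1_scale (lam_pos k) h⟩

lemma W_eta (k : ℕ) : W0 (eta (k + 1) : Sch d) = W0 (eta 1 : Sch d) ∧
    W1 (eta (k + 1) : Sch d) = (lam k)⁻¹ * W1 (eta 1 : Sch d) := by
  have h : ∀ ξ : V d, eta (k + 1) ξ = eta 1 ((lam k)⁻¹ • ξ) := by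
    intro ξ
    have h1 := cR_scale (ρ := 1) (lam_pos k) ξ
    have h2 := sR_scale (ρ := 1) (lam_pos k) ξ
    have h3 := cR_scale (ρ := 16) (lam_pos k) ξ
    rw [mul_one] at h1 h2
    simp [eta_apply, etaR, h2, ← h3, lam, pow_succ]
  exact ⟨W0_scale (lam_pos k) h, W1_scale (lam_pos k) h⟩

end KP

namespace KP

variable {d : ℕ}

/-! ### Littlewood-Paley pieces -/

/-- low frequency part -/
def S (k : ℕ) (u : Sch d) : Sch d := Op (phi k) u
/-- annular part -/
def Dl (k : ℕ) (u : Sch d) : Sch d := Op (psi k) u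
/-- "square root" annular part -/
def P (k : ℕ) (u : Sch d) : Sch d := Op (eta k) u

lemma P_P (k : ℕ) (u : Sch d) : P k (P k u) = Dl k u := Op_Op _ _ _

lemma S_succ (k : ℕ) (u : Sch d) : S (k + 1) u = S k u + Dl (k + 1) u := by
  rw [S, phi_succ, add_Op]; rfl

lemma S_zero (u : Sch d) : S 0 u = Dl 0 u := by rw [S, phi_zero]; rfl

lemma lam_succ (k : ℕ) : lam (k + 1) = 16 * lam k := by rw [lam, pow_succ, mul_comm]

lemma spec_S {k : ℕ} {u : Sch d} {ξ : V d} (h : 𝓕 (S k u) ξ ≠ 0) : ‖ξ‖ ≤ 2 * lam k := by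
  rw [S, fourier_Op_apply, phi_apply] at h
  exact phiR_ne (by exact_mod_cast left_ne_zero_of_mul h)

lemma spec_P {k : ℕ} {u : Sch d} {ξ : V d} (h : 𝓕 (P k u) ξ ≠ 0) : ‖ξ‖ ≤ 2 * lam k := by
  rw [P, fourier_Op_apply, eta_apply] at h
  exact etaR_ne (by exact_mod_cast left_ne_zero_of_mul h)

lemma spec_P' {k : ℕ} {u : Sch d} {ξ : V d} (h : 𝓕 (P (k + 1) u) ξ ≠ 0) : lam k ≤ ‖ξ‖ := by
  rw [P, fourier_Op_apply, eta_apply] at h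
  exact etaR_ne' (by exact_mod_cast left_ne_zero_of_mul h)

lemma spec_D {k : ℕ} {u : Sch d} {ξ : V d} (h : 𝓕 (Dl k u) ξ ≠ 0) : ‖ξ‖ ≤ 2 * lam k := by
  rw [← P_P] at h; exact spec_P h

lemma spec_D' {k : ℕ} {u : Sch d} {ξ : V d} (h : 𝓕 (Dl (k + 1) u) ξ ≠ 0) : lam k ≤ ‖ξ‖ := by
  rw [← P_P] at h; exact spec_P' h

lemma paraproduct (f g : Sch d) (N : ℕ) : mulS (S N f) (S (N + 1) g) =
    ∑ k ∈ Finset.range N, mulS (S k f) (Dl (k + 2) g)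
      + ∑ j ∈ Finset.range (N + 1), mulS (Dl j f) (S (j + 1) g) := by
  induction N with
  | zero => simp [S_zero]
  | succ N ih =>
    rw [Finset.sum_range_succ, Finset.sum_range_succ _ (N + 1), S_succ N f, add_mulS,
      S_succ (N + 1) g, mulS_add, ih]
    abel

/-- The product of a low frequency and an annular function is annular. -/
lemma ann_mul {u v : Sch d} {k : ℕ} (hu : ∀ ξ, 𝓕 u ξ ≠ 0 → ‖ξ‖ ≤ 2 * lam k)
    (hv : ∀ ξ, 𝓕 v ξ ≠ 0 → lam (k + 1) ≤ ‖ξ‖ ∧ ‖ξ‖ ≤ 2 * lam (k + 2)) (ξ : V d)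
    (h : 𝓕 (mulS u v) ξ ≠ 0) : 14 * lam k ≤ ‖ξ‖ ∧ ‖ξ‖ ≤ 514 * lam k := by
  obtain ⟨a, b, rfl, ha, hb⟩ := fourier_mulS_ne h
  have h1 := hu a ha
  have h2 := hv b hb
  rw [lam_succ (k + 1), lam_succ k] at h2
  have h3 := norm_add_le a b
  have h4 := norm_sub_le (a + b) a
  rw [add_sub_cancel_left] at h4
  constructor <;> linarith

lemma lam_mono {i j : ℕ} (h : i ≤ j) : lam i ≤ lam j := pow_le_pow_right₀ (by norm_num) h

lemma ann_sep {i j : ℕ} {x : ℝ} (h1 : 14 * lam i ≤ x) (h2 : x ≤ 514 * lam j) : i ≤ j + 1 := by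
  by_contra hc
  push Not at hc
  have := lam_mono (show j + 2 ≤ i by omega)
  rw [lam_succ, lam_succ] at this
  have := lam_pos j
  linarith

/-! ### Weights -/

lemma wt (θ : ℝ) {k : ℕ} {ξ : V d} (h : etaR k ξ ≠ 0) :
    (lam k ^ θ) ^ 2 ≤ (256 : ℝ) ^ |θ| * (1 + ‖ξ‖ ^ 2) ^ θ := by
  have hl := lam_pos k
  have h1 := etaR_ne h
  have hk1 : 1 ≤ lam k := one_le_pow₀ (by norm_num)
  have up : lam k ^ 2 ≤ 256 * (1 + ‖ξ‖ ^ 2) := by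
    cases k with
    | zero => simp; nlinarith [sq_nonneg ‖ξ‖]
    | succ k =>
      have h2 := etaR_ne' h
      rw [lam_succ]
      have := lam_pos k
      nlinarith
  have lo : (1 + ‖ξ‖ ^ 2) / 256 ≤ lam k ^ 2 := by
    have : ‖ξ‖ ^ 2 ≤ (2 * lam k) ^ 2 := by gcongr
    nlinarith
  have e : (lam k ^ θ) ^ 2 = (lam k ^ 2) ^ θ := by
    rw [← Real.rpow_natCast (lam k) 2, ← Real.rpow_mul hl.le, ← Real.rpow_natCast,
      ← Real.rpow_mul hl.le, mul_comm]
  rw [e]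
  rcases le_total 0 θ with h0 | h0
  · rw [abs_of_nonneg h0, ← Real.mul_rpow (by norm_num) (by positivity)]
    exact Real.rpow_le_rpow (by positivity) up h0
  · rw [abs_of_nonpos h0]
    have h3 := Real.rpow_le_rpow_of_nonpos (by positivity) lo h0
    refine h3.trans (le_of_eq ?_)
    rw [Real.div_rpow (by positivity) (by norm_num), Real.rpow_neg (by norm_num), div_eq_inv_mul]

lemma eta_sep {i j : ℕ} {ξ : V d} (hi : etaR i ξ ≠ 0) (hj : etaR j ξ ≠ 0) : i ≤ j + 1 := by
  by_contra hc
  push Not at hc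
  obtain ⟨i, rfl⟩ : ∃ i', i = i' + 1 := ⟨i - 1, by omega⟩
  have h1 := etaR_ne' hi
  have h2 := etaR_ne hj
  have := lam_mono (show j + 1 ≤ i by omega)
  rw [lam_succ] at this
  have := lam_pos j
  linarith

lemma sqsum (θ : ℝ) (s : Finset ℕ) (m : ℕ → Sch d) (u : Sch d)
    (hm : ∀ k ∈ s, ∀ ξ, ‖m k ξ‖ ≤ etaR k ξ) :
    ∑ k ∈ s, (lam k ^ θ) ^ 2 * n2 (Op (m k) u) ^ 2 ≤ (2 * (256 : ℝ) ^ |θ|) * Hs θ u ^ 2 := by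
  apply sum_n2_sq_le
  intro ξ
  classical
  set t := s.filter (fun k => etaR k ξ ≠ 0) with ht
  have hc : t.card ≤ 2 := by
    apply card_le_two
    intro i hi j hj
    rw [ht, Finset.mem_filter] at hi hj
    exact eta_sep hi.2 hj.2
  have e : ∑ k ∈ s, (lam k ^ θ) ^ 2 * ‖m k ξ‖ ^ 2 = ∑ k ∈ t, (lam k ^ θ) ^ 2 * ‖m k ξ‖ ^ 2 := by
    symm
    apply Finset.sum_subset (Finset.filter_subset _ _)
    intro k hk hkt
    have h0 : etaR k ξ = 0 := by
      by_contra h0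
      exact hkt (Finset.mem_filter.2 ⟨hk, h0⟩)
    have := hm k hk ξ
    rw [h0] at this
    have h1 : ‖m k ξ‖ = 0 := le_antisymm this (norm_nonneg _)
    rw [h1]; simp
  rw [e]
  calc ∑ k ∈ t, (lam k ^ θ) ^ 2 * ‖m k ξ‖ ^ 2
      ≤ ∑ k ∈ t, (256 : ℝ) ^ |θ| * (1 + ‖ξ‖ ^ 2) ^ θ := by
        apply Finset.sum_le_sum
        intro k hk
        rw [ht, Finset.mem_filter] at hk
        have h1 := wt θ hk.2
        have h2 : ‖m k ξ‖ ^ 2 ≤ 1 :=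
          pow_le_one₀ (norm_nonneg _) ((hm k hk.1 ξ).trans (etaR_le _ _))
        calc _ ≤ (lam k ^ θ) ^ 2 * 1 := by gcongr
          _ ≤ _ := by rw [mul_one]; exact h1
    _ = t.card * ((256 : ℝ) ^ |θ| * (1 + ‖ξ‖ ^ 2) ^ θ) := by simp
    _ ≤ 2 * ((256 : ℝ) ^ |θ| * (1 + ‖ξ‖ ^ 2) ^ θ) := by gcongr; exact_mod_cast hc
    _ = _ := by ring

lemma norm_eta (k : ℕ) (ξ : V d) : ‖(eta k : Sch d) ξ‖ = etaR k ξ := by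
  rw [eta_apply, Complex.norm_real, Real.norm_of_nonneg (etaR_nonneg _ _)]

lemma norm_psi_le (k : ℕ) (ξ : V d) : ‖(psi k : Sch d) ξ‖ ≤ etaR k ξ := by
  rw [psi_apply, Complex.norm_real, Real.norm_of_nonneg (by positivity), sq]
  exact mul_le_of_le_one_left (etaR_nonneg _ _) (etaR_le _ _)

lemma sqsum_D (θ : ℝ) (s : Finset ℕ) (u : Sch d) :
    ∑ k ∈ s, (lam k ^ θ) ^ 2 * n2 (Dl k u) ^ 2 ≤ (2 * (256 : ℝ) ^ |θ|) * Hs θ u ^ 2 :=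
  sqsum θ s psi u fun k _ ξ => norm_psi_le k ξ

lemma sqsum_P (θ : ℝ) (s : Finset ℕ) (u : Sch d) :
    ∑ k ∈ s, (lam k ^ θ) ^ 2 * n2 (P k u) ^ 2 ≤ (2 * (256 : ℝ) ^ |θ|) * Hs θ u ^ 2 :=
  sqsum θ s eta u fun k _ ξ => (norm_eta k ξ).le

/-- Constant. -/
def Kθ (θ : ℝ) : ℝ := 2 * (256 : ℝ) ^ |θ|

lemma Kθ_pos (θ : ℝ) : 0 < Kθ θ := by unfold Kθ; positivity
lemma Kθ_one (θ : ℝ) : 1 ≤ Kθ θ := by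
  unfold Kθ
  have : (1:ℝ) ≤ (256 : ℝ) ^ |θ| := Real.one_le_rpow (by norm_num) (abs_nonneg _)
  linarith

lemma n2_D_le (θ : ℝ) (k : ℕ) (u : Sch d) : lam k ^ θ * n2 (Dl k u) ≤ Kθ θ * Hs θ u := by
  have h := sqsum_D θ {k} u
  rw [Finset.sum_singleton, ← mul_pow] at h
  have h1 := Kθ_one θ
  apply le_of_sq_le_sq _ (mul_nonneg (Kθ_pos _).le (Hs_nonneg _ _))
  refine h.trans ?_
  change Kθ θ * _ ≤ _
  rw [mul_pow, sq (Kθ θ)]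
  gcongr
  nlinarith

/-- The basic bound for sums of annular terms. -/
lemma ann_bound (θ : ℝ) (N : ℕ) (u : ℕ → Sch d) (v : Sch d) {c : ℝ} (hc : 0 ≤ c)
    (ha : ∀ k < N, ∀ ξ, 𝓕 (u k) ξ ≠ 0 → 14 * lam k ≤ ‖ξ‖ ∧ ‖ξ‖ ≤ 514 * lam k)
    (hb : ∀ k < N, n2 (u k) ≤ c * (lam (k + 2) ^ θ * n2 (Dl (k + 2) v))) :
    n2 (∑ k ∈ Finset.range N, u k) ≤ 2 * Kθ θ * c * Hs θ v := by
  have hK := Kθ_one θ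
  have hH := Hs_nonneg θ v
  apply n2_le_of_sq (by positivity)
  calc n2 (∑ k ∈ Finset.range N, u k) ^ 2 ≤ 2 * ∑ k ∈ Finset.range N, n2 (u k) ^ 2 := by
        apply n2_sum_sq_le
        intro ξ i hi j hj h1 h2
        exact ann_sep (ha i (Finset.mem_range.1 hi) ξ h1).1 (ha j (Finset.mem_range.1 hj) ξ h2).2
    _ ≤ 2 * ∑ k ∈ Finset.range N, c ^ 2 * ((lam (k + 2) ^ θ) ^ 2 * n2 (Dl (k + 2) v) ^ 2) := by
        gcongr with k hk
        rw [← mul_pow, ← mul_pow]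
        exact pow_le_pow_left₀ (n2_nonneg _) (hb k (Finset.mem_range.1 hk)) 2
    _ = 2 * c ^ 2 * ∑ k ∈ (Finset.range N).image (fun k => k + 2),
          (lam k ^ θ) ^ 2 * n2 (Dl k v) ^ 2 := by
        rw [Finset.sum_image (by intro a _ b _ h; simpa using h), ← Finset.mul_sum, mul_assoc]
    _ ≤ 2 * c ^ 2 * (Kθ θ * Hs θ v ^ 2) := by
        gcongr; exact sqsum_D θ _ v
    _ ≤ _ := by
        have : Kθ θ ≤ Kθ θ ^ 2 := by nlinarith
        calc _ ≤ 2 * c ^ 2 * (Kθ θ ^ 2 * Hs θ v ^ 2) := by gcongr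
          _ ≤ 4 * c ^ 2 * (Kθ θ ^ 2 * Hs θ v ^ 2) := by gcongr; norm_num
          _ = _ := by ring

/-! ### The term II for `s > 0` -/

lemma termII {s : ℝ} (hs : 0 < s) : ∃ K, 0 < K ∧ ∀ (N : ℕ) (m : Sch d) (u : ℕ → Sch d) (v : Sch d)
    (c : ℝ), 0 ≤ c → (∀ ξ, ‖m ξ‖ ^ 2 ≤ (1 + ‖ξ‖ ^ 2) ^ s) →
    (∀ j < N, ∀ ξ, 𝓕 (u j) ξ ≠ 0 → ‖ξ‖ ≤ 64 * lam j) →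
    (∀ j < N, n2 (u j) ≤ c * n2 (Dl j v)) →
    n2 (Op m (∑ j ∈ Finset.range N, u j)) ≤ K * c * Hs s v := by
  have hq : (0:ℝ) < ((16:ℝ) ^ (2 * s))⁻¹ := by positivity
  have hq1 : ((16:ℝ) ^ (2 * s))⁻¹ ≠ 1 := by
    have : (1:ℝ) < (16:ℝ) ^ (2 * s) := Real.one_lt_rpow (by norm_num) (by linarith)
    exact (inv_lt_one_of_one_lt₀ this).ne
  obtain ⟨K, hK, hgeo⟩ := geo hq hq1
  set M : ℝ := K * (5000 : ℝ) ^ s with hM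
  have hMp : 0 < M := by positivity
  refine ⟨Real.sqrt (M * Kθ s), by have := Kθ_pos s; positivity, ?_⟩
  intro N m u v c hc hm hsp hb
  have hwpos : ∀ j, 0 < lam j ^ s := fun j => Real.rpow_pos_of_pos (lam_pos j) s
  have hqj : ∀ j : ℕ, (((16:ℝ) ^ (2 * s))⁻¹) ^ j = ((lam j ^ s) ^ 2)⁻¹ := by
    intro j
    rw [inv_pow]; congr 1
    rw [← Real.rpow_natCast ((16:ℝ) ^ (2 * s)), ← Real.rpow_mul (by norm_num),
      ← Real.rpow_natCast (lam j ^ s), ← Real.rpow_mul (lam_pos j).le, lam,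
      ← Real.rpow_natCast (16:ℝ) j, ← Real.rpow_mul (by norm_num)]
    congr 1; push_cast; ring
  have key : ∀ ξ, ‖𝓕 (Op m (∑ j ∈ Finset.range N, u j)) ξ‖ ^ 2
      ≤ M * ∑ j ∈ Finset.range N, (lam j ^ s) ^ 2 * ‖𝓕 (u j) ξ‖ ^ 2 := by
    intro ξ
    classical
    set t := (Finset.range N).filter (fun j => 𝓕 (u j) ξ ≠ 0) with ht
    have e1 : ∑ i ∈ Finset.range N, 𝓕 (u i) ξ = ∑ i ∈ t, 𝓕 (u i) ξ := by
      rw [ht, Finset.sum_filter_ne_zero]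
    rw [fourier_Op_apply, fourier_sum, e1, norm_mul, mul_pow]
    have hy : 0 < 1 + ‖ξ‖ ^ 2 := by positivity
    have hg : ∑ j ∈ t, (((16:ℝ) ^ (2 * s))⁻¹) ^ j ≤ K * ((5000:ℝ) ^ s * ((1 + ‖ξ‖ ^ 2) ^ s)⁻¹) := by
      apply hgeo t _ (by positivity)
      intro j hj
      rw [ht, Finset.mem_filter, Finset.mem_range] at hj
      have h1 := hsp j hj.1 ξ hj.2
      have h2 : 1 + ‖ξ‖ ^ 2 ≤ 5000 * lam j ^ 2 := by
        have : 1 ≤ lam j := one_le_pow₀ (by norm_num)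
        have : ‖ξ‖ ^ 2 ≤ (64 * lam j) ^ 2 := by gcongr
        nlinarith
      rw [hqj, ← div_eq_mul_inv, inv_le_comm₀ (by have := hwpos j; positivity) (by positivity),
        inv_div, div_le_iff₀ (by positivity)]
      have e : (lam j ^ s) ^ 2 = (lam j ^ 2) ^ s := by
        rw [← Real.rpow_natCast (lam j) 2, ← Real.rpow_mul (lam_pos j).le, ← Real.rpow_natCast,
          ← Real.rpow_mul (lam_pos j).le, mul_comm]
      rw [e, mul_comm, ← Real.mul_rpow (by norm_num) (by positivity)]
      exact Real.rpow_le_rpow hy.le h2 hs.le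
    have hcs : (∑ j ∈ t, ‖𝓕 (u j) ξ‖) ^ 2
        ≤ (∑ j ∈ t, (((16:ℝ) ^ (2 * s))⁻¹) ^ j) * ∑ j ∈ t, (lam j ^ s) ^ 2 * ‖𝓕 (u j) ξ‖ ^ 2 := by
      have := Finset.sum_mul_sq_le_sq_mul_sq t (fun j => (lam j ^ s)⁻¹)
        (fun j => lam j ^ s * ‖𝓕 (u j) ξ‖)
      have e2 : ∀ j, (lam j ^ s)⁻¹ * (lam j ^ s * ‖𝓕 (u j) ξ‖) = ‖𝓕 (u j) ξ‖ := by
        intro j; have := hwpos j; field_simp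
      simp only [e2, mul_pow, inv_pow] at this
      simpa only [hqj] using this
    have hle : ∑ j ∈ t, (lam j ^ s) ^ 2 * ‖𝓕 (u j) ξ‖ ^ 2
        ≤ ∑ j ∈ Finset.range N, (lam j ^ s) ^ 2 * ‖𝓕 (u j) ξ‖ ^ 2 := by
      apply Finset.sum_le_sum_of_subset_of_nonneg (Finset.filter_subset _ _)
      intros; positivity
    have hYs : 0 < (1 + ‖ξ‖ ^ 2) ^ s := Real.rpow_pos_of_pos hy s
    calc ‖m ξ‖ ^ 2 * ‖∑ i ∈ t, 𝓕 (u i) ξ‖ ^ 2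
        ≤ (1 + ‖ξ‖ ^ 2) ^ s * (∑ i ∈ t, ‖𝓕 (u i) ξ‖) ^ 2 := by
          gcongr
          · exact hm ξ
          · exact norm_sum_le _ _
      _ ≤ (1 + ‖ξ‖ ^ 2) ^ s * (K * ((5000:ℝ) ^ s * ((1 + ‖ξ‖ ^ 2) ^ s)⁻¹) *
            ∑ j ∈ Finset.range N, (lam j ^ s) ^ 2 * ‖𝓕 (u j) ξ‖ ^ 2) := by
          gcongr
          refine hcs.trans ?_
          gcongr
      _ = _ := by rw [hM]; field_simp
  have hi : ∀ j ∈ Finset.range N, Integrable (fun ξ => (lam j ^ s) ^ 2 * ‖𝓕 (u j) ξ‖ ^ 2) :=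
    fun i _ => (int_sq _).const_mul _
  have h1 : n2 (Op m (∑ j ∈ Finset.range N, u j)) ^ 2
      ≤ M * ∑ j ∈ Finset.range N, (lam j ^ s) ^ 2 * n2 (u j) ^ 2 := by
    simp_rw [n2_sq_F, ← integral_const_mul]
    rw [← integral_finsetSum _ hi, ← integral_const_mul]
    exact integral_mono (int_sq _) ((integrable_finsetSum _ hi).const_mul _) key
  apply n2_le_of_sq (by have := Hs_nonneg s v; positivity)
  rw [mul_pow, mul_pow, Real.sq_sqrt (by have := Kθ_pos s; positivity)]
  calc _ ≤ _ := h1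
    _ ≤ M * ∑ j ∈ Finset.range N, c ^ 2 * ((lam j ^ s) ^ 2 * n2 (Dl j v) ^ 2) := by
        refine mul_le_mul_of_nonneg_left (Finset.sum_le_sum fun j hj => ?_) hMp.le
        rw [mul_left_comm, ← mul_pow c]
        refine mul_le_mul_of_nonneg_left ?_ (by positivity)
        exact pow_le_pow_left₀ (n2_nonneg _) (hb j (Finset.mem_range.1 hj)) 2
    _ = M * c ^ 2 * ∑ j ∈ Finset.range N, ((lam j ^ s) ^ 2 * n2 (Dl j v) ^ 2) := by
        rw [← Finset.mul_sum]; ring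
    _ ≤ M * c ^ 2 * (Kθ s * Hs s v ^ 2) := by gcongr; exact sqsum_D s _ v
    _ = _ := by ring

end KP

namespace KP

variable {d : ℕ}

open ComplexConjugate

/-! ### Parseval and localization -/

lemma parseval (u w : Sch d) : ∫ x, u x * w x = ∫ ξ, 𝓕 u ξ * 𝓕 w (-ξ) := by
  have h := SchwartzMap.integral_fourier_mul_eq u (𝓕⁻ w)
  simp only [FourierTransform.fourier_fourierInv_eq, fourierInv_eq_fourier_neg] at h
  exact h.symm

lemma pair_Op (m u w : Sch d) (hm : ∀ ξ, m (-ξ) = m ξ) :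
    ∫ x, Op m u x * w x = ∫ x, u x * Op m w x := by
  rw [parseval, parseval]
  congr 1; ext ξ
  rw [fourier_Op_apply, fourier_Op_apply, hm]; ring

lemma pair_loc (m v h : Sch d) (hm : ∀ ξ, m (-ξ) = m ξ) (hv : ∀ ξ, 𝓕 v ξ ≠ 0 → m ξ = 1) :
    ∫ x, v x * h x = ∫ x, v x * Op m h x := by
  rw [← pair_Op m v h hm, Op_eq_self hv]

lemma ang_neg (ρ : ℝ) (ξ : V d) : ang ρ (-ξ) = ang ρ ξ := by simp [ang]
lemma phi_even (k : ℕ) (ξ : V d) : (phi k : Sch d) (-ξ) = phi k ξ := by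
  simp [phi_apply, phiR, cR, ang_neg]
lemma eta_even (k : ℕ) (ξ : V d) : (eta k : Sch d) (-ξ) = eta k ξ := by
  cases k <;> simp [eta_apply, etaR, cR, sR, ang_neg]
lemma psi_even (k : ℕ) (ξ : V d) : (psi k : Sch d) (-ξ) = psi k ξ := by
  simp [psi, eta_even]

lemma Op_conjS (m u : Sch d) (hm : ∀ ξ, m (-ξ) = m ξ) (hr : ∀ ξ, conj (m ξ) = m ξ) :
    Op m (conjS u) = conjS (Op m u) := by
  apply ext_fourier; intro ξ
  rw [fourier_Op_apply, fourier_conjS, fourier_conjS, fourier_Op_apply, map_mul, hr, hm]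

lemma S_conjS (k : ℕ) (u : Sch d) : S k (conjS u) = conjS (S k u) :=
  Op_conjS _ _ (phi_even k) (fun ξ => by simp [phi_apply])
lemma P_conjS (k : ℕ) (u : Sch d) : P k (conjS u) = conjS (P k u) :=
  Op_conjS _ _ (eta_even k) (fun ξ => by simp [eta_apply])
lemma D_conjS (k : ℕ) (u : Sch d) : Dl k (conjS u) = conjS (Dl k u) := by
  rw [← P_P, P_conjS, P_conjS, P_P]

lemma spec_conjS {u : Sch d} {ξ : V d} (h : 𝓕 (conjS u) ξ ≠ 0) : 𝓕 u (-ξ) ≠ 0 := by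
  rw [fourier_conjS] at h
  simpa using h

lemma Op_tr (m u : Sch d) (z : V d) : Op m (tr z u) = tr z (Op m u) := by
  apply ext_fourier; intro ξ
  simp only [fourier_Op_apply, fourier_tr]; ring

/-- `|u|²` -/
def sqS (u : Sch d) : Sch d := mulS u (conjS u)

lemma sqS_apply (u : Sch d) (x : V d) : sqS u x = ((‖u x‖ ^ 2 : ℝ) : ℂ) := by
  simp [sqS, Complex.mul_conj, Complex.normSq_eq_norm_sq]

/-! ### L¹ commutator estimate -/

lemma comm_apply (m f g : Sch d) (x : V d) :
    comm m f g x = ∫ z, ker m z * (f (x - z) - f x) * g (x - z) := by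
  have : ∀ z, ker m z * (f (x - z) - f x) * g (x - z)
      = ker m z * (mulS f g) (x - z) - f x * (ker m z * g (x - z)) := by
    intro z; simp; ring
  simp_rw [this]
  rw [integral_sub (int_Op m _ x) ((int_Op m g x).const_mul _), integral_const_mul,
    ← Op_apply, ← Op_apply]
  simp [comm]

lemma norm_pair_le (u v : Sch d) : ‖∫ x, u x * v x‖ ≤ n2 u * n2 v := by
  refine (norm_integral_le_integral_norm _).trans ?_
  simp_rw [norm_mul]
  exact cs u v

lemma L1comm (m h a : Sch d) :
    ∫ x, ‖comm m h a x‖ ≤ W1 m * (2 * Real.pi * Real.sqrt (E1 h) * n2 a) := by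
  obtain ⟨B, hB, hh⟩ := exists_bdd h
  have hInteg : Integrable (fun p : V d × V d => ‖ker m p.2 * (h (p.1 - p.2) - h p.1) * a (p.1 - p.2)‖)
      (volume.prod volume) := by
    have h1 := (((ker m).integrable (μ := volume)).convolution_integrand
      (ContinuousLinearMap.mul ℝ ℂ) ((a).integrable (μ := volume)))
    apply (h1.norm.const_mul (2 * B)).mono'
    · apply Continuous.aestronglyMeasurable
      have := h.continuous
      have := a.continuous
      have := (ker m).continuous
      fun_prop
    · filter_upwards with p
      rw [norm_norm]
      simp only [ContinuousLinearMap.mul_apply', norm_mul]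
      have h2 : ‖h (p.1 - p.2) - h p.1‖ ≤ 2 * B :=
        (norm_sub_le _ _).trans (by have := hh (p.1 - p.2); have := hh p.1; linarith)
      calc ‖ker m p.2‖ * ‖h (p.1 - p.2) - h p.1‖ * ‖a (p.1 - p.2)‖
          ≤ ‖ker m p.2‖ * (2 * B) * ‖a (p.1 - p.2)‖ := by gcongr
        _ = _ := by ring
  calc ∫ x, ‖comm m h a x‖
      ≤ ∫ x, ∫ z, ‖ker m z * (h (x - z) - h x) * a (x - z)‖ := by
        apply integral_mono (comm m h a).integrable.norm hInteg.integral_prod_left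
        intro x
        simp only [comm_apply]
        exact norm_integral_le_integral_norm _
    _ = ∫ z, ∫ x, ‖ker m z * (h (x - z) - h x) * a (x - z)‖ := integral_integral_swap hInteg
    _ ≤ ∫ z, (‖z‖ * ‖ker m z‖) * (2 * Real.pi * Real.sqrt (E1 h) * n2 a) := by
        apply integral_mono hInteg.integral_prod_right ((int_W1 m).mul_const _)
        intro z
        simp only
        have e : ∀ x, ‖ker m z * (h (x - z) - h x) * a (x - z)‖
            = ‖ker m z‖ * (‖(tr z h - h) x‖ * ‖tr z a x‖) := by
          intro x; simp [mul_assoc]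
        simp_rw [e]
        rw [integral_const_mul]
        have h1 := cs (tr z h - h) (tr z a)
        have h2 := n2_tr_sub z h
        rw [n2_tr] at h1
        have h3 : n2 (tr z h - h) * n2 a ≤ 2 * Real.pi * ‖z‖ * Real.sqrt (E1 h) * n2 a :=
          mul_le_mul_of_nonneg_right h2 (n2_nonneg _)
        calc _ ≤ ‖ker m z‖ * (2 * Real.pi * ‖z‖ * Real.sqrt (E1 h) * n2 a) :=
              mul_le_mul_of_nonneg_left (h1.trans h3) (norm_nonneg _)
          _ = _ := by ring
    _ = _ := by rw [integral_mul_const, W1]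

/-! ### Summation lemma -/

lemma lemX : ∃ K, 0 < K ∧ ∀ (M : ℕ) (h : Sch d),
    ∑ k ∈ Finset.range M, ((lam k)⁻¹) ^ 2 * E1 (S (k + 4) h) ≤ K * n2 h ^ 2 := by
  obtain ⟨K, hK, hgeo⟩ := geo (q := (256:ℝ)⁻¹) (by norm_num) (by norm_num)
  refine ⟨K * (2 * 65536) ^ 2, by positivity, ?_⟩
  intro M h
  apply sum_E1_le
  intro ξ
  classical
  set t := (Finset.range M).filter (fun j => phiR (j + 4) ξ ≠ 0) with ht
  have hq : ∀ j : ℕ, ((256:ℝ)⁻¹) ^ j = ((lam j)⁻¹) ^ 2 := by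
    intro j
    rw [lam, inv_pow, inv_pow, ← pow_mul, mul_comm, pow_mul]; norm_num
  have e : ∑ k ∈ Finset.range M, ((lam k)⁻¹) ^ 2 * (‖ξ‖ ^ 2 * ‖(phi (k + 4) : Sch d) ξ‖ ^ 2)
      = ∑ k ∈ t, ((lam k)⁻¹) ^ 2 * (‖ξ‖ ^ 2 * ‖(phi (k + 4) : Sch d) ξ‖ ^ 2) := by
    symm
    apply Finset.sum_subset (Finset.filter_subset _ _)
    intro k hk hkt
    have h0 : phiR (k + 4) ξ = 0 := by
      by_contra h0
      exact hkt (Finset.mem_filter.2 ⟨hk, h0⟩)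
    rw [phi_apply, h0]; simp
  rw [e]
  by_cases hξ : ‖ξ‖ = 0
  · simp [hξ]; positivity
  have hξp : 0 < ‖ξ‖ := lt_of_le_of_ne (norm_nonneg _) (Ne.symm hξ)
  have hg := hgeo t ((2 * 65536) ^ 2 / ‖ξ‖ ^ 2) (by positivity) (by
    intro j hj
    rw [ht, Finset.mem_filter] at hj
    have h1 := phiR_ne hj.2
    have hl := lam_pos j
    rw [show lam (j + 4) = 65536 * lam j by rw [lam, pow_add]; norm_num; ring] at h1
    rw [hq, inv_pow, le_div_iff₀ (by positivity), inv_mul_le_iff₀ (by positivity), ← mul_pow]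
    gcongr
    linarith)
  calc ∑ k ∈ t, ((lam k)⁻¹) ^ 2 * (‖ξ‖ ^ 2 * ‖(phi (k + 4) : Sch d) ξ‖ ^ 2)
      ≤ ∑ k ∈ t, ((256:ℝ)⁻¹) ^ k * ‖ξ‖ ^ 2 := by
        apply Finset.sum_le_sum
        intro k _
        rw [hq]
        have : ‖(phi (k + 4) : Sch d) ξ‖ ^ 2 ≤ 1 := by
          apply pow_le_one₀ (norm_nonneg _)
          rw [phi_apply, Complex.norm_real, Real.norm_of_nonneg (phiR_nonneg _ _)]
          exact phiR_le _ _
        gcongr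
        exact mul_le_of_le_one_right (by positivity) this
    _ = (∑ k ∈ t, ((256:ℝ)⁻¹) ^ k) * ‖ξ‖ ^ 2 := by rw [Finset.sum_mul]
    _ ≤ K * ((2 * 65536) ^ 2 / ‖ξ‖ ^ 2) * ‖ξ‖ ^ 2 := by gcongr
    _ = _ := by field_simp

lemma sumX : ∃ K, 0 < K ∧ ∀ (M : ℕ) (g h : Sch d),
    ∑ k ∈ Finset.range M, (lam k)⁻¹ * (n2 (P (k + 2) g) * Real.sqrt (E1 (S (k + 4) h)))
      ≤ K * n2 g * n2 h := by
  obtain ⟨K, hK, hX⟩ := lemX (d := d)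
  refine ⟨Real.sqrt (Kθ 0) * Real.sqrt K, by have := Kθ_pos 0; positivity, ?_⟩
  intro M g h
  have h1 : ∑ k ∈ Finset.range M, n2 (P (k + 2) g) ^ 2 ≤ Kθ 0 * n2 g ^ 2 := by
    have := sqsum_P 0 ((Finset.range M).image (fun k => k + 2)) g
    rw [Finset.sum_image (by intro a _ b _ h; simpa using h), Hs_zero] at this
    simpa [Kθ] using this
  have h2 := hX M h
  have h3 := Finset.sum_mul_sq_le_sq_mul_sq (Finset.range M) (fun k => n2 (P (k + 2) g))
    (fun k => (lam k)⁻¹ * Real.sqrt (E1 (S (k + 4) h)))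
  simp only [mul_pow, Real.sq_sqrt (E1_nonneg _)] at h3
  have hg := n2_nonneg g
  have hh := n2_nonneg h
  apply le_of_sq_le_sq _ (by positivity)
  calc _ = (∑ k ∈ Finset.range M, n2 (P (k + 2) g) * ((lam k)⁻¹ * Real.sqrt (E1 (S (k + 4) h)))) ^ 2 := by
        congr 1; apply Finset.sum_congr rfl; intro k _; ring
    _ ≤ _ := h3
    _ ≤ (Kθ 0 * n2 g ^ 2) * (K * n2 h ^ 2) := by
        apply mul_le_mul h1 h2 _ (by have := Kθ_pos 0; positivity)
        apply Finset.sum_nonneg; intro k _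
        have := E1_nonneg (S (k + 4) h)
        positivity
    _ = _ := by
        rw [mul_pow, mul_pow, mul_pow, Real.sq_sqrt (Kθ_pos 0).le, Real.sq_sqrt hK.le]; ring

end KP

namespace KP

variable {d : ℕ}

open ComplexConjugate

lemma norm_S_le (k : ℕ) (u : Sch d) {B : ℝ} (h : ∀ x, ‖u x‖ ≤ B) (x : V d) :
    ‖S k u x‖ ≤ W0 (phi 0 : Sch d) * B := by
  have := norm_Op_le (phi k) u h x
  rwa [(W_phi k).1] at this

lemma norm_phi_le (k : ℕ) (ξ : V d) : ‖(phi k : Sch d) ξ‖ ≤ 1 := by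
  rw [phi_apply, Complex.norm_real, Real.norm_of_nonneg (phiR_nonneg _ _)]
  exact phiR_le _ _

lemma n2_S_le (k : ℕ) (u : Sch d) : n2 (S k u) ≤ n2 u := by
  have := n2_Op_le (phi k) u zero_le_one (norm_phi_le k)
  rwa [one_mul] at this

lemma n2_Dl_le (k : ℕ) (u : Sch d) : n2 (Dl k u) ≤ n2 u := by
  have := n2_Op_le (psi k) u zero_le_one (fun ξ => (norm_psi_le k ξ).trans (etaR_le k ξ))
  rwa [one_mul] at this

lemma int_mul (u v : Sch d) : Integrable (fun x => u x * v x) := (mulS u v).integrable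

/-- fattened piece -/
def gt (k : ℕ) (g : Sch d) : Sch d := S (k + 3) g - S k g

lemma conjS_sub (u v : Sch d) : conjS (u - v) = conjS u - conjS v := by ext x; simp
lemma conjS_conjS (u : Sch d) : conjS (conjS u) = u := by ext x; simp

lemma SD_bound (M : ℕ) (u v : Sch d) {B : ℝ} (hB : 0 ≤ B) (h : ∀ x, ‖u x‖ ≤ B) :
    n2 (∑ k ∈ Finset.range M, mulS (S k u) (Dl (k + 2) v))
      ≤ 2 * Kθ 0 * (W0 (phi 0 : Sch d) * B) * n2 v := by
  have hW := W0_nonneg (phi 0 : Sch d)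
  have := ann_bound 0 M (fun k => mulS (S k u) (Dl (k + 2) v)) v (c := W0 (phi 0 : Sch d) * B)
    (by positivity)
    (fun k _ ξ hξ => ann_mul (fun ξ => spec_S) (fun ξ hx => ⟨spec_D' hx, spec_D hx⟩) ξ hξ)
    (fun k _ => by
      rw [Real.rpow_zero, one_mul]
      exact n2_mulS_left _ _ (by positivity) (norm_S_le k u h))
  rwa [Hs_zero] at this

lemma cotlar : ∃ K, 0 < K ∧ ∀ (M : ℕ) (g : Sch d) (B : ℝ), 0 ≤ B → (∀ x, ‖g x‖ ≤ B) →
    n2 (∑ k ∈ Finset.range M, mulS (Dl (k + 2) g) (conjS (gt k g))) ≤ K * B * n2 g := by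
  have hW := W0_nonneg (phi 0 : Sch d)
  have hK0 := Kθ_pos 0
  refine ⟨4 * Kθ 0 * W0 (phi 0 : Sch d) + 3 * W0 (phi 0 : Sch d) + 1, by positivity, ?_⟩
  intro M g B hB hg
  have hgc : ∀ x, ‖conjS g x‖ ≤ B := fun x => by simpa using hg x
  have hn := n2_nonneg g
  have hp := paraproduct g (conjS g) (M + 1)
  rw [Finset.sum_range_succ' (fun j => mulS (Dl j g) (S (j + 1) (conjS g))) (M + 1),
    Finset.sum_range_succ' (fun j => mulS (Dl (j + 1) g) (S (j + 1 + 1) (conjS g))) M] at hp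
  have e1 : ∑ k ∈ Finset.range M, mulS (Dl (k + 2) g) (conjS (gt k g))
      = ∑ k ∈ Finset.range M, mulS (Dl (k + 1 + 1) g) (S (k + 1 + 1 + 1) (conjS g))
        - ∑ k ∈ Finset.range M, mulS (S k (conjS g)) (Dl (k + 2) g) := by
    rw [← Finset.sum_sub_distrib]
    apply Finset.sum_congr rfl
    intro k _
    rw [gt, conjS_sub, mulS_sub, mulS_comm (S k _), ← S_conjS, ← S_conjS]
  have e2 : ∑ k ∈ Finset.range M, mulS (Dl (k + 1 + 1) g) (S (k + 1 + 1 + 1) (conjS g))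
      = mulS (S (M + 1) g) (S (M + 1 + 1) (conjS g))
        - ∑ k ∈ Finset.range (M + 1), mulS (S k g) (Dl (k + 2) (conjS g))
        - mulS (Dl (0 + 1) g) (S (0 + 1 + 1) (conjS g)) - mulS (Dl 0 g) (S (0 + 1) (conjS g)) := by
    rw [hp]; abel
  rw [e1, e2]
  have b1 := SD_bound M (conjS g) g hB hgc
  have b2 := SD_bound (M + 1) g (conjS g) hB hg
  rw [n2_conjS] at b2
  have hWB : 0 ≤ W0 (phi 0 : Sch d) * B := by positivity
  have b3 : ∀ (u : Sch d) k, n2 u ≤ n2 g → n2 (mulS u (S k (conjS g))) ≤ W0 (phi 0 : Sch d) * B * n2 g :=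
    fun u k hu => (n2_mulS_right _ _ hWB (norm_S_le k _ hgc)).trans
      (mul_le_mul_of_nonneg_left hu hWB)
  have c1 := b3 _ (M + 1 + 1) (n2_S_le (M + 1) g)
  have c2 := b3 _ (0 + 1 + 1) (n2_Dl_le (0 + 1) g)
  have c3 := b3 _ (0 + 1) (n2_Dl_le 0 g)
  set X1 := ∑ k ∈ Finset.range M, mulS (S k (conjS g)) (Dl (k + 2) g)
  set X2 := ∑ k ∈ Finset.range (M + 1), mulS (S k g) (Dl (k + 2) (conjS g))
  set Y1 := mulS (S (M + 1) g) (S (M + 1 + 1) (conjS g))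
  set Y2 := mulS (Dl (0 + 1) g) (S (0 + 1 + 1) (conjS g))
  set Y3 := mulS (Dl 0 g) (S (0 + 1) (conjS g))
  have t1 := n2_sub (Y1 - X2 - Y2 - Y3) X1
  have t2 := n2_sub (Y1 - X2 - Y2) Y3
  have t3 := n2_sub (Y1 - X2) Y2
  have t4 := n2_sub Y1 X2
  have : 0 ≤ B * n2 g := by positivity
  nlinarith

lemma pair_comm (m a b h : Sch d) (hm : ∀ ξ, m (-ξ) = m ξ) (hr : ∀ ξ, conj (m ξ) = m ξ) :
    ∫ x, (mulS (Op m a) (conjS b) - mulS a (conjS (Op m b))) x * h x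
      = - ∫ x, comm m h a x * conjS b x := by
  have h1 := pair_Op m (mulS h a) (conjS b) hm
  rw [Op_conjS m b hm hr] at h1
  have i1 : ∀ u v w : Sch d, Integrable (fun x => mulS u v x * w x) := fun u v w =>
    int_mul _ _
  have e1 : ∀ x, (mulS (Op m a) (conjS b) - mulS a (conjS (Op m b))) x * h x
      = mulS h (Op m a) x * conjS b x - mulS h a x * conjS (Op m b) x := by
    intro x; simp; ring
  have e2 : ∀ x, comm m h a x * conjS b x
      = Op m (mulS h a) x * conjS b x - mulS h (Op m a) x * conjS b x := by
    intro x; simp [comm]; ring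
  simp_rw [e1, e2]
  rw [integral_sub (i1 _ _ _) (i1 _ _ _),
    integral_sub (int_mul _ _) (i1 _ _ _), h1]
  ring

lemma pair_v (m a b h : Sch d) (hm : ∀ ξ, m (-ξ) = m ξ) (hr : ∀ ξ, conj (m ξ) = m ξ) {B : ℝ}
    (hb : ∀ x, ‖b x‖ ≤ B) :
    ‖∫ x, (mulS (Op m a) (conjS b) - mulS a (conjS (Op m b))) x * h x‖
      ≤ W1 m * (2 * Real.pi * Real.sqrt (E1 h) * n2 a) * B := by
  have hB : 0 ≤ B := (norm_nonneg _).trans (hb 0)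
  rw [pair_comm m a b h hm hr, norm_neg]
  refine (norm_integral_le_integral_norm _).trans ?_
  calc ∫ x, ‖comm m h a x * conjS b x‖ ≤ ∫ x, ‖comm m h a x‖ * B := by
        apply integral_mono (mulS (comm m h a) (conjS b)).integrable.norm
          ((comm m h a).integrable.norm.mul_const _)
        intro x
        have : ‖conjS b x‖ ≤ B := by simpa using hb x
        change ‖comm m h a x * conjS b x‖ ≤ _
        rw [norm_mul]
        exact mul_le_mul_of_nonneg_left this (norm_nonneg _)
    _ ≤ _ := by
        rw [integral_mul_const]
        exact mul_le_mul_of_nonneg_right (L1comm m h a) hB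

lemma P_gt (k : ℕ) (g : Sch d) : Op (eta (k + 2)) (gt k g) = P (k + 2) g := by
  apply ext_fourier; intro ξ
  rw [gt, P, S, S, fourier_Op_apply, fourier_Op_apply, fourier_subS, fourier_Op_apply,
    fourier_Op_apply]
  by_cases h0 : etaR (k + 2) ξ = 0
  · simp [eta_apply, h0]
  have h1 := etaR_ne' h0
  have h2 := etaR_ne h0
  have hl := lam_pos k
  have e1 : phiR (k + 3) ξ = 1 := phiR_one (by
    rw [lam_succ (k+2)]; have := lam_pos (k+2); linarith)
  have e2 : phiR k ξ = 0 := by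
    by_contra hc
    have := phiR_ne hc
    rw [lam_succ k] at h1
    linarith
  rw [phi_apply, phi_apply, e1, e2]; simp

lemma spec_mul_le {u v : Sch d} {R R' : ℝ} (hu : ∀ ξ, 𝓕 u ξ ≠ 0 → ‖ξ‖ ≤ R)
    (hv : ∀ ξ, 𝓕 v ξ ≠ 0 → ‖ξ‖ ≤ R') (ξ : V d) (h : 𝓕 (mulS u v) ξ ≠ 0) : ‖ξ‖ ≤ R + R' := by
  obtain ⟨a, b, rfl, ha, hb⟩ := fourier_mulS_ne h
  exact (norm_add_le _ _).trans (add_le_add (hu a ha) (hv b hb))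

lemma spec_conj_le {u : Sch d} {R : ℝ} (hu : ∀ ξ, 𝓕 u ξ ≠ 0 → ‖ξ‖ ≤ R) (ξ : V d)
    (h : 𝓕 (conjS u) ξ ≠ 0) : ‖ξ‖ ≤ R := by
  have := hu _ (spec_conjS h)
  simpa using this

lemma spec_sub_le {u v : Sch d} {R : ℝ} (hu : ∀ ξ, 𝓕 u ξ ≠ 0 → ‖ξ‖ ≤ R)
    (hv : ∀ ξ, 𝓕 v ξ ≠ 0 → ‖ξ‖ ≤ R) (ξ : V d) (h : 𝓕 (u - v) ξ ≠ 0) : ‖ξ‖ ≤ R := by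
  rw [fourier_subS] at h
  by_cases h1 : 𝓕 u ξ = 0
  · exact hv _ (fun h2 => h (by simp [h1, h2]))
  · exact hu _ h1

lemma pair_S (k : ℕ) (v h : Sch d) (hv : ∀ ξ, 𝓕 v ξ ≠ 0 → ‖ξ‖ ≤ lam k) :
    ∫ x, v x * h x = ∫ x, v x * S k h x :=
  pair_loc _ _ _ (phi_even k) fun ξ hξ => by rw [phi_apply, phiR_one (hv ξ hξ)]; simp

lemma sq_pair : ∃ K, 0 < K ∧ ∀ (M : ℕ) (g h : Sch d) (B : ℝ), 0 ≤ B → (∀ x, ‖g x‖ ≤ B) →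
    ‖∫ x, (∑ k ∈ Finset.range M, sqS (P (k + 2) g)) x * h x‖ ≤ K * B * n2 g * n2 h := by
  obtain ⟨K1, hK1, hc⟩ := cotlar (d := d)
  obtain ⟨K2, hK2, hX⟩ := sumX (d := d)
  have hW := W0_nonneg (phi 0 : Sch d)
  have hWe := W1_nonneg (eta 1 : Sch d)
  have hpi := Real.pi_pos
  refine ⟨K1 + W1 (eta 1 : Sch d) * (2 * Real.pi) * (2 * W0 (phi 0 : Sch d)) * K2, by positivity, ?_⟩
  intro M g h B hB hg
  set Y := ∑ k ∈ Finset.range M, mulS (Dl (k + 2) g) (conjS (gt k g)) with hY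
  set v : ℕ → Sch d := fun k => mulS (Op (eta (k + 2)) (P (k + 2) g)) (conjS (gt k g))
    - mulS (P (k + 2) g) (conjS (Op (eta (k + 2)) (gt k g))) with hv
  have e : ∑ k ∈ Finset.range M, sqS (P (k + 2) g) = Y - ∑ k ∈ Finset.range M, v k := by
    rw [hY, ← Finset.sum_sub_distrib]
    apply Finset.sum_congr rfl
    intro k _
    simp only [hv]
    rw [P_gt, ← P_P, sqS]
    change _ = mulS (P (k + 2) (P (k + 2) g)) _ - (mulS (P (k + 2) (P (k + 2) g)) _ - _)
    abel
  have hvk : ∀ k, ‖∫ x, v k x * h x‖ ≤ (W1 (eta 1 : Sch d) * (2 * Real.pi) * (2 * W0 (phi 0 : Sch d)) * B) *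
      ((lam k)⁻¹ * (n2 (P (k + 2) g) * Real.sqrt (E1 (S (k + 4) h)))) := by
    intro k
    have hl := lam_pos k
    have hl1 : lam (k + 1) = 16 * lam k := lam_succ k
    have hl2 : lam (k + 2) = 16 * lam (k + 1) := lam_succ _
    have hl3 : lam (k + 3) = 16 * lam (k + 2) := lam_succ _
    have hl4 : lam (k + 4) = 16 * lam (k + 3) := lam_succ _
    have sP : ∀ ξ, 𝓕 (P (k + 2) g) ξ ≠ 0 → ‖ξ‖ ≤ 2 * lam (k + 3) := fun ξ hξ => by
      have := spec_P hξ; linarith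
    have sG : ∀ ξ, 𝓕 (gt k g) ξ ≠ 0 → ‖ξ‖ ≤ 2 * lam (k + 3) :=
      spec_sub_le (fun ξ hξ => spec_S hξ) (fun ξ hξ => by have := spec_S hξ; linarith)
    have hspec : ∀ ξ, 𝓕 (v k) ξ ≠ 0 → ‖ξ‖ ≤ lam (k + 4) := by
      intro ξ hξ
      have := spec_sub_le (R := 2 * lam (k + 3) + 2 * lam (k + 3))
        (spec_mul_le (fun ξ hξ => by
          have := spec_P (u := P (k + 2) g) hξ; linarith) (spec_conj_le sG))
        (spec_mul_le sP (spec_conj_le (fun ξ hξ => by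
          have := spec_P (u := gt k g) hξ; linarith))) ξ hξ
      linarith
    rw [pair_S (k + 4) (v k) h hspec]
    have hb : ∀ x, ‖gt k g x‖ ≤ 2 * W0 (phi 0 : Sch d) * B := fun x => by
      have h1 := norm_S_le (k + 3) g hg x
      have h2 := norm_S_le k g hg x
      have h3 := norm_sub_le (S (k + 3) g x) (S k g x)
      change ‖S (k + 3) g x - S k g x‖ ≤ _
      linarith
    have := pair_v (eta (k + 2)) (P (k + 2) g) (gt k g) (S (k + 4) h) (eta_even _)
      (fun ξ => by simp [eta_apply]) hb
    refine this.trans ?_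
    rw [(W_eta (k + 1)).2]
    have hinv : (lam (k + 1))⁻¹ ≤ (lam k)⁻¹ := by
      apply inv_anti₀ hl; linarith
    have hn := n2_nonneg (P (k + 2) g)
    calc (lam (k + 1))⁻¹ * W1 (eta 1 : Sch d) * (2 * Real.pi * Real.sqrt (E1 (S (k + 4) h)) * n2 (P (k + 2) g)) * (2 * W0 (phi 0 : Sch d) * B)
        = (lam (k + 1))⁻¹ * (W1 (eta 1 : Sch d) * (2 * Real.pi * Real.sqrt (E1 (S (k + 4) h)) * n2 (P (k + 2) g)) * (2 * W0 (phi 0 : Sch d) * B)) := by ring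
      _ ≤ (lam k)⁻¹ * (W1 (eta 1 : Sch d) * (2 * Real.pi * Real.sqrt (E1 (S (k + 4) h)) * n2 (P (k + 2) g)) * (2 * W0 (phi 0 : Sch d) * B)) :=
          mul_le_mul_of_nonneg_right hinv (by positivity)
      _ = _ := by ring
  have e3 : ∫ x, (∑ k ∈ Finset.range M, sqS (P (k + 2) g)) x * h x
      = (∫ x, Y x * h x) - ∑ k ∈ Finset.range M, ∫ x, v k x * h x := by
    rw [e, ← integral_finsetSum _ (fun k _ => int_mul (v k) h),
      ← integral_sub (int_mul Y h)
        (integrable_finsetSum _ (fun k _ => int_mul (v k) h))]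
    congr 1; ext x
    rw [_root_.sub_apply, sum_apply _ v, sub_mul, Finset.sum_mul]
  rw [e3]
  have hh := n2_nonneg h
  have s1 := (norm_pair_le Y h).trans (mul_le_mul_of_nonneg_right (hc M g B hB hg) hh)
  have s2 : ‖∑ k ∈ Finset.range M, ∫ x, v k x * h x‖ ≤
      (W1 (eta 1 : Sch d) * (2 * Real.pi) * (2 * W0 (phi 0 : Sch d)) * B) * (K2 * n2 g * n2 h) := by
    refine (norm_sum_le _ _).trans ((Finset.sum_le_sum fun k _ => hvk k).trans ?_)
    rw [← Finset.mul_sum]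
    exact mul_le_mul_of_nonneg_left (hX M g h) (by positivity)
  have s3 := norm_sub_le (∫ x, Y x * h x) (∑ k ∈ Finset.range M, ∫ x, v k x * h x)
  calc _ ≤ _ := s3
    _ ≤ _ := add_le_add s1 s2
    _ = _ := by ring

end KP

namespace KP

variable {d : ℕ}

open ComplexConjugate

lemma norm_Op_sq_le (m a : Sch d) (x : V d) :
    ‖Op m a x‖ ^ 2 ≤ W0 m * ∫ z, ‖ker m z‖ * ‖a (x - z)‖ ^ 2 := by
  obtain ⟨B, hB, ha⟩ := exists_bdd a
  have hc : Continuous fun z => ‖ker m z‖ := (ker m).continuous.norm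
  have hac : Continuous fun z => ‖a (x - z)‖ := (a.continuous.comp (by fun_prop)).norm
  have i1 : Integrable (fun z => ‖ker m z‖ * ‖a (x - z)‖) := by
    simpa using (int_Op m a x).norm
  have i2 : Integrable (fun z => ‖ker m z‖ * ‖a (x - z)‖ ^ 2) := by
    apply ((int_W0 m).mul_const (B ^ 2)).mono' (by
      apply Continuous.aestronglyMeasurable; fun_prop)
    filter_upwards with z
    rw [norm_mul, norm_norm, norm_pow, norm_norm]
    have := ha (x - z)
    gcongr
  set I := ∫ z, ‖ker m z‖ * ‖a (x - z)‖ with hI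
  set J := ∫ z, ‖ker m z‖ * ‖a (x - z)‖ ^ 2 with hJ
  have h1 : ‖Op m a x‖ ≤ I := by
    rw [Op_apply]
    refine (norm_integral_le_integral_norm _).trans (le_of_eq ?_)
    simp [hI]
  have h2 : ∀ β : ℝ, 0 ≤ W0 m * (β * β) + (-2 * I) * β + J := by
    intro β
    have : W0 m * (β * β) + (-2 * I) * β + J
        = ∫ z, ‖ker m z‖ * (‖a (x - z)‖ - β) ^ 2 := by
      have e : ∀ z, ‖ker m z‖ * (‖a (x - z)‖ - β) ^ 2 = ‖ker m z‖ * (β * β)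
          + ‖ker m z‖ * ‖a (x - z)‖ * (-2 * β) + ‖ker m z‖ * ‖a (x - z)‖ ^ 2 := by
        intro z; ring
      simp_rw [e]
      have i3 : Integrable (fun z => ‖ker m z‖ * (β * β) + ‖ker m z‖ * ‖a (x - z)‖ * (-2 * β)) :=
        ((int_W0 m).mul_const _).add (i1.mul_const _)
      rw [integral_add i3 i2,
        integral_add ((int_W0 m).mul_const _) (i1.mul_const _), integral_mul_const,
        integral_mul_const, W0, hI, hJ]
      ring
    rw [this]
    exact integral_nonneg fun z => by positivity
  have h3 := discrim_le_zero h2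
  rw [discrim] at h3
  have : ‖Op m a x‖ ^ 2 ≤ I ^ 2 := by gcongr
  nlinarith

lemma transfer0 (m a Z : Sch d) :
    ∫ x, ‖Op m a x‖ ^ 2 * ‖Z x‖
      ≤ W0 m * ∫ z, ‖ker m z‖ * ∫ x, ‖a (x - z)‖ ^ 2 * ‖Z x‖ := by
  obtain ⟨B, hB, hZ⟩ := exists_bdd Z
  have hInteg : Integrable (fun p : V d × V d => ‖ker m p.2‖ * ‖a (p.1 - p.2)‖ ^ 2 * ‖Z p.1‖)
      (volume.prod volume) := by
    have h1 := (((ker m).integrable (μ := volume)).convolution_integrand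
      (ContinuousLinearMap.mul ℝ ℂ) ((sqS a).integrable (μ := volume)))
    apply (h1.norm.mul_const B).mono'
    · apply Continuous.aestronglyMeasurable
      have := a.continuous
      have := Z.continuous
      have := (ker m).continuous
      fun_prop
    · filter_upwards with p
      simp only [ContinuousLinearMap.mul_apply', norm_mul, norm_norm, norm_pow, sqS_apply,
        Complex.norm_real]
      exact mul_le_mul_of_nonneg_left (hZ _) (by positivity)
  calc ∫ x, ‖Op m a x‖ ^ 2 * ‖Z x‖
      ≤ ∫ x, W0 m * ∫ z, ‖ker m z‖ * ‖a (x - z)‖ ^ 2 * ‖Z x‖ := by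
        apply integral_mono
        · have := int_mul_norm (sqS (Op m a)) Z
          simpa [sqS_apply] using this
        · exact hInteg.integral_prod_left.const_mul _
        intro x
        simp only
        rw [integral_mul_const, ← mul_assoc]
        exact mul_le_mul_of_nonneg_right (norm_Op_sq_le m a x) (norm_nonneg _)
    _ = W0 m * ∫ z, ∫ x, ‖ker m z‖ * ‖a (x - z)‖ ^ 2 * ‖Z x‖ := by
        rw [integral_const_mul, integral_integral_swap hInteg]
    _ = _ := by
        congr 2; ext z
        rw [← integral_const_mul]
        simp only [mul_assoc]

lemma transfer (k : ℕ) (m a Z : Sch d) (Zr : V d → ℝ) (hZ : ∀ x, Z x = (Zr x : ℂ))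
    (hZ0 : ∀ x, 0 ≤ Zr x) {B : ℝ} (hB : ∀ x, ‖a x‖ ≤ B)
    (ha : ∀ ξ, 𝓕 (sqS a) ξ ≠ 0 → ‖ξ‖ ≤ lam k) :
    ∫ x, ‖Op m a x‖ ^ 2 * Zr x ≤ W0 m * (W0 m * (∫ x, sqS a x * Z x).re
      + W1 m * (2 * Real.pi * Real.sqrt (E1 (S k Z)) * (B * n2 a))) := by
  have hB0 : 0 ≤ B := (norm_nonneg _).trans (hB 0)
  have hn : ∀ x, ‖Z x‖ = Zr x := fun x => by
    rw [hZ, Complex.norm_real, Real.norm_of_nonneg (hZ0 x)]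
  have h0 := transfer0 m a Z
  simp_rw [hn] at h0
  refine h0.trans (mul_le_mul_of_nonneg_left ?_ (W0_nonneg m))
  have hsq : n2 (sqS a) ≤ B * n2 a := n2_mulS_right _ _ hB0 (fun x => by simpa using hB x)
  have key : ∀ z, ∫ x, ‖a (x - z)‖ ^ 2 * Zr x ≤ (∫ x, sqS a x * Z x).re
      + ‖z‖ * (2 * Real.pi * Real.sqrt (E1 (S k Z)) * (B * n2 a)) := by
    intro z
    have e1 : ∫ x, ‖a (x - z)‖ ^ 2 * Zr x = (∫ x, sqS a x * tr (-z) Z x).re := by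
      have : ∫ x, sqS a x * tr (-z) Z x = ((∫ x, ‖a x‖ ^ 2 * Zr (x + z) : ℝ) : ℂ) := by
        rw [← integral_complex_ofReal]
        congr 1; ext x
        rw [sqS_apply, tr_apply, hZ, sub_neg_eq_add]; push_cast; rfl
      rw [this, Complex.ofReal_re, ← integral_sub_right_eq_self (fun x => ‖a x‖ ^ 2 * Zr (x + z)) z]
      congr 1; ext x
      rw [sub_add_cancel]
    have e2 : ∫ x, sqS a x * tr (-z) Z x = (∫ x, sqS a x * Z x)
        + ∫ x, sqS a x * (tr (-z) (S k Z) - S k Z) x := by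
      have : ∫ x, sqS a x * (tr (-z) (S k Z) - S k Z) x
          = ∫ x, sqS a x * (tr (-z) Z - Z) x := by
        rw [pair_S k (sqS a) (tr (-z) Z - Z) ha]
        congr 1; ext x
        rw [S, S, Op_sub, Op_tr]
      rw [this, ← integral_add (int_mul _ _) (int_mul _ _)]
      congr 1; ext x
      rw [_root_.sub_apply]; ring
    rw [e1, e2, Complex.add_re]
    apply add_le_add le_rfl
    refine (Complex.re_le_norm _).trans ((norm_pair_le _ _).trans ?_)
    have := n2_tr_sub (-z) (S k Z)
    rw [norm_neg] at this
    calc n2 (sqS a) * n2 (tr (-z) (S k Z) - S k Z)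
        ≤ (B * n2 a) * (2 * Real.pi * ‖z‖ * Real.sqrt (E1 (S k Z))) :=
          mul_le_mul hsq this (n2_nonneg _) (mul_nonneg hB0 (n2_nonneg _))
      _ = _ := by ring
  have rint : Integrable (fun z => ‖ker m z‖ * (∫ x, sqS a x * Z x).re
      + ‖z‖ * ‖ker m z‖ * (2 * Real.pi * Real.sqrt (E1 (S k Z)) * (B * n2 a))) :=
    ((int_W0 m).mul_const _).add ((int_W1 m).mul_const _)
  calc ∫ z, ‖ker m z‖ * ∫ x, ‖a (x - z)‖ ^ 2 * Zr x
      ≤ ∫ z, (‖ker m z‖ * (∫ x, sqS a x * Z x).re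
        + ‖z‖ * ‖ker m z‖ * (2 * Real.pi * Real.sqrt (E1 (S k Z)) * (B * n2 a))) := by
        apply integral_mono_of_nonneg _ rint
        · filter_upwards with z
          have := mul_le_mul_of_nonneg_left (key z) (norm_nonneg (ker m z))
          refine this.trans (le_of_eq ?_)
          ring
        · filter_upwards with z
          apply mul_nonneg (norm_nonneg _)
          apply integral_nonneg
          intro x
          exact mul_nonneg (by positivity) (hZ0 x)
    _ = _ := by
        rw [integral_add ((int_W0 m).mul_const _) ((int_W1 m).mul_const _), integral_mul_const,
          integral_mul_const, W0, W1]

theorem SQ0 : ∃ K, 0 < K ∧ ∀ (M : ℕ) (g : Sch d) (B C : ℝ) (r : ℕ → Sch d), 0 ≤ B →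
    (∀ x, ‖g x‖ ≤ B) → 0 ≤ C → (∀ k < M, W0 (r k) ≤ C) → (∀ k < M, W1 (r k) ≤ C * (lam k)⁻¹) →
    n2 (∑ k ∈ Finset.range M, sqS (Op (r k) (P (k + 2) g))) ≤ K * C ^ 2 * B * n2 g := by
  obtain ⟨K1, hK1, hc⟩ := sq_pair (d := d)
  obtain ⟨K2, hK2, hX⟩ := sumX (d := d)
  have hWe := W0_nonneg (eta 1 : Sch d)
  have hpi := Real.pi_pos
  refine ⟨K1 + 2 * Real.pi * W0 (eta 1 : Sch d) * K2, by positivity, ?_⟩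
  intro M g B C r hB hg hC hr0 hr1
  set Z := ∑ k ∈ Finset.range M, sqS (Op (r k) (P (k + 2) g)) with hZ
  set Zr : V d → ℝ := fun x => ∑ k ∈ Finset.range M, ‖Op (r k) (P (k + 2) g) x‖ ^ 2 with hZr
  have hZZ : ∀ x, Z x = (Zr x : ℂ) := by
    intro x
    rw [hZ, sum_apply, hZr]
    push_cast
    apply Finset.sum_congr rfl
    intro k _
    rw [sqS_apply]; push_cast; rfl
  have hZ0 : ∀ x, 0 ≤ Zr x := fun x => Finset.sum_nonneg fun k _ => by positivity
  have hng := n2_nonneg g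
  have hnZ := n2_nonneg Z
  have hn : ∀ x, ‖Z x‖ = Zr x := fun x => by
    rw [hZZ, Complex.norm_real, Real.norm_of_nonneg (hZ0 x)]
  have hPb : ∀ k, ∀ x, ‖P (k + 2) g x‖ ≤ W0 (eta 1 : Sch d) * B := fun k x => by
    have := norm_Op_le (eta (k + 2)) g hg x
    rwa [(W_eta (k + 1)).1] at this
  have hspec : ∀ k, ∀ ξ, 𝓕 (sqS (P (k + 2) g)) ξ ≠ 0 → ‖ξ‖ ≤ lam (k + 4) := by
    intro k ξ hξ
    have := spec_mul_le (fun ξ hξ => spec_P hξ) (spec_conj_le (fun ξ hξ => spec_P hξ)) ξ hξ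
    have hl := lam_pos (k + 2)
    have hl3 : lam (k + 3) = 16 * lam (k + 2) := lam_succ _
    have hl4 : lam (k + 4) = 16 * lam (k + 3) := lam_succ _
    linarith
  have step : n2 Z ^ 2 ≤ (K1 + 2 * Real.pi * W0 (eta 1 : Sch d) * K2) * C ^ 2 * B * n2 g * n2 Z := by
    have e1 : n2 Z ^ 2 = ∑ k ∈ Finset.range M, ∫ x, ‖Op (r k) (P (k + 2) g) x‖ ^ 2 * Zr x := by
      rw [n2_sq, ← integral_finsetSum]
      · congr 1; ext x
        rw [hn, sq, ← Finset.sum_mul]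
      · intro k _
        have := int_mul_norm (sqS (Op (r k) (P (k + 2) g))) Z
        simpa [sqS_apply, hn] using this
    rw [e1]
    have hre : ∀ k, 0 ≤ (∫ x, sqS (P (k + 2) g) x * Z x).re := by
      intro k
      have : ∫ x, sqS (P (k + 2) g) x * Z x = ((∫ x, ‖P (k + 2) g x‖ ^ 2 * Zr x : ℝ) : ℂ) := by
        rw [← integral_complex_ofReal]
        congr 1; ext x
        rw [sqS_apply, hZZ]; push_cast; rfl
      rw [this, Complex.ofReal_re]
      exact integral_nonneg fun x => mul_nonneg (by positivity) (hZ0 x)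
    have hk : ∀ k ∈ Finset.range M, ∫ x, ‖Op (r k) (P (k + 2) g) x‖ ^ 2 * Zr x
        ≤ C ^ 2 * (∫ x, sqS (P (k + 2) g) x * Z x).re
          + (C ^ 2 * (2 * Real.pi * W0 (eta 1 : Sch d)) * B) *
            ((lam k)⁻¹ * (n2 (P (k + 2) g) * Real.sqrt (E1 (S (k + 4) Z)))) := by
      intro k hk
      rw [Finset.mem_range] at hk
      have h1 := transfer (k + 4) (r k) (P (k + 2) g) Z Zr hZZ hZ0 (hPb k) (hspec k)
      refine h1.trans ?_
      have hnP := n2_nonneg (P (k + 2) g)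
      have hl := lam_pos k
      have hR := hre k
      have w0 := hr0 k hk
      have w1 := hr1 k hk
      have w00 := W0_nonneg (r k)
      set R := (∫ x, sqS (P (k + 2) g) x * Z x).re
      have hQ : 0 ≤ 2 * Real.pi * Real.sqrt (E1 (S (k + 4) Z)) * (W0 (eta 1 : Sch d) * B * n2 (P (k + 2) g)) := by
        positivity
      set Q := 2 * Real.pi * Real.sqrt (E1 (S (k + 4) Z)) * (W0 (eta 1 : Sch d) * B * n2 (P (k + 2) g)) with hQd
      calc W0 (r k) * (W0 (r k) * R + W1 (r k) * Q)
          ≤ C * (C * R + C * (lam k)⁻¹ * Q) := by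
            apply mul_le_mul w0 _ _ hC
            · exact add_le_add (mul_le_mul_of_nonneg_right w0 hR) (mul_le_mul_of_nonneg_right w1 hQ)
            · have := W1_nonneg (r k); positivity
        _ = _ := by rw [hQd]; ring
    refine (Finset.sum_le_sum hk).trans ?_
    rw [Finset.sum_add_distrib, ← Finset.mul_sum, ← Finset.mul_sum]
    have s1 : ∑ k ∈ Finset.range M, (∫ x, sqS (P (k + 2) g) x * Z x).re ≤ K1 * B * n2 g * n2 Z := by
      rw [← Complex.re_sum, ← integral_finsetSum _ (fun k _ => int_mul _ _)]
      refine (Complex.re_le_norm _).trans ?_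
      refine le_trans (le_of_eq ?_) (hc M g Z B hB hg)
      congr 2; ext x
      rw [sum_apply _ (fun k => sqS (P (k + 2) g)), Finset.sum_mul]
    have s2 := hX M g Z
    calc _ ≤ C ^ 2 * (K1 * B * n2 g * n2 Z)
          + (C ^ 2 * (2 * Real.pi * W0 (eta 1 : Sch d)) * B) * (K2 * n2 g * n2 Z) :=
          add_le_add (mul_le_mul_of_nonneg_left s1 (by positivity))
            (mul_le_mul_of_nonneg_left s2 (by positivity))
      _ = _ := by ring
  rcases hnZ.eq_or_lt with h | h
  · rw [← h]; positivity
  · rw [sq] at step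
    exact le_of_mul_le_mul_right step h

end KP

namespace KP

variable {d : ℕ}

open ComplexConjugate

lemma norm_symb_le (m : Sch d) (ξ : V d) : ‖m ξ‖ ≤ W0 m := by
  have h : 𝓕 (ker m) ξ = m ξ := by simp [ker]
  rw [← h, SchwartzMap.fourier_coe, Real.fourier_eq, W0]
  refine (norm_integral_le_integral_norm _).trans (le_of_eq ?_)
  congr 1; ext z
  simp

lemma n2_Op_W0 (m u : Sch d) : n2 (Op m u) ≤ W0 m * n2 u :=
  n2_Op_le m u (W0_nonneg m) (norm_symb_le m)

lemma W0_smul (c : ℂ) (m : Sch d) : W0 (c • m) = ‖c‖ * W0 m := by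
  have h : ker (c • m) = c • ker m := by
    rw [ker, ker, FourierTransform.fourierInv_smul]
  rw [W0, W0, h, ← integral_const_mul]
  simp

lemma W1_smul (c : ℂ) (m : Sch d) : W1 (c • m) = ‖c‖ * W1 m := by
  have h : ker (c • m) = c • ker m := by
    rw [ker, ker, FourierTransform.fourierInv_smul]
  rw [W1, W1, h, ← integral_const_mul]
  congr 1; ext z
  simp; ring

lemma sq_real {θ : ℝ} (hθ : θ ≠ 0) : ∃ K, 0 < K ∧ ∀ (L : ℕ) (t : ℕ → ℝ) (T : ℝ),
    (∀ k < L, 0 ≤ t k) → (∀ k < L, t k ≤ T) →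
    (∑ k ∈ Finset.range L, lam k ^ θ * t k) ^ 2
      ≤ K * T * ∑ k ∈ Finset.range L, (lam k ^ θ) ^ 2 * t k := by
  have hq1 : (16:ℝ) ^ θ ≠ 1 := by
    intro h
    rcases lt_or_gt_of_ne hθ with h1 | h1
    · exact absurd h (Real.rpow_lt_one_of_one_lt_of_neg (by norm_num) h1).ne
    · exact absurd h (Real.one_lt_rpow (by norm_num) h1).ne'
  obtain ⟨K, hK, hg⟩ := geo (q := (16:ℝ) ^ θ) (by positivity) hq1
  refine ⟨2 * K, by positivity, ?_⟩
  intro L t T h0 hT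
  have hw : ∀ k : ℕ, ((16:ℝ) ^ θ) ^ k = lam k ^ θ := by
    intro k
    rw [lam, ← Real.rpow_natCast, ← Real.rpow_natCast, ← Real.rpow_mul (by norm_num),
      ← Real.rpow_mul (by norm_num), mul_comm]
  set w : ℕ → ℝ := fun k => lam k ^ θ with hwd
  have hwp : ∀ k, 0 < w k := fun k => Real.rpow_pos_of_pos (lam_pos k) _
  set R := Finset.range L
  have hR : ∀ k ∈ R, k < L := fun k hk => Finset.mem_range.1 hk
  have e1 : (∑ k ∈ R, w k * t k) ^ 2
      ≤ 2 * ∑ j ∈ R, ∑ k ∈ R, if w k ≤ w j then (w j * t j) * (w k * t k) else 0 := by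
    have sw : ∑ j ∈ R, ∑ k ∈ R, (if w k ≤ w j then (w j * t j) * (w k * t k) else 0)
        = ∑ j ∈ R, ∑ k ∈ R, (if w j ≤ w k then (w j * t j) * (w k * t k) else 0) := by
      rw [Finset.sum_comm]
      apply Finset.sum_congr rfl; intro j _
      apply Finset.sum_congr rfl; intro k _
      split_ifs <;> ring
    rw [two_mul]
    nth_rewrite 2 [sw]
    rw [sq, Finset.sum_mul_sum, ← Finset.sum_add_distrib]
    apply Finset.sum_le_sum; intro j hj
    rw [← Finset.sum_add_distrib]
    apply Finset.sum_le_sum; intro k hk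
    have p1 : 0 ≤ (w j * t j) * (w k * t k) :=
      mul_nonneg (mul_nonneg (hwp j).le (h0 j (hR j hj))) (mul_nonneg (hwp k).le (h0 k (hR k hk)))
    rcases le_total (w j) (w k) with h | h
    · rw [if_pos h]
      split_ifs <;> linarith
    · rw [if_pos h]
      split_ifs <;> linarith
  refine e1.trans ?_
  rw [mul_assoc, mul_assoc]
  apply mul_le_mul_of_nonneg_left _ (by norm_num)
  rw [← mul_assoc, Finset.mul_sum]
  apply Finset.sum_le_sum
  intro j hj
  have hj0 := h0 j (hR j hj)
  have hjT : 0 ≤ T := hj0.trans (hT j (hR j hj))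
  calc ∑ k ∈ R, (if w k ≤ w j then (w j * t j) * (w k * t k) else 0)
      ≤ ∑ k ∈ R, (if w k ≤ w j then (w j * t j * T) * w k else 0) := by
        apply Finset.sum_le_sum; intro k hk
        split_ifs
        · have := hT k (hR k hk)
          have h1 := hwp j
          have h2 := hwp k
          calc (w j * t j) * (w k * t k) ≤ (w j * t j) * (w k * T) := by gcongr
            _ = _ := by ring
        · exact le_rfl
    _ = (w j * t j * T) * ∑ k ∈ R.filter (fun k => w k ≤ w j), ((16:ℝ) ^ θ) ^ k := by
        rw [← Finset.sum_filter, Finset.mul_sum]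
        apply Finset.sum_congr rfl; intro k _
        rw [hw]
    _ ≤ (w j * t j * T) * (K * w j) := by
        have h1 := hwp j
        apply mul_le_mul_of_nonneg_left _ (by positivity)
        apply hg _ _ h1.le
        intro k hk
        rw [hw]
        exact (Finset.mem_filter.1 hk).2
    _ = _ := by ring

/-- weighted sum of squares -/
def SQ (L : ℕ) (c : ℕ → ℝ) (a : ℕ → Sch d) : Sch d :=
  ∑ k ∈ Finset.range L, ((c k : ℝ) : ℂ) • sqS (a k)

lemma SQ_apply (L : ℕ) (c : ℕ → ℝ) (a : ℕ → Sch d) (x : V d) :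
    SQ L c a x = ((∑ k ∈ Finset.range L, c k * ‖a k x‖ ^ 2 : ℝ) : ℂ) := by
  rw [SQ, sum_apply]
  push_cast
  apply Finset.sum_congr rfl
  intro k _
  rw [Pi.smul_apply, sqS_apply, smul_eq_mul]; push_cast; rfl

lemma norm_SQ (L : ℕ) (c : ℕ → ℝ) (hc : ∀ k, 0 ≤ c k) (a : ℕ → Sch d) (x : V d) :
    ‖SQ L c a x‖ = ∑ k ∈ Finset.range L, c k * ‖a k x‖ ^ 2 := by
  rw [SQ_apply, Complex.norm_real, Real.norm_of_nonneg]
  exact Finset.sum_nonneg fun k _ => mul_nonneg (hc k) (by positivity)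

lemma sqgen {θ : ℝ} (hθ : θ ≠ 0) : ∃ K, 0 < K ∧ ∀ (L : ℕ) (a : ℕ → Sch d) (A : ℝ), 0 ≤ A →
    (∀ k < L, ∀ x, ‖a k x‖ ≤ A) →
    n2 (SQ L (fun k => lam k ^ θ) a) ^ 2
      ≤ K * A ^ 2 * ∑ k ∈ Finset.range L, (lam k ^ θ) ^ 2 * n2 (a k) ^ 2 := by
  obtain ⟨K, hK, h⟩ := sq_real hθ
  refine ⟨K, hK, ?_⟩
  intro L a A hA ha
  simp_rw [n2_sq]
  simp_rw [← integral_const_mul]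
  rw [← integral_finsetSum _ (fun k _ => (int_sq (a k)).const_mul _), ← integral_const_mul]
  apply integral_mono (int_sq _)
  · apply Integrable.const_mul
    exact integrable_finsetSum _ (fun k _ => (int_sq (a k)).const_mul _)
  intro x
  simp only
  rw [norm_SQ _ _ (fun k => (Real.rpow_pos_of_pos (lam_pos k) _).le)]
  exact h L (fun k => ‖a k x‖ ^ 2) (A ^ 2) (fun k _ => by positivity)
    (fun k hk => by have := ha k hk x; gcongr)

end KP

namespace KP

variable {d : ℕ}

open ComplexConjugate LineDeriv

lemma eta_scale (k : ℕ) (ξ : V d) : (eta (k + 1) : Sch d) ξ = eta 1 ((lam k)⁻¹ • ξ) := by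
  have h1 := cR_scale (ρ := 1) (lam_pos k) ξ
  have h2 := sR_scale (ρ := 1) (lam_pos k) ξ
  have h3 := cR_scale (ρ := 16) (lam_pos k) ξ
  rw [mul_one] at h1 h2
  simp [eta_apply, etaR, h2, ← h3, lam, pow_succ]

lemma W_psi (k : ℕ) : W0 (psi (k + 1) : Sch d) = W0 (psi 1 : Sch d) ∧
    W1 (psi (k + 1) : Sch d) = (lam k)⁻¹ * W1 (psi 1 : Sch d) := by
  have h : ∀ ξ : V d, psi (k + 1) ξ = psi 1 ((lam k)⁻¹ • ξ) := by
    intro ξ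
    simp [psi, eta_scale k]
  exact ⟨W0_scale (lam_pos k) h, W1_scale (lam_pos k) h⟩

lemma lam_shift (θ : ℝ) (k : ℕ) : lam k ^ θ = (256:ℝ) ^ (-θ) * lam (k + 2) ^ θ := by
  rw [show lam (k + 2) = 256 * lam k by rw [lam_succ, lam_succ]; ring,
    Real.mul_rpow (by norm_num) (lam_pos k).le, ← mul_assoc, ← Real.rpow_add (by norm_num)]
  simp

lemma sqsum_shift (θ : ℝ) (L : ℕ) (y : ℕ → Sch d) {H : ℝ}
    (h : ∀ s : Finset ℕ, ∑ k ∈ s, (lam k ^ θ) ^ 2 * n2 (y k) ^ 2 ≤ H) :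
    ∑ k ∈ Finset.range L, (lam k ^ θ) ^ 2 * n2 (y (k + 2)) ^ 2 ≤ ((256:ℝ) ^ (-θ)) ^ 2 * H := by
  have := h ((Finset.range L).image (fun k => k + 2))
  rw [Finset.sum_image (by intro a _ b _ h; simpa using h)] at this
  calc _ = ((256:ℝ) ^ (-θ)) ^ 2 * ∑ k ∈ Finset.range L, (lam (k + 2) ^ θ) ^ 2 * n2 (y (k + 2)) ^ 2 := by
        rw [Finset.mul_sum]
        apply Finset.sum_congr rfl
        intro k _
        rw [lam_shift θ k]; ring
    _ ≤ _ := mul_le_mul_of_nonneg_left this (by positivity)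

lemma SQ_smul (L : ℕ) (c b : ℕ → ℝ) (a : ℕ → Sch d) :
    SQ L c (fun k => ((b k : ℝ) : ℂ) • a k) = SQ L (fun k => c k * b k ^ 2) a := by
  ext x
  rw [SQ_apply, SQ_apply]
  congr 1
  apply Finset.sum_congr rfl
  intro k _
  rw [_root_.smul_apply, norm_smul, Complex.norm_real, mul_pow, Real.norm_eq_abs, sq_abs]
  ring

lemma norm_D_lip (k : ℕ) (f : Sch d) {A : ℝ} (hf : ∀ x y, ‖f x - f y‖ ≤ A * ‖x - y‖) (x : V d) :
    ‖Dl (k + 2) f x‖ ≤ (lam k)⁻¹ * (W1 (psi 1 : Sch d) * A) := by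
  have hA : 0 ≤ W1 (psi 1 : Sch d) * A := by
    have h1 := norm_Op_le_lip (psi 1 : Sch d) f (by
      rw [psi_apply]
      have : etaR 1 (0 : V d) = 0 := by
        by_contra h
        have := etaR_ne' h
        simp [lam] at this
        linarith
      simp [this]) hf x
    exact (norm_nonneg _).trans h1
  have h0 : (psi (k + 2) : Sch d) 0 = 0 := by
    rw [psi_apply]
    have : etaR (k + 2) (0 : V d) = 0 := by
      by_contra h
      have := etaR_ne' h
      rw [norm_zero] at this
      have := lam_pos (k + 1)
      linarith
    simp [this]
  have h := norm_Op_le_lip (psi (k + 2)) f h0 hf x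
  rw [(W_psi (k + 1)).2, mul_assoc] at h
  refine h.trans (mul_le_mul_of_nonneg_right ?_ hA)
  apply inv_anti₀ (lam_pos k)
  exact lam_mono (Nat.le_succ k)

lemma boundU_ne {s : ℝ} (hs1 : s ≠ 1) : ∃ K, 0 < K ∧ ∀ (L : ℕ) (f : Sch d) (A : ℝ),
    0 ≤ A → (∀ x y, ‖f x - f y‖ ≤ A * ‖x - y‖) →
    n2 (SQ L (fun k => lam k ^ (s + 1)) (fun k => Dl (k + 2) f)) ≤ K * A * Hs s f := by
  obtain ⟨K, hK, hq⟩ := sqgen (d := d) (sub_ne_zero.2 hs1)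
  have hW := W1_nonneg (psi 1 : Sch d)
  have hKs := Kθ_pos s
  refine ⟨Real.sqrt K * W1 (psi 1 : Sch d) * ((256:ℝ) ^ (-s) * Real.sqrt (Kθ s)) + 1,
    by positivity, ?_⟩
  intro L f A hA hf
  have hH := Hs_nonneg s f
  have e : SQ L (fun k => lam k ^ (s + 1)) (fun k => Dl (k + 2) f)
      = SQ L (fun k => lam k ^ (s - 1)) (fun k => ((lam k : ℝ) : ℂ) • Dl (k + 2) f) := by
    rw [SQ_smul]
    congr 1; ext k
    rw [← Real.rpow_natCast (lam k) 2, ← Real.rpow_add (lam_pos k)]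
    congr 1; push_cast; ring
  rw [e]
  have h1 := hq L (fun k => ((lam k : ℝ) : ℂ) • Dl (k + 2) f) (W1 (psi 1 : Sch d) * A) (by positivity)
    (by
      intro k _ x
      rw [_root_.smul_apply, norm_smul, Complex.norm_real, Real.norm_of_nonneg (lam_pos k).le]
      have := mul_le_mul_of_nonneg_left (norm_D_lip k f hf x) (lam_pos k).le
      rwa [mul_inv_cancel_left₀ (lam_pos k).ne'] at this)
  have h2 : ∑ k ∈ Finset.range L, (lam k ^ (s - 1)) ^ 2 * n2 (((lam k : ℝ) : ℂ) • Dl (k + 2) f) ^ 2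
      ≤ ((256:ℝ) ^ (-s)) ^ 2 * (Kθ s * Hs s f ^ 2) := by
    refine le_trans (le_of_eq ?_) (sqsum_shift s L (fun k => Dl k f) (fun t => sqsum_D s t f))
    apply Finset.sum_congr rfl
    intro k _
    rw [n2_smul, Complex.norm_real, Real.norm_of_nonneg (lam_pos k).le, mul_pow, ← mul_assoc,
      ← mul_pow]
    congr 2
    rw [Real.rpow_sub (lam_pos k), Real.rpow_one, div_mul_cancel₀ _ (lam_pos k).ne']
  apply n2_le_of_sq (by positivity)
  refine h1.trans ((mul_le_mul_of_nonneg_left h2 (by positivity)).trans ?_)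
  calc _ = (Real.sqrt K * W1 (psi 1 : Sch d) * ((256:ℝ) ^ (-s) * Real.sqrt (Kθ s)) * A * Hs s f) ^ 2 := by
        simp only [mul_pow, Real.sq_sqrt hK.le, Real.sq_sqrt hKs.le]; ring
    _ ≤ _ := by
        gcongr
        linarith

/-! ### the case `s = 1` -/

/-- Riesz type symbol -/
def rhoR (v : V d) (ξ : V d) : ℝ := etaR 2 ξ * inner ℝ ξ v / (‖ξ‖ ^ 2 + phiR 0 ξ)

lemma rho_den (ξ : V d) : 0 < ‖ξ‖ ^ 2 + phiR 0 ξ := by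
  have h0 := phiR_nonneg 0 ξ
  by_cases h : ‖ξ‖ ≤ 1
  · rw [phiR_one (by simpa [lam] using h)]; positivity
  · push Not at h; positivity

lemma rhoR_contDiff (v : V d) : ContDiff ℝ (⊤ : ℕ∞) (rhoR v : V d → ℝ) := by
  unfold rhoR
  apply ContDiff.div
  · exact (etaR_contDiff 2).mul (contDiff_id.inner ℝ contDiff_const)
  · exact (contDiff_norm_sq ℝ).add (phiR_contDiff 0)
  · exact fun ξ => (rho_den ξ).ne.symm

/-- scaled Riesz symbol -/
def rho (k : ℕ) (v : V d) : Sch d := mkS (fun ξ => rhoR v ((lam k)⁻¹ • ξ))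
  ((rhoR_contDiff v).comp (contDiff_const_smul _)) (hcs_of (lam k * (2 * lam 2)) (by
    intro ξ hξ
    have h1 : etaR 2 ((lam k)⁻¹ • ξ) ≠ 0 := by
      intro h; apply hξ; simp [rhoR, h]
    have := etaR_ne h1
    rwa [norm_smul, norm_inv, Real.norm_of_nonneg (lam_pos k).le, inv_mul_le_iff₀ (lam_pos k)] at this))

lemma rho_apply (k : ℕ) (v ξ : V d) : rho k v ξ = ((rhoR v ((lam k)⁻¹ • ξ) : ℝ) : ℂ) := rfl

lemma W_rho (k : ℕ) (v : V d) : W0 (rho k v) = W0 (rho 0 v) ∧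
    W1 (rho k v) = (lam k)⁻¹ * W1 (rho 0 v) := by
  have h : ∀ ξ : V d, rho k v ξ = rho 0 v ((lam k)⁻¹ • ξ) := by
    intro ξ
    simp [rho_apply, lam]
  exact ⟨W0_scale (lam_pos k) h, W1_scale (lam_pos k) h⟩

/-- partial derivative -/
def pd (v : V d) (f : Sch d) : Sch d := ∂_{v} f

lemma fourier_pd (v : V d) (f : Sch d) (ξ : V d) :
    𝓕 (pd v f) ξ = (2 * Real.pi * Complex.I) * ((inner ℝ ξ v : ℝ) : ℂ) * 𝓕 f ξ := by
  rw [pd, SchwartzMap.fourier_lineDerivOp_eq]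
  have : (fun ξ : V d => inner ℝ ξ v).HasTemperateGrowth := by fun_prop
  rw [_root_.smul_apply, SchwartzMap.smulLeftCLM_apply_apply this]
  simp [mul_assoc]

lemma norm_pd_le (v : V d) (f : Sch d) {A : ℝ} (hA : 0 ≤ A) (hv : ‖v‖ ≤ 1)
    (hf : ∀ x y, ‖f x - f y‖ ≤ A * ‖x - y‖) (x : V d) : ‖pd v f x‖ ≤ A := by
  have h1 : ‖fderiv ℝ f x‖ ≤ A := by
    have : LipschitzWith ⟨A, hA⟩ f := LipschitzWith.of_dist_le_mul fun x y => by
      rw [dist_eq_norm, dist_eq_norm]; exact hf x y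
    exact norm_fderiv_le_of_lipschitz ℝ this
  rw [pd, SchwartzMap.lineDerivOp_apply_eq_fderiv]
  refine (ContinuousLinearMap.le_opNorm _ _).trans ?_
  calc _ ≤ A * 1 := mul_le_mul h1 hv (norm_nonneg _) hA
    _ = A := mul_one A

lemma n2_pd_le (v : V d) (f : Sch d) (hv : ‖v‖ ≤ 1) : n2 (pd v f) ≤ 2 * Real.pi * Hs 1 f := by
  apply n2_le_mul_fourier (by positivity)
  intro ξ
  rw [fourier_pd, fourier_Jb, norm_mul, norm_mul, norm_mul, norm_mul, Complex.norm_I,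
    Complex.norm_real, Complex.norm_real, Real.norm_of_nonneg Real.pi_pos.le]
  have h1 : ‖inner ℝ ξ v‖ ≤ ‖(1 + ‖ξ‖ ^ 2) ^ ((1:ℝ) / 2)‖ := by
    have hn : (0:ℝ) ≤ (1 + ‖ξ‖ ^ 2) ^ ((1:ℝ) / 2) := by positivity
    rw [Real.norm_of_nonneg hn, ← Real.sqrt_eq_rpow]
    refine (norm_inner_le_norm ξ v).trans ?_
    apply Real.le_sqrt_of_sq_le
    have := norm_nonneg v
    have h2 := norm_nonneg ξ
    have h3 : ‖ξ‖ * ‖v‖ ≤ ‖ξ‖ := mul_le_of_le_one_right h2 hv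
    calc _ ≤ ‖ξ‖ ^ 2 := by gcongr
      _ ≤ _ := by linarith
  have h3 := norm_nonneg (𝓕 f ξ)
  have hp := Real.pi_pos
  calc _ = 2 * Real.pi * (‖inner ℝ ξ v‖ * ‖𝓕 f ξ‖) := by
        rw [Complex.norm_ofNat]; ring
    _ ≤ _ := by
        rw [norm_mul, Complex.norm_real]
        exact mul_le_mul_of_nonneg_left (mul_le_mul_of_nonneg_right h1 h3) (by positivity)

lemma riesz (k : ℕ) (f : Sch d) : ((lam k : ℝ) : ℂ) • Dl (k + 2) f = (2 * Real.pi * Complex.I)⁻¹ •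
    ∑ i : Fin d, Op (rho k (EuclideanSpace.single i 1)) (P (k + 2) (pd (EuclideanSpace.single i 1) f)) := by
  apply ext_fourier
  intro ξ
  rw [fourier_smulS, fourier_smulS, fourier_sum, Dl, fourier_Op_apply, psi_apply]
  simp_rw [P, fourier_Op_apply, fourier_pd, rho_apply, eta_apply]
  have hpi : (Real.pi : ℂ) ≠ 0 := by exact_mod_cast Real.pi_ne_zero
  have hl := lam_pos k
  have hes : etaR (k + 2) ξ = etaR 2 ((lam k)⁻¹ • ξ) := by
    have h := eta_scale (k + 1) ξ
    have h' := eta_scale 1 ((lam k)⁻¹ • ξ)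
    rw [eta_apply, eta_apply] at h h'
    have h1 : etaR (k + 2) ξ = etaR 1 ((lam (k + 1))⁻¹ • ξ) := by exact_mod_cast h
    have h2 : etaR 2 ((lam k)⁻¹ • ξ) = etaR 1 ((lam 1)⁻¹ • (lam k)⁻¹ • ξ) := by exact_mod_cast h'
    rw [h1, h2, smul_smul, ← mul_inv]
    congr 3
    rw [lam, lam, lam]; ring
  by_cases h0 : etaR (k + 2) ξ = 0
  · simp [h0]
  have h2 : etaR 2 ((lam k)⁻¹ • ξ) ≠ 0 := by rwa [← hes]
  have h3 := etaR_ne' h2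
  set ζ := (lam k)⁻¹ • ξ with hζ
  have hξζ : ξ = lam k • ζ := by rw [hζ, smul_smul, mul_inv_cancel₀ hl.ne', one_smul]
  have hz : phiR 0 ζ = 0 := by
    by_contra hc
    have := phiR_ne hc
    simp only [lam, pow_zero, pow_one] at this h3
    linarith
  have hζ0 : 0 < ‖ζ‖ := lt_of_lt_of_le (lam_pos 1) h3
  have hsum : ∑ i : Fin d, rhoR (EuclideanSpace.single i 1) ζ * inner ℝ ξ (EuclideanSpace.single i 1)
      = etaR 2 ζ * lam k := by
    have e : ∀ i : Fin d, rhoR (EuclideanSpace.single i 1) ζ * inner ℝ ξ (EuclideanSpace.single i 1)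
        = (etaR 2 ζ * lam k / ‖ζ‖ ^ 2) * ‖ζ i‖ ^ 2 := by
      intro i
      rw [rhoR, hz, hξζ]
      simp [EuclideanSpace.inner_single_right]
      field_simp
    simp_rw [e]
    rw [← Finset.mul_sum, ← EuclideanSpace.norm_sq_eq]
    field_simp
  have hsumC : ∑ i : Fin d, ((rhoR (EuclideanSpace.single i 1) ζ : ℝ) : ℂ) *
      ((inner ℝ ξ (EuclideanSpace.single i 1) : ℝ) : ℂ) = (etaR 2 ζ : ℂ) * (lam k : ℂ) := by
    exact_mod_cast congrArg (fun t : ℝ => (t : ℂ)) hsum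
  rw [hes]
  have e2 : ∀ i : Fin d, ((rhoR (EuclideanSpace.single i 1) ζ : ℝ) : ℂ) * ((etaR 2 ζ : ℂ) *
      (2 * Real.pi * Complex.I * ((inner ℝ ξ (EuclideanSpace.single i 1) : ℝ) : ℂ) * 𝓕 f ξ))
      = (((rhoR (EuclideanSpace.single i 1) ζ : ℝ) : ℂ) *
      ((inner ℝ ξ (EuclideanSpace.single i 1) : ℝ) : ℂ)) * ((etaR 2 ζ : ℂ) * (2 * Real.pi * Complex.I) * 𝓕 f ξ) := by
    intro i; ring
  simp_rw [e2]
  rw [← Finset.sum_mul, hsumC]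
  have hI := Complex.I_ne_zero
  field_simp
  push_cast; ring

lemma boundU_one : ∃ K, 0 < K ∧ ∀ (L : ℕ) (f : Sch d) (A : ℝ),
    0 ≤ A → (∀ x y, ‖f x - f y‖ ≤ A * ‖x - y‖) →
    n2 (SQ L (fun k => lam k ^ ((1:ℝ) + 1)) (fun k => Dl (k + 2) f)) ≤ K * A * Hs 1 f := by
  obtain ⟨K, hK, hq⟩ := SQ0 (d := d)
  have hpi := Real.pi_pos
  set e : Fin d → V d := fun i => EuclideanSpace.single i 1 with he
  set C : Fin d → ℝ := fun i => W0 (rho 0 (e i)) + W1 (rho 0 (e i)) with hC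
  have hC0 : ∀ i, 0 ≤ C i := fun i => add_nonneg (W0_nonneg _) (W1_nonneg _)
  refine ⟨d * ∑ i, K * C i ^ 2 * (2 * Real.pi) + 1, ?_, ?_⟩
  · have : 0 ≤ ∑ i, K * C i ^ 2 * (2 * Real.pi) := Finset.sum_nonneg fun i _ => by positivity
    positivity
  intro L f A hA hf
  have hH := Hs_nonneg 1 f
  have hev : ∀ i, ‖e i‖ ≤ 1 := fun i => by simp [he]
  set Z : Fin d → Sch d := fun i => ∑ k ∈ Finset.range L,
    sqS (Op (rho k (e i)) (P (k + 2) (pd (e i) f))) with hZ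
  have hZn : ∀ i, n2 (Z i) ≤ K * C i ^ 2 * (2 * Real.pi) * (A * Hs 1 f) := by
    intro i
    have := hq L (pd (e i) f) A (C i) (fun k => rho k (e i)) hA (norm_pd_le _ f hA (hev i) hf)
      (hC0 i) (fun k _ => by
        rw [(W_rho k (e i)).1]; exact le_add_of_nonneg_right (W1_nonneg _))
      (fun k _ => by
        rw [(W_rho k (e i)).2, mul_comm]
        exact mul_le_mul_of_nonneg_right (le_add_of_nonneg_left (W0_nonneg _))
          (inv_nonneg.2 (lam_pos k).le))
    refine this.trans ?_
    have h2 := n2_pd_le (e i) f (hev i)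
    calc _ ≤ K * C i ^ 2 * A * (2 * Real.pi * Hs 1 f) :=
          mul_le_mul_of_nonneg_left h2 (by positivity)
      _ = _ := by ring
  have hZx : ∀ i x, Z i x = ((∑ k ∈ Finset.range L,
      ‖Op (rho k (e i)) (P (k + 2) (pd (e i) f)) x‖ ^ 2 : ℝ) : ℂ) := by
    intro i x
    simp only [hZ]
    rw [sum_apply]
    push_cast
    apply Finset.sum_congr rfl
    intro k _
    rw [sqS_apply]; push_cast; rfl
  have hmain : n2 (SQ L (fun k => lam k ^ ((1:ℝ) + 1)) (fun k => Dl (k + 2) f))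
      ≤ d * n2 (∑ i, Z i) := by
    apply n2_le_mul (by positivity)
    intro x
    rw [norm_SQ _ _ (fun k => (Real.rpow_pos_of_pos (lam_pos k) _).le), sum_apply]
    simp_rw [hZx]
    rw [← Complex.ofReal_sum, Complex.norm_real, Real.norm_of_nonneg (by positivity),
      Finset.sum_comm, Finset.mul_sum]
    apply Finset.sum_le_sum
    intro k _
    have h1 := congrArg (fun u : Sch d => ‖u x‖ ^ 2) (riesz k f)
    simp only [_root_.smul_apply, norm_smul, Complex.norm_real, sum_apply, mul_pow] at h1
    rw [show lam k ^ ((1:ℝ) + 1) = ‖lam k‖ ^ 2 by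
      rw [Real.norm_of_nonneg (lam_pos k).le, ← Real.rpow_natCast]; norm_num, h1]
    have h2 : ‖(2 * Real.pi * Complex.I : ℂ)⁻¹‖ ^ 2 ≤ 1 := by
      apply pow_le_one₀ (norm_nonneg _)
      rw [norm_inv, norm_mul, norm_mul, Complex.norm_I, Complex.norm_real, Complex.norm_ofNat,
        Real.norm_of_nonneg hpi.le]
      apply inv_le_one_of_one_le₀
      have := Real.pi_gt_three
      linarith
    have h3 : ‖∑ i, Op (rho k (e i)) (P (k + 2) (pd (e i) f)) x‖ ^ 2
        ≤ d * ∑ i, ‖Op (rho k (e i)) (P (k + 2) (pd (e i) f)) x‖ ^ 2 := by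
      have h4 := norm_sum_le Finset.univ (fun i => Op (rho k (e i)) (P (k + 2) (pd (e i) f)) x)
      have h5 := sq_sum_le_card_mul_sum_sq (s := Finset.univ)
        (f := fun i => ‖Op (rho k (e i)) (P (k + 2) (pd (e i) f)) x‖)
      simp only [Finset.card_univ, Fintype.card_fin] at h5
      refine le_trans ?_ h5
      gcongr
    calc _ ≤ 1 * ‖∑ i, Op (rho k (e i)) (P (k + 2) (pd (e i) f)) x‖ ^ 2 :=
          mul_le_mul_of_nonneg_right h2 (by positivity)
      _ ≤ _ := by rw [one_mul]; exact h3
  refine hmain.trans ?_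
  have h6 : n2 (∑ i, Z i) ≤ (∑ i, K * C i ^ 2 * (2 * Real.pi)) * (A * Hs 1 f) := by
    refine (n2_sum _ _).trans ?_
    rw [Finset.sum_mul]
    exact Finset.sum_le_sum fun i _ => hZn i
  have h7 := mul_le_mul_of_nonneg_left h6 (Nat.cast_nonneg (α := ℝ) d)
  have h8 : 0 ≤ A * Hs 1 f := by positivity
  calc _ ≤ _ := h7
    _ ≤ _ := by rw [add_mul, add_mul, one_mul, ← mul_assoc, mul_assoc _ A]; linarith

end KP

namespace KP

variable {d : ℕ}

lemma lam_shift' (θ : ℝ) (k : ℕ) : lam (k + 2) ^ θ = (256:ℝ) ^ θ * lam k ^ θ := by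
  rw [show lam (k + 2) = 256 * lam k by rw [lam_succ, lam_succ]; ring,
    Real.mul_rpow (by norm_num) (lam_pos k).le]

lemma norm_P_le (k : ℕ) (g : Sch d) {B : ℝ} (h : ∀ x, ‖g x‖ ≤ B) (x : V d) :
    ‖P (k + 1) g x‖ ≤ W0 (eta 1 : Sch d) * B := by
  have := norm_Op_le (eta (k + 1)) g h x
  rwa [(W_eta k).1] at this

lemma boundV (s : ℝ) : ∃ K, 0 < K ∧ ∀ (C0 : ℝ) (L : ℕ) (sP : ℕ → Sch d) (g : Sch d) (B : ℝ),
    0 ≤ C0 → 0 ≤ B → (∀ x, ‖g x‖ ≤ B) → (∀ k, W0 (sP (k + 1)) ≤ C0 * lam (k + 1) ^ s) →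
    (∀ k, W1 (sP (k + 1)) ≤ C0 * lam (k + 1) ^ (s - 1)) →
    n2 (SQ L (fun k => lam k ^ (-(s + 1))) (fun k => Op (sP (k + 2)) (P (k + 2) g)))
      ≤ K * C0 ^ 2 * B * Hs (s - 1) g := by
  by_cases hs1 : s = 1
  · obtain ⟨K, hK, hq⟩ := SQ0 (d := d)
    refine ⟨K * 256 ^ 2, by positivity, ?_⟩
    intro C0 L sP g B hC hB hg h0 h1
    have hh := hq L g B (C0 * 256) (fun k => ((lam k ^ (-1:ℝ) : ℝ) : ℂ) • sP (k + 2)) hB hg (by positivity)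
      (by
        intro k _
        have hl := lam_pos k
        rw [W0_smul, Complex.norm_real, Real.norm_of_nonneg (by positivity)]
        refine (mul_le_mul_of_nonneg_left (h0 (k + 1)) (by positivity)).trans (le_of_eq ?_)
        rw [show k + 1 + 1 = k + 2 from rfl, lam_shift', hs1, Real.rpow_neg hl.le, Real.rpow_one,
          Real.rpow_one]
        field_simp)
      (by
        intro k _
        have hl := lam_pos k
        rw [W1_smul, Complex.norm_real, Real.norm_of_nonneg (by positivity)]
        refine (mul_le_mul_of_nonneg_left (h1 (k + 1)) (by positivity)).trans ?_
        rw [hs1, sub_self, Real.rpow_zero, Real.rpow_neg hl.le, Real.rpow_one, mul_one, mul_comm]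
        apply mul_le_mul_of_nonneg_right _ (by positivity)
        linarith)
    have e : SQ L (fun k => lam k ^ (-(s + 1))) (fun k => Op (sP (k + 2)) (P (k + 2) g))
        = ∑ k ∈ Finset.range L, sqS (Op (((lam k ^ (-1:ℝ) : ℝ) : ℂ) • sP (k + 2)) (P (k + 2) g)) := by
      have e1 : ∑ k ∈ Finset.range L, sqS (Op (((lam k ^ (-1:ℝ) : ℝ) : ℂ) • sP (k + 2)) (P (k + 2) g))
          = SQ L (fun _ => 1) (fun k => ((lam k ^ (-1:ℝ) : ℝ) : ℂ) • Op (sP (k + 2)) (P (k + 2) g)) := by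
        rw [SQ]
        apply Finset.sum_congr rfl
        intro k _
        rw [smul_Op, Complex.ofReal_one, one_smul]
      rw [e1, SQ_smul]
      congr 1; ext k
      rw [hs1, one_mul, ← Real.rpow_natCast, ← Real.rpow_mul (lam_pos k).le]
      norm_num
    rw [e]
    refine hh.trans (le_of_eq ?_)
    rw [hs1, sub_self, Hs_zero]; ring
  · obtain ⟨K, hK, hq⟩ := sqgen (d := d) (sub_ne_zero.2 hs1)
    have hW := W0_nonneg (eta 1 : Sch d)
    have hKs := Kθ_pos (s - 1)
    set c : ℝ := Real.sqrt K * (256 ^ s * W0 (eta 1 : Sch d)) *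
      (256 ^ s * (256:ℝ) ^ (-(s - 1)) * Real.sqrt (Kθ (s - 1))) with hc
    refine ⟨c + 1, by positivity, ?_⟩
    intro C0 L sP g B hC hB hg h0 h1
    have hH := Hs_nonneg (s - 1) g
    have hsh : ∀ k, lam k ^ (-s) * lam (k + 2) ^ s = 256 ^ s := by
      intro k
      rw [lam_shift', mul_left_comm, ← Real.rpow_add (lam_pos k)]
      simp
    have e : SQ L (fun k => lam k ^ (-(s + 1))) (fun k => Op (sP (k + 2)) (P (k + 2) g))
        = SQ L (fun k => lam k ^ (s - 1))
          (fun k => ((lam k ^ (-s) : ℝ) : ℂ) • Op (sP (k + 2)) (P (k + 2) g)) := by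
      rw [SQ_smul]
      congr 1; ext k
      rw [← Real.rpow_natCast, ← Real.rpow_mul (lam_pos k).le, ← Real.rpow_add (lam_pos k)]
      congr 1; push_cast; ring
    rw [e]
    have h2 := hq L (fun k => ((lam k ^ (-s) : ℝ) : ℂ) • Op (sP (k + 2)) (P (k + 2) g))
      (256 ^ s * C0 * (W0 (eta 1 : Sch d) * B)) (by positivity)
      (by
        intro k _ x
        have hl := lam_pos k
        have hl2 := lam_pos (k + 2)
        rw [_root_.smul_apply, norm_smul, Complex.norm_real, Real.norm_of_nonneg (by positivity)]
        have a1 := norm_Op_le (sP (k + 2)) (P (k + 2) g) (norm_P_le (k + 1) g hg) x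
        have a2 := mul_le_mul_of_nonneg_right (h0 (k + 1)) (show 0 ≤ W0 (eta 1 : Sch d) * B by positivity)
        refine (mul_le_mul_of_nonneg_left (a1.trans a2) (by positivity)).trans (le_of_eq ?_)
        rw [← hsh k]; ring)
    have h3 : ∑ k ∈ Finset.range L, (lam k ^ (s - 1)) ^ 2 *
        n2 (((lam k ^ (-s) : ℝ) : ℂ) • Op (sP (k + 2)) (P (k + 2) g)) ^ 2
        ≤ (256 ^ s * C0) ^ 2 * (((256:ℝ) ^ (-(s - 1))) ^ 2 * (Kθ (s - 1) * Hs (s - 1) g ^ 2)) := by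
      refine le_trans ?_ (mul_le_mul_of_nonneg_left
        (sqsum_shift (s - 1) L (fun k => P k g) (fun t => sqsum_P (s - 1) t g)) (by positivity))
      rw [Finset.mul_sum]
      apply Finset.sum_le_sum
      intro k _
      have hl := lam_pos k
      have hn := n2_nonneg (P (k + 2) g)
      rw [n2_smul, Complex.norm_real, Real.norm_of_nonneg (by positivity), mul_left_comm _ _ (n2 _ ^ 2),
        ← mul_pow (256 ^ s * C0) (n2 _)]
      apply mul_le_mul_of_nonneg_left _ (by positivity)
      apply pow_le_pow_left₀ (mul_nonneg (by positivity) (n2_nonneg _))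
      have a1 := (n2_Op_W0 (sP (k + 2)) (P (k + 2) g)).trans
        (mul_le_mul_of_nonneg_right (h0 (k + 1)) hn)
      refine (mul_le_mul_of_nonneg_left a1 (by positivity)).trans (le_of_eq ?_)
      rw [← hsh k]; ring
    have h5 : n2 (SQ L (fun k => lam k ^ (s - 1))
          (fun k => ((lam k ^ (-s) : ℝ) : ℂ) • Op (sP (k + 2)) (P (k + 2) g)))
          ≤ c * C0 ^ 2 * B * Hs (s - 1) g := by
      apply n2_le_of_sq (by positivity)
      refine h2.trans ((mul_le_mul_of_nonneg_left h3 (by positivity)).trans (le_of_eq ?_))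
      rw [hc]
      simp only [mul_pow, Real.sq_sqrt hK.le, Real.sq_sqrt hKs.le]; ring
    refine h5.trans ?_
    have h6 : 0 ≤ C0 ^ 2 * B * Hs (s - 1) g := by positivity
    have h7 : (c + 1) * C0 ^ 2 * B * Hs (s - 1) g
      = c * C0 ^ 2 * B * Hs (s - 1) g + C0 ^ 2 * B * Hs (s - 1) g := by ring
    linarith

lemma boundU (s : ℝ) : ∃ K, 0 < K ∧ ∀ (L : ℕ) (f : Sch d) (A : ℝ),
    0 ≤ A → (∀ x y, ‖f x - f y‖ ≤ A * ‖x - y‖) →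
    n2 (SQ L (fun k => lam k ^ (s + 1)) (fun k => Dl (k + 2) f)) ≤ K * A * Hs s f := by
  by_cases hs1 : s = 1
  · subst hs1; exact boundU_one
  · exact boundU_ne hs1

/-- Pointwise Cauchy-Schwarz for paired sums. -/
lemma n2_pair (L : ℕ) (c : ℕ → ℝ) (hc : ∀ k, 0 < c k) (a b : ℕ → Sch d) :
    n2 (∑ k ∈ Finset.range L, mulS (a k) (b k)) ^ 2
      ≤ n2 (SQ L c a) * n2 (SQ L (fun k => (c k)⁻¹) b) := by
  have hpt : ∀ x, ‖(∑ k ∈ Finset.range L, mulS (a k) (b k)) x‖ ^ 2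
      ≤ ‖SQ L c a x‖ * ‖SQ L (fun k => (c k)⁻¹) b x‖ := by
    intro x
    rw [norm_SQ _ _ (fun k => (hc k).le), norm_SQ _ _ (fun k => (inv_pos.2 (hc k)).le), sum_apply]
    have h1 : ‖∑ k ∈ Finset.range L, mulS (a k) (b k) x‖
        ≤ ∑ k ∈ Finset.range L, (Real.sqrt (c k) * ‖a k x‖) * (Real.sqrt (c k)⁻¹ * ‖b k x‖) := by
      refine (norm_sum_le _ _).trans (Finset.sum_le_sum fun k _ => ?_)
      rw [mulS_apply, norm_mul, Real.sqrt_inv]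
      have := Real.sqrt_pos.2 (hc k)
      apply le_of_eq; field_simp
    refine (pow_le_pow_left₀ (norm_nonneg _) h1 2).trans ?_
    refine (Finset.sum_mul_sq_le_sq_mul_sq _ _ _).trans (le_of_eq ?_)
    congr 1 <;> refine Finset.sum_congr rfl fun k _ => ?_
    · rw [mul_pow, Real.sq_sqrt (hc k).le]
    · rw [mul_pow, Real.sq_sqrt (inv_pos.2 (hc k)).le]
  rw [n2_sq]
  refine le_trans ?_ (cs _ _)
  exact integral_mono (int_sq _) (int_mul_norm _ _) hpt

end KP

namespace KP

variable {d : ℕ}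

lemma SQ_shift (L : ℕ) (c c' : ℕ → ℝ) (hc : ∀ k, 0 ≤ c k) (hc' : ∀ k, 0 ≤ c' k) {D : ℝ} (hD : 0 ≤ D)
    (p : ℕ) (h : ∀ k, c k ≤ D * c' (k + p)) (a : ℕ → Sch d) :
    n2 (SQ L c (fun k => a (k + p))) ≤ D * n2 (SQ (L + p) c' a) := by
  apply n2_le_mul hD
  intro x
  rw [norm_SQ _ _ hc, norm_SQ _ _ hc', add_comm L p, Finset.sum_range_add, mul_add]
  have h1 : 0 ≤ D * ∑ k ∈ Finset.range p, c' k * ‖a k x‖ ^ 2 :=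
    mul_nonneg hD (Finset.sum_nonneg fun k _ => mul_nonneg (hc' k) (by positivity))
  refine le_trans ?_ (le_add_of_nonneg_left h1)
  rw [Finset.mul_sum]
  apply Finset.sum_le_sum
  intro k _
  rw [add_comm p k, ← mul_assoc]
  exact mul_le_mul_of_nonneg_right (h k) (by positivity)

lemma diag {s : ℝ} (hs : 0 ≤ s) : ∃ K, 0 < K ∧ ∀ (C0 : ℝ) (L : ℕ) (sP : ℕ → Sch d) (f g : Sch d) (A B : ℝ)
    (p q : ℕ), p ≤ 1 → q ≤ 1 →
    0 ≤ C0 → 0 ≤ A → (∀ x y, ‖f x - f y‖ ≤ A * ‖x - y‖) → 0 ≤ B → (∀ x, ‖g x‖ ≤ B) →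
    (∀ k, W0 (sP (k + 1)) ≤ C0 * lam (k + 1) ^ s) →
    (∀ k, W1 (sP (k + 1)) ≤ C0 * lam (k + 1) ^ (s - 1)) →
    n2 (∑ k ∈ Finset.range L, mulS (Dl (k + p + 2) f) (Op (sP (k + q + 2)) (P (k + q + 2) g)))
      ≤ K * C0 * (A * Hs (s - 1) g + B * Hs s f) := by
  obtain ⟨KU, hKU, hU⟩ := boundU (d := d) s
  obtain ⟨KV, hKV, hV⟩ := boundV (d := d) s
  refine ⟨Real.sqrt (KU * (16 ^ (s + 1) * KV)), by positivity, ?_⟩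
  intro C0 L sP f g A B p q hp hq hC hA hf hB hg h0 h1
  have hHf := Hs_nonneg s f
  have hHg := Hs_nonneg (s - 1) g
  have hl : ∀ k, 0 < lam k ^ (s + 1) := fun k => Real.rpow_pos_of_pos (lam_pos k) _
  have e1 := n2_pair L (fun k => lam k ^ (s + 1)) hl (fun k => Dl (k + p + 2) f)
    (fun k => Op (sP (k + q + 2)) (P (k + q + 2) g))
  have e2 := SQ_shift L (fun k => lam k ^ (s + 1)) (fun k => lam k ^ (s + 1)) (fun k => (hl k).le)
    (fun k => (hl k).le) zero_le_one p (fun k => by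
      rw [one_mul]
      exact Real.rpow_le_rpow (lam_pos k).le (lam_mono (by omega)) (by linarith))
    (fun k => Dl (k + 2) f)
  have e3 := SQ_shift L (fun k => (lam k ^ (s + 1))⁻¹) (fun k => lam k ^ (-(s + 1)))
    (fun k => (inv_pos.2 (hl k)).le)
    (fun k => (Real.rpow_pos_of_pos (lam_pos k) _).le) (D := 16 ^ (s + 1)) (by positivity) q (fun k => by
      have hk := lam_pos k
      rw [← Real.rpow_neg hk.le]
      have h16 : (1:ℝ) ≤ 16 ^ (s + 1) := Real.one_le_rpow (by norm_num) (by linarith)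
      interval_cases q
      · rw [add_zero]
        exact le_mul_of_one_le_left (by positivity) h16
      · rw [lam_succ, Real.mul_rpow (by norm_num) hk.le, ← mul_assoc, ← Real.rpow_add (by norm_num)]
        simp)
    (fun k => Op (sP (k + 2)) (P (k + 2) g))
  have e4 := hU (L + p) f A hA hf
  have e5 := hV C0 (L + q) sP g B hC hB hg h0 h1
  have n1 := n2_nonneg (SQ L (fun k => (lam k ^ (s + 1))⁻¹) (fun k => Op (sP (k + q + 2)) (P (k + q + 2) g)))
  apply n2_le_of_sq (by positivity)
  rw [one_mul] at e2
  have e6 := e3.trans (mul_le_mul_of_nonneg_left e5 (by positivity))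
  have e7 := e1.trans (mul_le_mul (e2.trans e4) e6 n1 (by positivity))
  refine e7.trans ?_
  rw [mul_pow, mul_pow, Real.sq_sqrt (by positivity)]
  calc _ = KU * (16 ^ (s + 1) * KV) * C0 ^ 2 * ((A * Hs (s - 1) g) * (B * Hs s f)) := by ring
    _ ≤ _ := by
      apply mul_le_mul_of_nonneg_left _ (by positivity)
      have := mul_nonneg hA hHg
      have := mul_nonneg hB hHf
      nlinarith

/-- Hypotheses on localised symbols. -/
structure HypL (s C0 : ℝ) (σ : V d → ℂ) (sL sP : ℕ → Sch d) : Prop where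
  hC : 0 ≤ C0
  eL : ∀ j ξ, sL j ξ = phi j ξ * σ ξ
  eP : ∀ j ξ, sP j ξ = eta j ξ * σ ξ
  L0 : ∀ j, W0 (sL j) ≤ C0 * lam j ^ s
  P0 : ∀ k, W0 (sP (k + 1)) ≤ C0 * lam (k + 1) ^ s
  P1 : ∀ k, W1 (sP (k + 1)) ≤ C0 * lam (k + 1) ^ (s - 1)

lemma HypL.succ {s C0 : ℝ} {σ : V d → ℂ} {sL sP : ℕ → Sch d} (h : HypL s C0 σ sL sP) (k : ℕ) (g : Sch d) :
    Op (sL (k + 1)) g = Op (sL k) g + Op (sP (k + 1)) (P (k + 1) g) := by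
  have : sL (k + 1) = sL k + mulS (sP (k + 1)) (eta (k + 1)) := by
    ext ξ
    have h1 := congrArg (fun u : Sch d => u ξ) (phi_succ (d := d) k)
    simp only [_root_.add_apply, psi, mulS_apply] at h1
    rw [_root_.add_apply, mulS_apply, h.eL, h.eL, h.eP, h1]
    ring
  rw [this, add_Op, P, Op_Op]

lemma boundIII {s : ℝ} (hs : 0 ≤ s) : ∃ K, 0 < K ∧ ∀ (C0 : ℝ) (σ : V d → ℂ) (sL sP : ℕ → Sch d),
    HypL s C0 σ sL sP → ∀ (M : ℕ) (f g : Sch d) (A B : ℝ),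
    0 ≤ A → (∀ x y, ‖f x - f y‖ ≤ A * ‖x - y‖) → 0 ≤ B → (∀ x, ‖g x‖ ≤ B) →
    n2 (∑ j ∈ Finset.range (M + 3), mulS (Dl j f) (Op (sL (j + 1)) g))
      ≤ K * C0 * (A * Hs (s - 1) g + B * Hs s f) := by
  obtain ⟨K, hK, hd⟩ := diag (d := d) hs
  have hW := W0_nonneg (eta 1 : Sch d)
  have hKs := Kθ_pos s
  refine ⟨2 * (16 ^ s * Kθ s) + 2 * Kθ s + W0 (eta 1 : Sch d) * Kθ s + 3 * K, by positivity, ?_⟩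
  intro C0 σ sL sP h M f g A B hA hf hB hg
  have hC := h.hC
  have hHf := Hs_nonneg s f
  have hHg := Hs_nonneg (s - 1) g
  set u : ℕ → Sch d := fun j => mulS (Dl j f) (Op (sL (j + 1)) g) with hu
  have hlow : ∀ j, n2 (u j) ≤ C0 * B * (16 ^ s * Kθ s) * Hs s f := by
    intro j
    have hl := lam_pos j
    have hl1 := lam_pos (j + 1)
    have h2 := n2_nonneg (Dl j f)
    have h1 := n2_mulS_right (Dl j f) (Op (sL (j + 1)) g) (B := C0 * lam (j + 1) ^ s * B) (by positivity)
      (fun x => (norm_Op_le _ g hg x).trans (mul_le_mul_of_nonneg_right (h.L0 _) hB))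
    refine h1.trans ?_
    rw [lam_succ, Real.mul_rpow (by norm_num) hl.le]
    calc _ = C0 * B * 16 ^ s * (lam j ^ s * n2 (Dl j f)) := by ring
      _ ≤ C0 * B * 16 ^ s * (Kθ s * Hs s f) := mul_le_mul_of_nonneg_left (n2_D_le s j f) (by positivity)
      _ = _ := by ring
  -- the splitting
  set HL := ∑ k ∈ Finset.range (M + 1), mulS (Dl (k + 2) f) (Op (sL k) g) with hHL
  set D1 := ∑ k ∈ Finset.range M, mulS (Dl (k + 1 + 2) f) (Op (sP (k + 0 + 2)) (P (k + 0 + 2) g)) with hD1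
  set D2 := ∑ k ∈ Finset.range (M + 1), mulS (Dl (k + 0 + 2) f) (Op (sP (k + 0 + 2)) (P (k + 0 + 2) g)) with hD2
  set D3 := ∑ k ∈ Finset.range (M + 1), mulS (Dl (k + 0 + 2) f) (Op (sP (k + 1 + 2)) (P (k + 1 + 2) g)) with hD3
  set T := mulS (Dl 2 f) (Op (sP 1) (P 1 g)) with hT
  have hsplit : ∑ j ∈ Finset.range (M + 3), u j = u 0 + u 1 + (HL + (T + D1) + D2 + D3) := by
    have e1 : T + D1 = ∑ k ∈ Finset.range (M + 1), mulS (Dl (k + 2) f) (Op (sP (k + 1)) (P (k + 1) g)) := by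
      rw [Finset.sum_range_succ', add_comm]
    rw [e1, hHL, hD2, hD3, ← Finset.sum_add_distrib, ← Finset.sum_add_distrib, ← Finset.sum_add_distrib,
      Finset.sum_range_succ', Finset.sum_range_succ', add_comm (u 0), add_assoc, add_comm (_ : Sch d) (u 1 + u 0)]
    congr 1
    apply Finset.sum_congr rfl
    intro k _
    simp only [hu]
    rw [← mulS_add, ← mulS_add, ← mulS_add, h.succ, h.succ, h.succ]
  have b1 : n2 HL ≤ 2 * Kθ s * (C0 * B) * Hs s f := by
    apply ann_bound s _ _ f (by positivity)
    · intro k _ ξ hξ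
      rw [mulS_comm] at hξ
      refine ann_mul ?_ ?_ ξ hξ
      · intro ζ hz
        rw [fourier_Op_apply, h.eL, phi_apply] at hz
        exact phiR_ne (by
          intro h0; apply hz; rw [h0]; simp)
      · intro ζ hz
        exact ⟨spec_D' hz, spec_D hz⟩
    · intro k _
      have hl := lam_pos k
      have hn := n2_nonneg (Dl (k + 2) f)
      have h1 := n2_mulS_right (Dl (k + 2) f) (Op (sL k) g) (B := C0 * lam k ^ s * B) (by positivity)
        (fun x => (norm_Op_le _ g hg x).trans (mul_le_mul_of_nonneg_right (h.L0 _) hB))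
      refine h1.trans ?_
      have h2 : lam k ^ s ≤ lam (k + 2) ^ s := Real.rpow_le_rpow hl.le (lam_mono (by omega)) hs
      calc _ = C0 * B * (lam k ^ s * n2 (Dl (k + 2) f)) := by ring
        _ ≤ _ := by gcongr
  have b2 : n2 T ≤ W0 (eta 1 : Sch d) * Kθ s * C0 * (B * Hs s f) := by
    have hn := n2_nonneg (Dl 2 f)
    have hl := lam_pos 1
    have h1 := n2_mulS_right (Dl 2 f) (Op (sP 1) (P 1 g)) (B := C0 * lam 1 ^ s * (W0 (eta 1 : Sch d) * B))
      (by positivity)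
      (fun x => (norm_Op_le _ _ (norm_P_le 0 g hg) x).trans
        (mul_le_mul_of_nonneg_right (h.P0 0) (by positivity)))
    refine h1.trans ?_
    have h2 : lam 1 ^ s ≤ lam 2 ^ s := Real.rpow_le_rpow hl.le (lam_mono (by omega)) hs
    have h3 := (mul_le_mul_of_nonneg_right h2 hn).trans (n2_D_le s 2 f)
    calc _ = C0 * (W0 (eta 1 : Sch d) * B) * (lam 1 ^ s * n2 (Dl 2 f)) := by ring
      _ ≤ C0 * (W0 (eta 1 : Sch d) * B) * (Kθ s * Hs s f) := mul_le_mul_of_nonneg_left h3 (by positivity)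
      _ = _ := by ring
  have b3 := hd C0 M sP f g A B 1 0 (by omega) (by omega) hC hA hf hB hg h.P0 h.P1
  have b4 := hd C0 (M + 1) sP f g A B 0 0 (by omega) (by omega) hC hA hf hB hg h.P0 h.P1
  have b5 := hd C0 (M + 1) sP f g A B 0 1 (by omega) (by omega) hC hA hf hB hg h.P0 h.P1
  rw [hsplit]
  have t1 := n2_add (u 0 + u 1) (HL + (T + D1) + D2 + D3)
  have t2 := n2_add (u 0) (u 1)
  have t3 := n2_add (HL + (T + D1) + D2) D3
  have t4 := n2_add (HL + (T + D1)) D2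
  have t5 := n2_add HL (T + D1)
  have t6 := n2_add T D1
  have l0 := hlow 0
  have l1 := hlow 1
  set X := A * Hs (s - 1) g with hX
  set Y := B * Hs s f with hY
  have hX0 : 0 ≤ X := by positivity
  have hY0 : 0 ≤ Y := by positivity
  have l0' : n2 (u 0) ≤ 16 ^ s * Kθ s * C0 * Y := by rw [hY]; linarith
  have l1' : n2 (u 1) ≤ 16 ^ s * Kθ s * C0 * Y := by rw [hY]; linarith
  have b1' : n2 HL ≤ 2 * Kθ s * C0 * Y := by rw [hY]; linarith
  have hh : 0 ≤ (2 * (16 ^ s * Kθ s) + 2 * Kθ s + W0 (eta 1 : Sch d) * Kθ s) * C0 * X := by positivity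
  change n2 D1 ≤ _ at b3
  change n2 D2 ≤ _ at b4
  change n2 D3 ≤ _ at b5
  linarith

end KP

namespace KP

variable {d : ℕ}

/-- All hypotheses on the symbol. -/
structure Hyp (s C0 : ℝ) (σ : V d → ℂ) (sL sP sX : ℕ → Sch d) : Prop extends HypL s C0 σ sL sP where
  eX : ∀ j ξ, sX j ξ = (chiR j ξ : ℂ) * σ ξ
  X1 : ∀ k, W1 (sX (k + 2)) ≤ C0 * lam (k + 2) ^ (s - 1)
  bd : ∀ ξ, ‖σ ξ‖ ≤ (1 + ‖ξ‖ ^ 2) ^ (s / 2)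

lemma Hyp.comm_eq {s C0 : ℝ} {σ : V d → ℂ} {sL sP sX : ℕ → Sch d} (h : Hyp s C0 σ sL sP sX)
    {N k : ℕ} (hk : k < N) (f g : Sch d) :
    comm (sL (N + 3)) (S k f) (Dl (k + 2) g) = comm (sX (k + 2)) (S k f) (Dl (k + 2) g) := by
  have hl := lam_pos k
  have key : ∀ ξ : V d, 14 * lam k ≤ ‖ξ‖ → ‖ξ‖ ≤ 514 * lam k → sL (N + 3) ξ = sX (k + 2) ξ := by
    intro ξ h1 h2
    have e2 : lam (k + 2) = 256 * lam k := by rw [lam_succ, lam_succ]; ring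
    have e3 : lam (k + 3) = 4096 * lam k := by rw [lam_succ, lam_succ, lam_succ]; ring
    have e4 := lam_mono (show k + 3 ≤ N + 3 by omega)
    rw [h.eL, h.eX, phi_apply, phiR_one (by linarith), chiR_one (by linarith) (by linarith)]
  have hD : ∀ ξ, 𝓕 (Dl (k + 2) g) ξ ≠ 0 → lam (k + 1) ≤ ‖ξ‖ ∧ ‖ξ‖ ≤ 2 * lam (k + 2) :=
    fun ξ hξ => ⟨spec_D' hξ, spec_D hξ⟩
  have e1 : Op (sL (N + 3)) (mulS (S k f) (Dl (k + 2) g)) = Op (sX (k + 2)) (mulS (S k f) (Dl (k + 2) g)) := by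
    apply Op_congr
    intro ξ hξ
    have := ann_mul (fun ζ hz => spec_S hz) hD ξ hξ
    exact key ξ this.1 this.2
  have e2 : Op (sL (N + 3)) (Dl (k + 2) g) = Op (sX (k + 2)) (Dl (k + 2) g) := by
    apply Op_congr
    intro ξ hξ
    have := hD ξ hξ
    rw [lam_succ (k + 1), lam_succ k] at this
    exact key ξ (by linarith) (by linarith)
  rw [comm, comm, e1, e2]

lemma Op_swap (m m' u : Sch d) : Op m (Op m' u) = Op m' (Op m u) := by
  rw [Op_Op, Op_Op, mulS_comm]

lemma Hyp.split {s C0 : ℝ} {σ : V d → ℂ} {sL sP sX : ℕ → Sch d} (h : Hyp s C0 σ sL sP sX)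
    (N : ℕ) (f g : Sch d) :
    comm (sL (N + 3)) (S N f) (S (N + 1) g) =
      ∑ k ∈ Finset.range N, comm (sX (k + 2)) (S k f) (Dl (k + 2) g)
      + Op (sL (N + 3)) (∑ j ∈ Finset.range (N + 1), mulS (Dl j f) (S (j + 1) g))
      - ∑ j ∈ Finset.range (N + 1), mulS (Dl j f) (Op (sL (j + 1)) g) := by
  have e1 : Op (sL (N + 3)) (S (N + 1) g) = S (N + 1) (Op (sL (N + 3)) g) := Op_swap _ _ _
  have e2 : ∀ k ∈ Finset.range N, comm (sX (k + 2)) (S k f) (Dl (k + 2) g)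
      = Op (sL (N + 3)) (mulS (S k f) (Dl (k + 2) g)) - mulS (S k f) (Dl (k + 2) (Op (sL (N + 3)) g)) := by
    intro k hk
    rw [← h.comm_eq (Finset.mem_range.1 hk), comm]
    congr 2
    exact Op_swap _ _ _
  have e3 : ∀ j ∈ Finset.range (N + 1), mulS (Dl j f) (Op (sL (j + 1)) g)
      = mulS (Dl j f) (S (j + 1) (Op (sL (N + 3)) g)) := by
    intro j hj
    congr 1
    rw [S, Op_Op]
    congr 1
    ext ξ
    rw [mulS_apply, h.eL, h.eL]
    by_cases h0 : phiR (j + 1) ξ = 0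
    · rw [phi_apply, h0]; simp
    · have h1 := phiR_ne h0
      have h2 := lam_mono (show j + 2 ≤ N + 3 by have := Finset.mem_range.1 hj; omega)
      rw [lam_succ (j + 1)] at h2
      have := lam_pos (j + 1)
      rw [phi_apply (N + 3), phiR_one (by linarith)]
      simp
  rw [comm, e1, paraproduct, paraproduct f (Op (sL (N + 3)) g), Finset.sum_congr rfl e2,
    Finset.sum_congr rfl e3, Op_add, Op_sum, Finset.sum_sub_distrib]
  abel

lemma hypOne : ∃ C1, 0 ≤ C1 ∧ HypL (d := d) 0 C1 (fun _ => 1) phi eta := by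
  have h1 := W0_nonneg (phi 0 : Sch d)
  have h2 := W0_nonneg (eta 1 : Sch d)
  have h3 := W1_nonneg (eta 1 : Sch d)
  refine ⟨W0 (phi 0 : Sch d) + W0 (eta 1 : Sch d) + 16 * W1 (eta 1 : Sch d), by positivity,
    by positivity, by simp, by simp, ?_, ?_, ?_⟩
  · intro j
    rw [(W_phi j).1, Real.rpow_zero]; linarith
  · intro j
    rw [(W_eta j).1, Real.rpow_zero]; linarith
  · intro k
    have hl := lam_pos k
    rw [(W_eta k).2, zero_sub, Real.rpow_neg (lam_pos _).le, Real.rpow_one, lam_succ, mul_inv,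
      ← mul_assoc, mul_comm]
    apply mul_le_mul_of_nonneg_right _ (by positivity)
    linarith

theorem core {s : ℝ} (hs : 0 ≤ s) : ∃ K, 0 < K ∧ ∀ (C0 : ℝ) (σ : V d → ℂ) (sL sP sX : ℕ → Sch d),
    Hyp s C0 σ sL sP sX → ∀ (M : ℕ) (f g : Sch d) (A B : ℝ),
    0 ≤ A → (∀ x y, ‖f x - f y‖ ≤ A * ‖x - y‖) → 0 ≤ B → (∀ x, ‖g x‖ ≤ B) →
    n2 (comm (sL (M + 2 + 3)) (S (M + 2) f) (S (M + 2 + 1) g))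
      ≤ K * (C0 + 1) * (A * Hs (s - 1) g + B * Hs s f) := by
  obtain ⟨K3, hK3, h3⟩ := boundIII (d := d) hs
  have hII : ∃ K2, 0 < K2 ∧ ∀ (C0 : ℝ) (σ : V d → ℂ) (sL sP sX : ℕ → Sch d),
    Hyp s C0 σ sL sP sX → ∀ (M : ℕ) (f g : Sch d) (A B : ℝ),
    0 ≤ A → (∀ x y, ‖f x - f y‖ ≤ A * ‖x - y‖) → 0 ≤ B → (∀ x, ‖g x‖ ≤ B) →
    n2 (Op (sL (M + 2 + 3)) (∑ j ∈ Finset.range (M + 2 + 1), mulS (Dl j f) (S (j + 1) g)))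
      ≤ K2 * (A * Hs (s - 1) g + B * Hs s f) := by
    rcases hs.eq_or_lt with h0 | hpos
    · subst h0
      obtain ⟨C1, hC1, hyp1⟩ := hypOne (d := d)
      refine ⟨K3 * C1 + 1, by positivity, ?_⟩
      intro C0 σ sL sP sX h M f g A B hA hf hB hg
      have hHf := Hs_nonneg 0 f
      have hHg := Hs_nonneg (0 - 1) g
      have e1 := n2_Op_le (sL (M + 2 + 3)) (∑ j ∈ Finset.range (M + 2 + 1), mulS (Dl j f) (S (j + 1) g))
        zero_le_one (by
          intro ξ
          have := h.bd ξ
          rw [zero_div, Real.rpow_zero] at this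
          rw [h.eL, norm_mul]
          exact mul_le_one₀ (norm_phi_le _ _) (norm_nonneg _) this)
      have e2 := h3 C1 _ _ _ hyp1 M f g A B hA hf hB hg
      rw [one_mul] at e1
      refine e1.trans (e2.trans ?_)
      apply mul_le_mul_of_nonneg_right _ (by positivity)
      linarith
    · obtain ⟨K, hK, ht⟩ := termII (d := d) hpos
      have hW := W0_nonneg (phi 0 : Sch d)
      refine ⟨K * W0 (phi 0 : Sch d) + 1, by positivity, ?_⟩
      intro C0 σ sL sP sX h M f g A B hA hf hB hg
      have hHf := Hs_nonneg s f
      have hHg := Hs_nonneg (s - 1) g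
      have e1 := ht (M + 2 + 1) (sL (M + 2 + 3)) (fun j => mulS (Dl j f) (S (j + 1) g)) f
        (W0 (phi 0 : Sch d) * B) (by positivity)
        (by
          intro ξ
          have h1 : ‖sL (M + 2 + 3) ξ‖ ≤ (1 + ‖ξ‖ ^ 2) ^ (s / 2) := by
            rw [h.eL, norm_mul]
            exact (mul_le_of_le_one_left (norm_nonneg _) (norm_phi_le _ _)).trans (h.bd ξ)
          refine (pow_le_pow_left₀ (norm_nonneg _) h1 2).trans (le_of_eq ?_)
          rw [← Real.rpow_natCast, ← Real.rpow_mul (by positivity)]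
          congr 1; push_cast; ring)
        (by
          intro j _ ξ hξ
          obtain ⟨a, b, rfl, ha, hb⟩ := fourier_mulS_ne hξ
          have h1 := spec_D ha
          have h2 := spec_S hb
          rw [lam_succ] at h2
          have h3 := norm_add_le a b
          have := lam_pos j
          linarith)
        (by
          intro j _
          exact n2_mulS_right _ _ (by positivity) (norm_S_le (j + 1) g hg))
      refine e1.trans ?_
      have t1 : 0 ≤ B * Hs s f := by positivity
      have t2 : 0 ≤ (K * W0 (phi 0 : Sch d) + 1) * (A * Hs (s - 1) g) := by positivity
      linarith
  obtain ⟨K2, hK2, h2⟩ := hII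
  have hW := W0_nonneg (phi 0 : Sch d)
  have hKs := Kθ_pos (s - 1)
  refine ⟨2 * Kθ (s - 1) * W0 (phi 0 : Sch d) + K2 + K3, by positivity, ?_⟩
  intro C0 σ sL sP sX h M f g A B hA hf hB hg
  have hC := h.hC
  have hHf := Hs_nonneg s f
  have hHg := Hs_nonneg (s - 1) g
  have b3 := h3 C0 σ sL sP h.toHypL M f g A B hA hf hB hg
  have b2 := h2 C0 σ sL sP sX h M f g A B hA hf hB hg
  have b1 : n2 (∑ k ∈ Finset.range (M + 2), comm (sX (k + 2)) (S k f) (Dl (k + 2) g))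
      ≤ 2 * Kθ (s - 1) * (C0 * (W0 (phi 0 : Sch d) * A)) * Hs (s - 1) g := by
    apply ann_bound (s - 1) _ _ g (by positivity)
    · intro k _ ξ hξ
      have hD : ∀ ξ, 𝓕 (Dl (k + 2) g) ξ ≠ 0 → lam (k + 1) ≤ ‖ξ‖ ∧ ‖ξ‖ ≤ 2 * lam (k + 2) :=
        fun ξ hξ => ⟨spec_D' hξ, spec_D hξ⟩
      rw [comm, fourier_subS] at hξ
      by_cases h0 : 𝓕 (Op (sX (k + 2)) (mulS (S k f) (Dl (k + 2) g))) ξ = 0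
      · rw [h0, zero_sub] at hξ
        exact ann_mul (fun ζ hz => spec_S hz) (fun ζ hz => hD ζ (by
          rw [fourier_Op_apply] at hz; exact right_ne_zero_of_mul hz)) ξ (neg_ne_zero.1 hξ)
      · rw [fourier_Op_apply] at h0
        exact ann_mul (fun ζ hz => spec_S hz) hD ξ (right_ne_zero_of_mul h0)
    · intro k _
      have hl := lam_pos (k + 2)
      have hn := n2_nonneg (Dl (k + 2) g)
      have h1 := n2_comm_le (sX (k + 2)) (S k f) (Dl (k + 2) g) (A := W0 (phi 0 : Sch d) * A) (by positivity)
        (fun x y => by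
          have := Op_lip (phi k) f hf x y
          rwa [(W_phi k).1] at this)
      refine h1.trans ?_
      have h2 := mul_le_mul_of_nonneg_right (h.X1 k) (show 0 ≤ W0 (phi 0 : Sch d) * A * n2 (Dl (k + 2) g) by positivity)
      calc _ = W1 (sX (k + 2)) * (W0 (phi 0 : Sch d) * A * n2 (Dl (k + 2) g)) := by ring
        _ ≤ _ := h2
        _ = _ := by ring
  rw [h.split]
  refine (n2_sub _ _).trans ?_
  refine (add_le_add_left (n2_add _ _) _).trans ?_
  refine (add_le_add (add_le_add b1 b2) b3).trans ?_
  set X := A * Hs (s - 1) g with hX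
  set Y := B * Hs s f with hY
  have hX0 : 0 ≤ X := by positivity
  have hY0 : 0 ≤ Y := by positivity
  have e : 2 * Kθ (s - 1) * (C0 * (W0 (phi 0 : Sch d) * A)) * Hs (s - 1) g
      = 2 * Kθ (s - 1) * W0 (phi 0 : Sch d) * C0 * X := by rw [hX]; ring
  rw [e]
  have p1 : 0 ≤ 2 * Kθ (s - 1) * W0 (phi 0 : Sch d) * (C0 * Y + X + Y) := by positivity
  have p2 : 0 ≤ K2 * C0 * (X + Y) := by positivity
  have p3 : 0 ≤ K3 * (X + Y) := by positivity
  linarith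

end KP

namespace KP

variable {d : ℕ}

lemma conv_int {p q : V d → ℝ} (hp : Integrable p) (hq : Integrable q) :
    Integrable (fun x => ∫ y, p y * q (x - y)) ∧ ∫ x, ∫ y, p y * q (x - y) = (∫ x, p x) * ∫ x, q x := by
  constructor
  · exact hp.integrable_convolution (ContinuousLinearMap.mul ℝ ℝ) hq
  · exact integral_convolution (ContinuousLinearMap.mul ℝ ℝ) hp hq

lemma ker_mulS (m m' : Sch d) (x : V d) : ker (mulS m m') x = ∫ z, ker m z * ker m' (x - z) := by
  have : ker (mulS m m') = Op m (ker m') := by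
    rw [ker, Op]; simp [ker]
  rw [this, Op_apply]

lemma W0_mulS (m m' : Sch d) : W0 (mulS m m') ≤ W0 m * W0 m' := by
  have h := conv_int (int_W0 m) (int_W0 m')
  rw [W0, W0, W0, ← h.2]
  apply integral_mono (int_W0 _) h.1
  intro x
  change ‖ker (mulS m m') x‖ ≤ _
  rw [ker_mulS]
  refine (norm_integral_le_integral_norm _).trans (le_of_eq ?_)
  congr 1; ext y; rw [norm_mul]

lemma W1_mulS (m m' : Sch d) : W1 (mulS m m') ≤ W1 m * W0 m' + W0 m * W1 m' := by
  have h1 := conv_int (int_W1 m) (int_W0 m')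
  have h2 := conv_int (int_W0 m) (int_W1 m')
  rw [W1, W1, W0, W0, W1, ← h1.2, ← h2.2, ← integral_add h1.1 h2.1]
  apply integral_mono (int_W1 _) (h1.1.add h2.1)
  intro x
  change ‖x‖ * ‖ker (mulS m m') x‖ ≤ (∫ y, _) + (∫ y, _)
  obtain ⟨B, -, hB⟩ := exists_bdd (ker m')
  have c0 := (ker m').continuous
  obtain ⟨B1, hB1⟩ : ∃ B1, ∀ y, ‖y‖ * ‖ker m' y‖ ≤ B1 := by
    refine ⟨SchwartzMap.seminorm ℝ 1 0 (ker m'), fun y => ?_⟩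
    simpa using SchwartzMap.norm_pow_mul_le_seminorm ℝ (ker m') 1 y
  have i1 : Integrable (fun y => (‖y‖ * ‖ker m y‖) * ‖ker m' (x - y)‖) := by
    refine (int_W1 m).mul_bdd (c := B) (Continuous.aestronglyMeasurable (by fun_prop)) ?_
    filter_upwards with y
    rw [norm_norm]; exact hB _
  have i2 : Integrable (fun y => ‖ker m y‖ * (‖x - y‖ * ‖ker m' (x - y)‖)) := by
    refine (int_W0 m).mul_bdd (c := B1) (Continuous.aestronglyMeasurable (by fun_prop)) ?_
    filter_upwards with y
    rw [Real.norm_of_nonneg (by positivity)]; exact hB1 _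
  rw [← integral_add i1 i2, ker_mulS]
  calc _ ≤ ‖x‖ * ∫ z, ‖ker m z * ker m' (x - z)‖ :=
        mul_le_mul_of_nonneg_left (norm_integral_le_integral_norm _) (norm_nonneg _)
    _ = ∫ z, ‖x‖ * ‖ker m z * ker m' (x - z)‖ := by rw [integral_const_mul]
    _ ≤ _ := by
      apply integral_mono_of_nonneg
      · filter_upwards with y; positivity
      · exact i1.add i2
      · filter_upwards with y
        rw [norm_mul]
        have h3 : ‖x‖ ≤ ‖y‖ + ‖x - y‖ := by
          have := norm_add_le y (x - y)
          rwa [add_sub_cancel] at this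
        calc _ ≤ (‖y‖ + ‖x - y‖) * (‖ker m y‖ * ‖ker m' (x - y)‖) :=
              mul_le_mul_of_nonneg_right h3 (by positivity)
          _ = _ := by ring

/-- W0, W1 are controlled by Schwartz seminorms. -/
lemma W_seminorm : ∃ (t : Finset (ℕ × ℕ)) (C : ℝ), 0 ≤ C ∧ ∀ (m : Sch d) (M : ℝ), 0 ≤ M →
    (∀ i ∈ t, SchwartzMap.seminorm ℝ i.1 i.2 m ≤ M) → W0 m ≤ C * M ∧ W1 m ≤ C * M := by
  have key : ∀ k : ℕ, ∃ (t : Finset (ℕ × ℕ)) (C : ℝ), 0 ≤ C ∧ ∀ (m : Sch d) (M : ℝ), 0 ≤ M →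
    (∀ i ∈ t, SchwartzMap.seminorm ℝ i.1 i.2 m ≤ M) → SchwartzMap.seminorm ℝ k 0 (ker m) ≤ C * M := by
    intro k
    set q : Seminorm ℝ (Sch d) := (SchwartzMap.seminorm ℝ k 0).comp
      (FourierTransform.fourierInvCLM ℝ (Sch d) : Sch d →ₗ[ℝ] Sch d) with hq
    have hqc : Continuous q := by
      have h1 : Continuous (SchwartzMap.seminorm ℝ k 0 : Sch d → ℝ) :=
        (schwartz_withSeminorms ℝ (V d) ℂ).continuous_seminorm (k, 0)
      exact h1.comp (FourierTransform.fourierInvCLM ℝ (Sch d)).continuous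
    obtain ⟨t, C, -, hC⟩ := Seminorm.bound_of_continuous (schwartz_withSeminorms ℝ (V d) ℂ) q hqc
    refine ⟨t, C, C.2, ?_⟩
    intro m M hM h
    have h1 := hC m
    have h2 : (t.sup (schwartzSeminormFamily ℝ (V d) ℂ)) m ≤ M := Seminorm.finset_sup_apply_le hM h
    calc _ = q m := rfl
      _ ≤ _ := h1
      _ ≤ C * M := mul_le_mul_of_nonneg_left h2 C.2
  set p := (volume : Measure (V d)).integrablePower
  obtain ⟨t0, C0, hC0, h0⟩ := key 0
  obtain ⟨t1, C1, hC1, h1⟩ := key (0 + p)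
  obtain ⟨t2, C2, hC2, h2⟩ := key (1 + p)
  set I : ℝ := 2 ^ p * ∫ x : V d, (1 + ‖x‖) ^ (-(p : ℝ)) with hI
  have hI0 : 0 ≤ I := mul_nonneg (by positivity) (integral_nonneg fun _ => by positivity)
  classical
  refine ⟨t0 ∪ t1 ∪ t2, I * (C0 + C1 + C2), by positivity, ?_⟩
  intro m M hM h
  have e0 := h0 m M hM (fun i hi => h i (by simp [hi]))
  have e1 := h1 m M hM (fun i hi => h i (by simp [hi]))
  have e2 := h2 m M hM (fun i hi => h i (by simp [hi]))
  have f0 := SchwartzMap.integral_pow_mul_iteratedFDeriv_le ℝ volume (ker m) 0 0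
  have f1 := SchwartzMap.integral_pow_mul_iteratedFDeriv_le ℝ volume (ker m) 1 0
  simp only [norm_iteratedFDeriv_zero, pow_zero, one_mul, pow_one] at f0 f1
  change W0 m ≤ I * _ at f0
  change W1 m ≤ I * _ at f1
  have n0 : 0 ≤ C2 * M := by positivity
  have n1 : 0 ≤ C1 * M := by positivity
  constructor
  · refine f0.trans ((mul_le_mul_of_nonneg_left (c := (C0 + C1 + C2) * M) (by linarith) hI0).trans_eq (mul_assoc I (C0 + C1 + C2) M).symm)
  · refine f1.trans ((mul_le_mul_of_nonneg_left (c := (C0 + C1 + C2) * M) (by linarith) hI0).trans_eq (mul_assoc I (C0 + C1 + C2) M).symm)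

/-- Uniform bounds for smooth families of symbols. -/
lemma family {G : ℝ × V d → ℝ} (hG : ContDiff ℝ (⊤ : ℕ∞) G) {R : ℝ} (hR : ∀ t ξ, G (t, ξ) ≠ 0 → ‖ξ‖ ≤ R) :
    ∃ C, 0 ≤ C ∧ ∀ t, 0 ≤ t → t ≤ 1 → ∀ m : Sch d, (∀ ξ, m ξ = (G (t, ξ) : ℂ)) → W0 m ≤ C ∧ W1 m ≤ C := by
  obtain ⟨T, C, hC, hT⟩ := W_seminorm (d := d)
  set Gc : ℝ × V d → ℂ := fun z => (G z : ℂ) with hGc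
  have hGcd : ContDiff ℝ (⊤ : ℕ∞) Gc := Complex.ofRealCLM.contDiff.comp hG
  have key : ∀ i : ℕ × ℕ, ∃ M, 0 ≤ M ∧ ∀ t, 0 ≤ t → t ≤ 1 → ∀ m : Sch d, (∀ ξ, m ξ = (G (t, ξ) : ℂ)) →
      SchwartzMap.seminorm ℝ i.1 i.2 m ≤ M := by
    rintro ⟨p, n⟩
    have hcomp : IsCompact (Set.Icc (0:ℝ) 1 ×ˢ Metric.closedBall (0 : V d) R) :=
      isCompact_Icc.prod (isCompact_closedBall _ _)
    have hcont : Continuous (fun z => iteratedFDeriv ℝ n Gc z) :=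
      hGcd.continuous_iteratedFDeriv (by exact_mod_cast le_top)
    obtain ⟨D, hD⟩ := hcomp.exists_bound_of_continuousOn hcont.continuousOn
    set J := ‖ContinuousLinearMap.inr ℝ ℝ (V d)‖
    refine ⟨|R| ^ p * (|D| * J ^ n), by positivity, ?_⟩
    intro t ht0 ht1 m hm
    apply SchwartzMap.seminorm_le_bound ℝ p n m (by positivity)
    intro ξ
    have hmf : (m : V d → ℂ) = (fun z => Gc ((t, 0) + z)) ∘ (ContinuousLinearMap.inr ℝ ℝ (V d)) := by
      ext ζ
      simp [hm, hGc]
    by_cases hξ : ‖ξ‖ ≤ R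
    · have h1 : ‖iteratedFDeriv ℝ n m ξ‖ ≤ |D| * J ^ n := by
        rw [hmf, ContinuousLinearMap.iteratedFDeriv_comp_right (n := (⊤ : ℕ∞)) _ (by fun_prop) _
          (by exact_mod_cast le_top)]
        refine (ContinuousMultilinearMap.norm_compContinuousLinearMap_le _ _).trans ?_
        rw [iteratedFDeriv_comp_add_left, Finset.prod_const, Finset.card_univ, Fintype.card_fin]
        apply mul_le_mul_of_nonneg_right _ (by positivity)
        refine le_trans (hD _ ?_) (le_abs_self D)
        simp [ht0, ht1, hξ]
      exact mul_le_mul (pow_le_pow_left₀ (norm_nonneg _) (hξ.trans (le_abs_self R)) _) h1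
        (norm_nonneg _) (by positivity)
    · have h0 : iteratedFDeriv ℝ n m ξ = 0 := by
        have hs : ξ ∉ tsupport (m : V d → ℂ) := by
          intro hmem
          have hsub : tsupport (m : V d → ℂ) ⊆ Metric.closedBall 0 R := by
            apply closure_minimal _ Metric.isClosed_closedBall
            intro ζ hz
            rw [Function.mem_support, hm] at hz
            simpa using hR t ζ (by exact_mod_cast hz)
          exact hξ (by simpa using hsub hmem)
        exact image_eq_zero_of_notMem_tsupport fun h => hs (tsupport_iteratedFDeriv_subset (𝕜 := ℝ) n h)
      rw [h0, norm_zero, mul_zero]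
      positivity
  choose M hM0 hM using key
  have hs : 0 ≤ ∑ i ∈ T, M i := Finset.sum_nonneg fun i _ => hM0 i
  refine ⟨C * ∑ i ∈ T, M i, by positivity, ?_⟩
  intro t h0 h1 m hm
  exact hT m _ hs fun i hi => (hM i t h0 h1 m hm).trans
    (Finset.single_le_sum (f := M) (fun j _ => hM0 j) hi)

end KP

namespace KP

variable {d : ℕ}

/-- entire functions with `Sc 0 (r^2) = cosh r` and `r * Sc 1 (r^2) = sinh r`. -/
def Sc (i : ℕ) : ℝ → ℝ := FormalMultilinearSeries.ofScalarsSum (fun n => (((2 * n + i).factorial : ℕ) : ℝ)⁻¹)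

lemma Sc_contDiff (i : ℕ) : ContDiff ℝ (⊤ : ℕ∞) (Sc i) := by
  have hr : (FormalMultilinearSeries.ofScalars ℝ (fun n => (((2 * n + i).factorial : ℕ) : ℝ)⁻¹)).radius = ⊤ := by
    apply FormalMultilinearSeries.ofScalars_radius_eq_top_of_tendsto
    · filter_upwards with n
      positivity
    · apply squeeze_zero (g := fun n : ℕ => 1 / ((n : ℝ) + 1))
      · intro n; positivity
      · intro n
        have e : (2 * n.succ + i).factorial = (2 * n + i + 2) * ((2 * n + i + 1) * (2 * n + i).factorial) := by
          rw [show 2 * n.succ + i = (2 * n + i + 1) + 1 by omega, Nat.factorial_succ, Nat.factorial_succ]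
        have hf : (0:ℝ) < ((2 * n + i).factorial : ℕ) := by positivity
        rw [e]
        push_cast
        rw [norm_inv, norm_inv, Real.norm_of_nonneg (by positivity), Real.norm_of_nonneg (by positivity),
          div_inv_eq_mul, inv_mul_le_iff₀ (by positivity)]
        rw [mul_one_div, le_div_iff₀ (by positivity)]
        have hn : (0:ℝ) ≤ n := by positivity
        have hi : (0:ℝ) ≤ i := by positivity
        have h2 : (n:ℝ) + 1 ≤ (2 * n + i + 2) * (2 * n + i + 1) := by nlinarith [mul_nonneg hn hi]
        nlinarith [mul_le_mul_of_nonneg_left h2 hf.le]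
      · exact tendsto_one_div_add_atTop_nhds_zero_nat
  have h := (FormalMultilinearSeries.ofScalars ℝ (fun n => (((2 * n + i).factorial : ℕ) : ℝ)⁻¹)).hasFPowerSeriesOnBall
    (by rw [hr]; exact ENNReal.zero_lt_top)
  have h2 := h.analyticOnNhd
  rw [hr] at h2
  have h3 : AnalyticOnNhd ℝ (Sc i) Set.univ := by
    intro x _
    exact h2 x (by simp)
  exact h3.contDiff

lemma Sc_eq (i : ℕ) (y : ℝ) : Sc i y = ∑' n : ℕ, y ^ n / ((2 * n + i).factorial : ℕ) := by
  rw [Sc, FormalMultilinearSeries.ofScalarsSum_eq_tsum]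
  simp only [smul_eq_mul]
  congr 1; ext n; rw [inv_mul_eq_div]

lemma hasSum_Sc0 (r : ℝ) : HasSum (fun n : ℕ => (r ^ 2) ^ n / ((2 * n + 0).factorial : ℕ)) (Real.cosh r) := by
  simpa [pow_mul] using Real.hasSum_cosh r

lemma hasSum_Sc1 {r : ℝ} (hr : r ≠ 0) :
    HasSum (fun n : ℕ => (r ^ 2) ^ n / ((2 * n + 1).factorial : ℕ)) (Real.sinh r / r) := by
  have h := (Real.hasSum_sinh r).div_const r
  have e : (fun n : ℕ => (r ^ 2) ^ n / (((2 * n + 1).factorial : ℕ) : ℝ)) =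
      fun n : ℕ => r ^ (2 * n + 1) / (((2 * n + 1).factorial : ℕ) : ℝ) / r := by
    ext n
    rw [pow_succ r (2 * n), pow_mul]
    field_simp
  rw [e]; exact h

lemma Sc0_sq (r : ℝ) : Sc 0 (r ^ 2) = Real.cosh r := by
  rw [Sc_eq]; exact (hasSum_Sc0 r).tsum_eq

lemma Sc1_sq {r : ℝ} (hr : r ≠ 0) : Sc 1 (r ^ 2) = Real.sinh r / r := by
  rw [Sc_eq]; exact (hasSum_Sc1 hr).tsum_eq

lemma Sc_zero (i : ℕ) : Sc i 0 = ((i.factorial : ℕ) : ℝ)⁻¹ := by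
  rw [Sc, FormalMultilinearSeries.ofScalarsSum_zero]; simp

lemma Sc0_pos {y : ℝ} (hy : 0 ≤ y) : 0 < Sc 0 y := by
  rw [← Real.sq_sqrt hy, Sc0_sq]; exact Real.cosh_pos _

lemma Sc1_pos {y : ℝ} (hy : 0 ≤ y) : 0 < Sc 1 y := by
  rcases hy.eq_or_lt with h | h
  · rw [← h, Sc_zero]; norm_num
  · have := Real.sqrt_pos.2 h
    rw [← Real.sq_sqrt hy, Sc1_sq this.ne']
    exact div_pos (Real.sinh_pos_iff.2 this) this

lemma Sc_le {y : ℝ} (hy : 0 ≤ y) : Sc 1 y ≤ Sc 0 y := by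
  rcases hy.eq_or_lt with h | h
  · rw [← h, Sc_zero, Sc_zero]; norm_num
  · have := Real.sqrt_pos.2 h
    rw [← Real.sq_sqrt hy, Sc1_sq this.ne', Sc0_sq]
    refine hasSum_le ?_ (hasSum_Sc1 this.ne') (hasSum_Sc0 _)
    intro n
    apply div_le_div_of_nonneg_left (by positivity) (by positivity)
    exact_mod_cast Nat.factorial_le (by omega)

/-- `tt (μ r^2) = √(tanh(√μ r)/(√μ r))` -/
def tt (y : ℝ) : ℝ := Real.sqrt (Sc 1 y / Sc 0 y)

lemma tt_nonneg (y : ℝ) : 0 ≤ tt y := Real.sqrt_nonneg _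

lemma tt_le {y : ℝ} (hy : 0 ≤ y) : tt y ≤ 1 := by
  rw [tt, Real.sqrt_le_iff, one_pow, div_le_one (Sc0_pos hy)]
  exact ⟨zero_le_one, Sc_le hy⟩

lemma tt_contDiffAt {y : ℝ} (hy : 0 ≤ y) : ContDiffAt ℝ (⊤ : ℕ∞) tt y := by
  have h0 := Sc0_pos hy
  have h1 := Sc1_pos hy
  apply ContDiffAt.sqrt
  · exact (Sc_contDiff 1).contDiffAt.div (Sc_contDiff 0).contDiffAt h0.ne'
  · positivity

lemma tt_sq {x : ℝ} (hx : 0 < x) : tt (x ^ 2) = Real.sqrt (Real.tanh x / x) := by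
  rw [tt, Sc0_sq, Sc1_sq hx.ne', Real.tanh_eq_sinh_div_cosh]
  congr 1
  field_simp

lemma tt_Tsymb {μ r : ℝ} (hμ : 0 < μ) (hr : 0 ≤ r) : tt (μ * r ^ 2) = Real.sqrt (Tsymb μ r) := by
  rcases hr.eq_or_lt with h | h
  · rw [← h, Tsymb, if_pos rfl, tt]; simp [Sc_zero]
  · have h1 := Real.sqrt_pos.2 hμ
    rw [Tsymb, if_neg h.ne', ← tt_sq (by positivity), mul_pow, Real.sq_sqrt hμ.le]

/-- large-frequency form of `tt` -/
lemma tt_large {k r : ℝ} (hk : 0 < k) (hr : 0 < r) : tt (k ^ 2 * r ^ 2) =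
    k ^ (-(1 / 2) : ℝ) * (r ^ (-(1 / 2) : ℝ) * Real.sqrt ((1 - expNegInvGlue (k⁻¹ / (2 * r))) / (1 + expNegInvGlue (k⁻¹ / (2 * r))))) := by
  have hz : 0 < k⁻¹ / (2 * r) := by positivity
  have hq : expNegInvGlue (k⁻¹ / (2 * r)) = Real.exp (-(2 * (k * r))) := by
    rw [expNegInvGlue, if_neg hz.not_ge]
    congr 1
    field_simp
  have hkr : 0 < k * r := by positivity
  have hth : Real.tanh (k * r) = (1 - Real.exp (-(2 * (k * r)))) / (1 + Real.exp (-(2 * (k * r)))) := by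
    rw [Real.tanh_eq_sinh_div_cosh, Real.sinh_eq, Real.cosh_eq]
    have e : Real.exp (-(2 * (k * r))) = Real.exp (-(k * r)) * Real.exp (-(k * r)) := by
      rw [← Real.exp_add]; congr 1; ring
    have e2 : Real.exp (k * r) * Real.exp (-(k * r)) = 1 := by rw [← Real.exp_add]; simp
    rw [e]
    have := Real.exp_pos (k * r)
    have := Real.exp_pos (-(k * r))
    rw [div_eq_div_iff (by positivity) (by positivity)]
    generalize Real.exp (k * r) = a at *
    generalize Real.exp (-(k * r)) = b at *
    linear_combination (b) * e2
  have hpow : ∀ x : ℝ, 0 < x → x ^ (-(1 / 2) : ℝ) = (Real.sqrt x)⁻¹ := by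
    intro x hx
    rw [Real.rpow_neg hx.le, Real.sqrt_eq_rpow]
  rw [hq, ← mul_pow, tt_sq hkr, ← hth, Real.sqrt_div' _ hkr.le, hpow k hk, hpow r hr, Real.sqrt_mul hk.le]
  rw [div_eq_inv_mul, mul_inv]
  ring

end KP

namespace KP

variable {d : ℕ}

lemma contDiff_cut {X : V d → ℝ} (hX : ContDiff ℝ (⊤ : ℕ∞) X) {ρ : ℝ} (hρ : 0 < ρ)
    (h0 : ∀ ξ, X ξ ≠ 0 → ρ ≤ ‖ξ‖) {F : ℝ × V d → ℝ}
    (hF : ∀ t ξ, ξ ≠ 0 → ContDiffAt ℝ (⊤ : ℕ∞) F (t, ξ)) :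
    ContDiff ℝ (⊤ : ℕ∞) (fun z : ℝ × V d => X z.2 * F z) := by
  rw [contDiff_iff_contDiffAt]
  rintro ⟨t, ξ⟩
  by_cases h : ξ = 0
  · have : (fun z : ℝ × V d => X z.2 * F z) =ᶠ[nhds (t, ξ)] fun _ => 0 := by
      have ho : IsOpen {z : ℝ × V d | ‖z.2‖ < ρ} := isOpen_lt (by fun_prop) (by fun_prop)
      filter_upwards [ho.mem_nhds (show (t, ξ) ∈ {z : ℝ × V d | ‖z.2‖ < ρ} by simp [h, hρ])] with z hz
      have : X z.2 = 0 := by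
        by_contra hc
        exact absurd (h0 _ hc) (not_le.2 hz)
      rw [this, zero_mul]
    exact contDiffAt_const.congr_of_eventuallyEq this
  · exact (hX.comp contDiff_snd).contDiffAt.mul (hF t ξ h)

lemma W0_add (m m' : Sch d) : W0 (m + m') ≤ W0 m + W0 m' := by
  have h : ker (m + m') = ker m + ker m' := by
    rw [ker, ker, ker, FourierTransform.fourierInv_add]
  rw [W0, W0, W0, ← integral_add (int_W0 m) (int_W0 m'), h]
  apply integral_mono _ ((int_W0 m).add (int_W0 m'))
  · intro x; exact norm_add_le _ _
  · rw [← h]; exact int_W0 _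

/-- scaled version of `family` -/
lemma family_scaled {G : ℝ × V d → ℝ} (hG : ContDiff ℝ (⊤ : ℕ∞) G) {R : ℝ} (hR : ∀ t ξ, G (t, ξ) ≠ 0 → ‖ξ‖ ≤ R) :
    ∃ C, 0 ≤ C ∧ ∀ t, 0 ≤ t → t ≤ 1 → ∀ l, 0 < l → ∀ c : ℝ, 0 ≤ c → ∀ m : Sch d,
      (∀ ξ, m ξ = ((c * G (t, l⁻¹ • ξ) : ℝ) : ℂ)) → W0 m ≤ C * c ∧ W1 m ≤ C * (c * l⁻¹) := by
  obtain ⟨C, hC, h⟩ := family hG hR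
  refine ⟨C, hC, ?_⟩
  intro t h0 h1 l hl c hc m hm
  have hcd : ContDiff ℝ (⊤ : ℕ∞) (fun ξ => G (t, ξ)) := hG.comp (contDiff_const.prodMk contDiff_id)
  set m0 : Sch d := mkS (fun ξ => G (t, ξ)) hcd (hcs_of R (hR t)) with hm0
  have hW := h t h0 h1 m0 (fun ξ => by rw [hm0, mkS_apply])
  have hs : ∀ ξ, m ξ = ((c : ℂ) • m0) (l⁻¹ • ξ) := by
    intro ξ
    rw [hm, _root_.smul_apply, hm0, mkS_apply]
    push_cast; rfl
  rw [W0_scale hl hs, W1_scale hl hs, W0_smul, W1_smul, Complex.norm_real, Real.norm_of_nonneg hc]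
  constructor
  · rw [mul_comm C]; exact mul_le_mul_of_nonneg_left hW.1 hc
  · calc _ ≤ l⁻¹ * (c * C) := by
          apply mul_le_mul_of_nonneg_left _ (by positivity)
          exact mul_le_mul_of_nonneg_left hW.2 hc
      _ = _ := by ring

/-- annular cut-off equal to one on `[1/64, 8]` -/
def X2 (ξ : V d) : ℝ := cR 8 ξ * sR (1 / 128) ξ

lemma X2_contDiff : ContDiff ℝ (⊤ : ℕ∞) (X2 : V d → ℝ) := (cR_contDiff _).mul (sR_contDiff _)

lemma X2_ne {ξ : V d} (h : X2 ξ ≠ 0) : 1 / 128 ≤ ‖ξ‖ ∧ ‖ξ‖ ≤ 16 := by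
  constructor
  · exact sR_ne (by norm_num) (right_ne_zero_of_mul h)
  · have := cR_ne (by norm_num) (left_ne_zero_of_mul h)
    linarith

lemma X2_one {ξ : V d} (h1 : 1 / 64 ≤ ‖ξ‖) (h2 : ‖ξ‖ ≤ 8) : X2 ξ = 1 := by
  have e : sR (1 / 128) ξ = 1 := by
    rw [sR, ang_big (by norm_num) (by linarith), Real.sin_pi_div_two]
  rw [X2, e, cR_one (by norm_num) h2, one_mul]

/-- symbol of `J^s` -/
def aa (s : ℝ) (ξ : V d) : ℝ := (1 + ‖ξ‖ ^ 2) ^ (s / 2)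

/-- symbol of `√T_μ` -/
def bb (μ : ℝ) (ξ : V d) : ℝ := tt (μ * ‖ξ‖ ^ 2)

lemma aa_contDiff (s : ℝ) : ContDiff ℝ (⊤ : ℕ∞) (aa s : V d → ℝ) := by
  apply ContDiff.rpow_const_of_ne
  · exact contDiff_const.add (contDiff_norm_sq ℝ)
  · intro ξ; positivity

lemma bb_contDiff {μ : ℝ} (hμ : 0 ≤ μ) : ContDiff ℝ (⊤ : ℕ∞) (bb μ : V d → ℝ) := by
  rw [contDiff_iff_contDiffAt]
  intro ξ
  exact (tt_contDiffAt (by positivity)).comp ξ (contDiff_const.mul (contDiff_norm_sq ℝ)).contDiffAt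

lemma bb_nonneg (μ : ℝ) (ξ : V d) : 0 ≤ bb μ ξ := tt_nonneg _
lemma bb_le {μ : ℝ} (hμ : 0 ≤ μ) (ξ : V d) : bb μ ξ ≤ 1 := tt_le (by positivity)

lemma ttk_contDiff : ContDiff ℝ (⊤ : ℕ∞) (fun z : ℝ × V d => tt (z.1 ^ 2 * ‖z.2‖ ^ 2)) := by
  rw [contDiff_iff_contDiffAt]
  intro z
  exact ContDiffAt.comp (g := tt) (f := fun z : ℝ × V d => z.1 ^ 2 * ‖z.2‖ ^ 2) z
    (tt_contDiffAt (y := z.1 ^ 2 * ‖z.2‖ ^ 2) (by positivity))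
    ((contDiff_fst.pow 2).mul (contDiff_snd.norm_sq ℝ)).contDiffAt

lemma Xl_hcs {F : V d → ℝ} {l : ℝ} (hl : 0 < l) : HasCompactSupport (fun ξ : V d => X2 (l⁻¹ • ξ) * F ξ) := by
  apply hcs_of (l * 16)
  intro ξ h
  have := (X2_ne (left_ne_zero_of_mul h)).2
  rw [norm_smul, norm_inv, Real.norm_of_nonneg hl.le, inv_mul_le_iff₀ hl] at this
  exact this

lemma Xl_cd {F : V d → ℝ} (hF : ContDiff ℝ (⊤ : ℕ∞) F) (l : ℝ) :
    ContDiff ℝ (⊤ : ℕ∞) (fun ξ : V d => X2 (l⁻¹ • ξ) * F ξ) :=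
  (X2_contDiff.comp (contDiff_const_smul l⁻¹)).mul hF

/-- localized `a` -/
def sA (s : ℝ) (k : ℕ) : Sch d := mkS _ (Xl_cd (aa_contDiff s) (lam k)) (Xl_hcs (lam_pos k))

lemma sA_apply (s : ℝ) (k : ℕ) (ξ : V d) : sA s k ξ = ((X2 ((lam k)⁻¹ • ξ) * aa s ξ : ℝ) : ℂ) := rfl

lemma W_sA (s : ℝ) : ∃ C, 0 ≤ C ∧ ∀ k, W0 (sA s k : Sch d) ≤ C * lam k ^ s ∧ W1 (sA s k : Sch d) ≤ C * lam k ^ (s - 1) := by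
  have hG : ContDiff ℝ (⊤ : ℕ∞) (fun z : ℝ × V d => X2 z.2 * (z.1 ^ 2 + ‖z.2‖ ^ 2) ^ (s / 2)) := by
    apply contDiff_cut X2_contDiff (ρ := 1 / 128) (by norm_num) (fun ξ h => (X2_ne h).1)
    intro t ξ h
    apply ContDiffAt.rpow_const_of_ne
    · exact ((contDiff_fst.pow 2).add (contDiff_snd.norm_sq ℝ)).contDiffAt
    · have : 0 < ‖ξ‖ := norm_pos_iff.2 h
      positivity
  obtain ⟨C, hC, h⟩ := family_scaled hG (R := 16) (fun t ξ h => (X2_ne (left_ne_zero_of_mul h)).2)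
  refine ⟨C, hC, fun k => ?_⟩
  have hl := lam_pos k
  have hl1 : 1 ≤ lam k := one_le_pow₀ (by norm_num)
  have := h (lam k)⁻¹ (by positivity) (inv_le_one_of_one_le₀ hl1) (lam k) hl (lam k ^ s) (by positivity) (sA s k) ?_
  · rw [Real.rpow_sub hl, Real.rpow_one, div_eq_mul_inv]; exact this
  · intro ξ
    rw [sA_apply]
    congr 1
    have e : (lam k)⁻¹ ^ 2 + ‖(lam k)⁻¹ • ξ‖ ^ 2 = (lam k ^ 2)⁻¹ * (1 + ‖ξ‖ ^ 2) := by
      rw [norm_smul, norm_inv, Real.norm_of_nonneg hl.le]; field_simp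
    have e2 : lam k ^ s = ((lam k) ^ 2) ^ (s / 2) := by
      rw [← Real.rpow_natCast, ← Real.rpow_mul hl.le]; congr 1; push_cast; ring
    simp only [e, aa]
    rw [Real.mul_rpow (by positivity) (by positivity), Real.inv_rpow (by positivity), ← e2]
    have : lam k ^ s ≠ 0 := (by positivity : 0 < lam k ^ s).ne'
    field_simp

/-- localized `b` -/
def sB (μ : ℝ) (hμ : 0 ≤ μ) (k : ℕ) : Sch d := mkS _ (Xl_cd (bb_contDiff hμ) (lam k)) (Xl_hcs (lam_pos k))

lemma sB_apply (μ : ℝ) (hμ : 0 ≤ μ) (k : ℕ) (ξ : V d) :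
    sB μ hμ k ξ = ((X2 ((lam k)⁻¹ • ξ) * bb μ ξ : ℝ) : ℂ) := rfl

lemma bb_scale {μ l : ℝ} (hμ : 0 ≤ μ) (hl : 0 < l) (ξ : V d) :
    bb μ ξ = tt ((Real.sqrt μ * l) ^ 2 * ‖l⁻¹ • ξ‖ ^ 2) := by
  rw [bb, norm_smul, norm_inv, Real.norm_of_nonneg hl.le, mul_pow, Real.sq_sqrt hμ]
  congr 1; field_simp

lemma large_contDiff : ContDiff ℝ (⊤ : ℕ∞) (fun z : ℝ × V d => X2 z.2 * (‖z.2‖ ^ (-(1 / 2) : ℝ) *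
    Real.sqrt ((1 - expNegInvGlue (z.1 / (2 * ‖z.2‖))) / (1 + expNegInvGlue (z.1 / (2 * ‖z.2‖)))))) := by
  apply contDiff_cut X2_contDiff (ρ := 1 / 128) (by norm_num) (fun ξ h => (X2_ne h).1)
  intro t ξ h
  have hn : 0 < ‖ξ‖ := norm_pos_iff.2 h
  have hnorm : ContDiffAt ℝ (⊤ : ℕ∞) (fun z : ℝ × V d => ‖z.2‖) (t, ξ) :=
    contDiffAt_snd.norm ℝ h
  have hq : ContDiffAt ℝ (⊤ : ℕ∞) (fun z : ℝ × V d => expNegInvGlue (z.1 / (2 * ‖z.2‖))) (t, ξ) :=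
    expNegInvGlue.contDiff.contDiffAt.comp (t, ξ) (contDiffAt_fst.div (contDiffAt_const.mul hnorm) (by positivity))
  have q0 : 0 ≤ expNegInvGlue (t / (2 * ‖ξ‖)) := expNegInvGlue.nonneg _
  have q1 : expNegInvGlue (t / (2 * ‖ξ‖)) < 1 := by
    rw [expNegInvGlue]
    split_ifs with hc
    · exact one_pos
    · rw [Real.exp_lt_one_iff]
      push Not at hc
      exact neg_lt_zero.2 (inv_pos.2 hc)
  apply ContDiffAt.mul
  · exact hnorm.rpow_const_of_ne hn.ne'
  · apply ContDiffAt.sqrt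
    · exact (contDiffAt_const.sub hq).div (contDiffAt_const.add hq) (by positivity)
    · have : 0 < 1 - expNegInvGlue (t / (2 * ‖ξ‖)) := by linarith
      positivity

lemma W_sB : ∃ C, 0 ≤ C ∧ ∀ μ (hμ : 0 < μ) k, W0 (sB μ hμ.le k : Sch d) ≤ C ∧
    W1 (sB μ hμ.le k : Sch d) ≤ C * (lam k)⁻¹ ∧
    (1 ≤ Real.sqrt μ * lam k → W0 (sB μ hμ.le k : Sch d) ≤ C * (Real.sqrt μ * lam k) ^ (-(1 / 2) : ℝ)) := by
  obtain ⟨C1, hC1, h1⟩ := family_scaled (G := fun z : ℝ × V d => X2 z.2 * tt (z.1 ^ 2 * ‖z.2‖ ^ 2))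
    ((X2_contDiff.comp contDiff_snd).mul ttk_contDiff) (R := 16) (fun t ξ h => (X2_ne (left_ne_zero_of_mul h)).2)
  obtain ⟨C2, hC2, h2⟩ := family_scaled large_contDiff (d := d) (R := 16) (fun t ξ h => (X2_ne (left_ne_zero_of_mul h)).2)
  refine ⟨C1 + C2, by positivity, fun μ hμ k => ?_⟩
  have hl := lam_pos k
  have hk : 0 < Real.sqrt μ * lam k := mul_pos (Real.sqrt_pos.2 hμ) hl
  set κ := Real.sqrt μ * lam k with hκ
  rcases le_total κ 1 with hle | hge
  · have := h1 κ hk.le hle (lam k) hl 1 zero_le_one (sB μ hμ.le k) (fun ξ => by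
      rw [sB_apply, bb_scale hμ.le hl, one_mul])
    have w0 : W0 (sB μ hμ.le k : Sch d) ≤ C1 + C2 := by linarith [this.1]
    refine ⟨w0, ?_, fun h => ?_⟩
    · rw [one_mul] at this
      refine this.2.trans (mul_le_mul_of_nonneg_right (by linarith) (by positivity))
    · have : κ = 1 := le_antisymm hle h
      rw [this, Real.one_rpow, mul_one]; exact w0
  · have := h2 κ⁻¹ (by positivity) (inv_le_one_of_one_le₀ hge) (lam k) hl (κ ^ (-(1 / 2) : ℝ)) (by positivity)
      (sB μ hμ.le k) (fun ξ => by
        rw [sB_apply]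
        congr 1
        by_cases hx : X2 ((lam k)⁻¹ • ξ) = 0
        · simp only [hx, zero_mul, mul_zero]
        · have hp : 0 < ‖(lam k)⁻¹ • ξ‖ := by linarith [(X2_ne hx).1]
          rw [bb_scale hμ.le hl, ← hκ, tt_large hk hp]; ring)
    have hx1 : κ ^ (-(1 / 2) : ℝ) ≤ 1 := Real.rpow_le_one_of_one_le_of_nonpos hge (by norm_num)
    have hx0 : 0 ≤ κ ^ (-(1 / 2) : ℝ) := by positivity
    have w : W0 (sB μ hμ.le k : Sch d) ≤ (C1 + C2) * κ ^ (-(1 / 2) : ℝ) :=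
      this.1.trans (mul_le_mul_of_nonneg_right (by linarith) hx0)
    refine ⟨w.trans (mul_le_of_le_one_right (by positivity) hx1), ?_, fun _ => w⟩
    refine this.2.trans ?_
    apply mul_le_mul (by linarith) _ (by positivity) (by positivity)
    exact mul_le_of_le_one_left (by positivity) hx1

end KP

namespace KP

variable {d : ℕ}

lemma Xl_one {k : ℕ} {ξ : V d} (h1 : lam k / 64 ≤ ‖ξ‖) (h2 : ‖ξ‖ ≤ 8 * lam k) : X2 ((lam k)⁻¹ • ξ) = 1 := by
  have hl := lam_pos k
  have e : ‖(lam k)⁻¹ • ξ‖ = ‖ξ‖ / lam k := by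
    rw [norm_smul, norm_inv, Real.norm_of_nonneg hl.le]; field_simp
  apply X2_one
  · rw [e, le_div_iff₀ hl]; linarith
  · rw [e, div_le_iff₀ hl]; exact h2

/-- The full symbol. -/
def sg (s μ : ℝ) (ξ : V d) : ℂ := ((aa s ξ * bb μ ξ : ℝ) : ℂ)

lemma aa_pos (s : ℝ) (ξ : V d) : 0 < aa s ξ := by unfold aa; positivity

lemma sg_bd {s μ : ℝ} (hμ : 0 ≤ μ) (ξ : V d) : ‖sg s μ ξ‖ ≤ (1 + ‖ξ‖ ^ 2) ^ (s / 2) := by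
  have h1 := bb_nonneg μ ξ
  have h2 := bb_le hμ ξ
  have h3 := aa_pos s ξ
  rw [sg, Complex.norm_real, Real.norm_of_nonneg (by positivity)]
  exact mul_le_of_le_one_right h3.le h2

lemma W_loc (s E : ℝ) (hE : 0 ≤ E) : ∃ C, 0 ≤ C ∧ ∀ μ (_ : 0 < μ) k (e m : Sch d), W0 e ≤ E → W1 e ≤ E * (lam k)⁻¹ →
    (∀ ξ, e ξ ≠ 0 → lam k / 64 ≤ ‖ξ‖ ∧ ‖ξ‖ ≤ 8 * lam k) →
    (∀ ξ, m ξ = e ξ * sg s μ ξ) → W0 m ≤ C * lam k ^ s ∧ W1 m ≤ C * lam k ^ (s - 1) := by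
  obtain ⟨A, hA, hA'⟩ := W_sA (d := d) s
  obtain ⟨B, hB, hB'⟩ := W_sB (d := d)
  refine ⟨3 * (E * (A * B)), by positivity, ?_⟩
  intro μ hμ k e m e0 e1 hsupp hm
  have hl := lam_pos k
  obtain ⟨a0, a1⟩ := hA' k
  obtain ⟨b0, b1, -⟩ := hB' μ hμ k
  rw [Real.rpow_sub hl, Real.rpow_one, div_eq_mul_inv] at a1 ⊢
  have hp : 0 < lam k ^ s := by positivity
  set L := lam k ^ s
  set l := (lam k)⁻¹
  have hl' : 0 < l := by positivity
  have hmm : m = mulS e (mulS (sA s k) (sB μ hμ.le k)) := by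
    ext ξ
    rw [hm, mulS_apply, mulS_apply, sA_apply, sB_apply, sg]
    by_cases h : e ξ = 0
    · rw [h, zero_mul, zero_mul]
    · obtain ⟨h1, h2⟩ := hsupp ξ h
      rw [Xl_one h1 h2]; push_cast; ring
  have q0 : W0 (mulS (sA s k) (sB μ hμ.le k) : Sch d) ≤ (A * L) * B :=
    (W0_mulS _ _).trans (mul_le_mul a0 b0 (W0_nonneg _) (by positivity))
  have q1 : W1 (mulS (sA s k) (sB μ hμ.le k) : Sch d) ≤ (A * (L * l)) * B + (A * L) * (B * l) :=
    (W1_mulS _ _).trans (add_le_add (mul_le_mul a1 b0 (W0_nonneg _) (by positivity))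
      (mul_le_mul a0 b1 (W1_nonneg _) (by positivity)))
  rw [hmm]
  constructor
  · calc _ ≤ _ := W0_mulS _ _
      _ ≤ E * ((A * L) * B) := mul_le_mul e0 q0 (W0_nonneg _) hE
      _ ≤ _ := by
        have : 0 ≤ E * ((A * L) * B) := by positivity
        nlinarith
  · calc _ ≤ _ := W1_mulS _ _
      _ ≤ (E * l) * ((A * L) * B) + E * ((A * (L * l)) * B + (A * L) * (B * l)) :=
        add_le_add (mul_le_mul e1 q0 (W0_nonneg _) (by positivity)) (mul_le_mul e0 q1 (W1_nonneg _) hE)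
      _ = _ := by ring

lemma phi_mul_cd {F : V d → ℝ} (hF : ContDiff ℝ (⊤ : ℕ∞) F) (j : ℕ) :
    ContDiff ℝ (⊤ : ℕ∞) (fun ξ => phiR j ξ * F ξ) := (phiR_contDiff j).mul hF

lemma phi_mul_hcs (F : V d → ℝ) (j : ℕ) : HasCompactSupport (fun ξ => phiR j ξ * F ξ) := (phiR_hcs j).mul_right

/-- low-frequency part of `a`. -/
def pA (s : ℝ) (j : ℕ) : Sch d := mkS _ (phi_mul_cd (aa_contDiff s) j) (phi_mul_hcs _ j)

lemma pA_apply (s : ℝ) (j : ℕ) (ξ : V d) : pA s j ξ = ((phiR j ξ * aa s ξ : ℝ) : ℂ) := rfl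

/-- low-frequency part of `b`. -/
def pB (μ : ℝ) (hμ : 0 ≤ μ) (j : ℕ) : Sch d := mkS _ (phi_mul_cd (bb_contDiff hμ) j) (phi_mul_hcs _ j)

lemma pB_apply (μ : ℝ) (hμ : 0 ≤ μ) (j : ℕ) (ξ : V d) : pB μ hμ j ξ = ((phiR j ξ * bb μ ξ : ℝ) : ℂ) := rfl

lemma eta_X {k : ℕ} {ξ : V d} (h : etaR (k + 1) ξ ≠ 0) : lam (k + 1) / 64 ≤ ‖ξ‖ ∧ ‖ξ‖ ≤ 8 * lam (k + 1) := by
  have h1 := etaR_ne h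
  have h2 := etaR_ne' h
  have hl := lam_pos k
  have e : lam (k + 1) = 16 * lam k := by rw [lam, pow_succ]; ring
  constructor <;> linarith

lemma W0_psi (k : ℕ) : W0 (psi (k + 1) : Sch d) ≤ W0 (eta 1 : Sch d) ^ 2 := by
  refine (W0_mulS _ _).trans ?_
  rw [(W_eta k).1, sq]

lemma pA_succ (s : ℝ) (j : ℕ) : (pA s (j + 1) : Sch d) = pA s j + mulS (psi (j + 1)) (sA s (j + 1)) := by
  ext ξ
  rw [_root_.add_apply, mulS_apply, pA_apply, pA_apply, psi_apply, sA_apply, phiR_succ]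
  by_cases h : etaR (j + 1) ξ = 0
  · rw [h]; simp
  · rw [Xl_one (eta_X h).1 (eta_X h).2]; push_cast; ring

lemma pB_succ (μ : ℝ) (hμ : 0 ≤ μ) (j : ℕ) :
    (pB μ hμ (j + 1) : Sch d) = pB μ hμ j + mulS (psi (j + 1)) (sB μ hμ (j + 1)) := by
  ext ξ
  rw [_root_.add_apply, mulS_apply, pB_apply, pB_apply, psi_apply, sB_apply, phiR_succ]
  by_cases h : etaR (j + 1) ξ = 0
  · rw [h]; simp
  · rw [Xl_one (eta_X h).1 (eta_X h).2]; push_cast; ring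

lemma W_pA {s : ℝ} (hs : 0 ≤ s) : ∃ D, 0 ≤ D ∧ ∀ j, W0 (pA s j : Sch d) ≤ D * lam j ^ s := by
  rcases hs.eq_or_lt with h | h
  · subst h
    refine ⟨W0 (phi 0 : Sch d), W0_nonneg _, fun j => ?_⟩
    have : (pA 0 j : Sch d) = phi j := by
      ext ξ; rw [pA_apply, phi_apply]; simp [aa]
    rw [this, (W_phi j).1]; simp
  · obtain ⟨A, hA, hA'⟩ := W_sA (d := d) s
    set q : ℝ := 16 ^ s with hq
    have hq1 : 1 < q := Real.one_lt_rpow (by norm_num) h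
    set E := W0 (eta 1 : Sch d) ^ 2 with hE
    have hE0 : 0 ≤ E := by positivity
    have w0 := W0_nonneg (pA s 0 : Sch d)
    have hd0 : 0 ≤ E * A * q / (q - 1) := div_nonneg (by positivity) (by linarith)
    refine ⟨W0 (pA s 0 : Sch d) + E * A * q / (q - 1), by positivity, fun j => ?_⟩
    induction j with
    | zero => simp [hd0]
    | succ j ih =>
      have e : lam (j + 1) ^ s = lam j ^ s * q := by
        rw [lam, lam, pow_succ, Real.mul_rpow (by positivity) (by norm_num)]
      have hp : 0 < lam j ^ s := by have := lam_pos j; positivity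
      rw [pA_succ]
      have h1 : W0 (mulS (psi (j + 1)) (sA s (j + 1)) : Sch d) ≤ E * (A * lam (j + 1) ^ s) :=
        (W0_mulS _ _).trans (mul_le_mul (W0_psi j) (hA' _).1 (W0_nonneg _) hE0)
      refine (W0_add _ _).trans ((add_le_add ih h1).trans ?_)
      rw [e]
      set L := lam j ^ s
      have hx : E * A * q / (q - 1) * q = E * A * q / (q - 1) + E * A * q := by
        have : q - 1 ≠ 0 := by linarith
        field_simp; ring
      have h3 : W0 (pA s 0 : Sch d) * L ≤ W0 (pA s 0 : Sch d) * L * q :=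
        le_mul_of_one_le_right (by positivity) hq1.le
      calc _ = W0 (pA s 0 : Sch d) * L + (E * A * q / (q - 1) + E * A * q) * L := by ring
        _ ≤ W0 (pA s 0 : Sch d) * L * q + (E * A * q / (q - 1) * q) * L := by rw [hx]; linarith
        _ = _ := by ring

lemma phiR_scale (j : ℕ) (ξ : V d) : phiR j ξ = phiR 0 ((lam j)⁻¹ • ξ) := by
  have := cR_scale (ρ := 1) (lam_pos j) ξ
  rw [mul_one] at this
  rw [phiR, phiR, this]; simp

lemma W_pB : ∃ D, 0 ≤ D ∧ ∀ μ (hμ : 0 < μ), μ ≤ 1 → ∀ j, W0 (pB μ hμ.le j : Sch d) ≤ D := by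
  obtain ⟨C1, hC1, h1⟩ := family_scaled (G := fun z : ℝ × V d => phiR 0 z.2 * tt (z.1 ^ 2 * ‖z.2‖ ^ 2))
    (((phiR_contDiff 0).comp contDiff_snd).mul ttk_contDiff) (R := 2)
    (fun t ξ h => by simpa using phiR_ne (left_ne_zero_of_mul h))
  obtain ⟨B, hB, hB'⟩ := W_sB (d := d)
  set E := W0 (eta 1 : Sch d) ^ 2 with hE
  have hE0 : 0 ≤ E := by positivity
  set c := E * B with hc
  have hc0 : 0 ≤ c := by positivity
  refine ⟨C1 + c + c, by positivity, fun μ hμ hμ1 j => ?_⟩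
  have small : ∀ j, Real.sqrt μ * lam j ≤ 1 → W0 (pB μ hμ.le j : Sch d) ≤ C1 := by
    intro j hj
    have hl := lam_pos j
    have := h1 (Real.sqrt μ * lam j) (by positivity) hj (lam j) hl 1 zero_le_one (pB μ hμ.le j) (fun ξ => by
      rw [pB_apply, bb_scale hμ.le hl, phiR_scale, one_mul])
    linarith [this.1]
  have big : ∀ j, 1 ≤ Real.sqrt μ * lam j →
      W0 (pB μ hμ.le j : Sch d) ≤ C1 + c + c - c * (Real.sqrt μ * lam j) ^ (-(1 / 2) : ℝ) := by
    intro j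
    induction j with
    | zero =>
      intro h
      have h2 : Real.sqrt μ ≤ 1 := Real.sqrt_le_one.2 hμ1
      have h3 : Real.sqrt μ * lam 0 = 1 := le_antisymm (by simpa using h2) h
      have := small 0 h3.le
      rw [h3, Real.one_rpow]; linarith
    | succ j ih =>
      intro h
      have hs := Real.sqrt_pos.2 hμ
      have hl := lam_pos j
      have hx1 : (Real.sqrt μ * lam (j + 1)) ^ (-(1 / 2) : ℝ) ≤ 1 :=
        Real.rpow_le_one_of_one_le_of_nonpos h (by norm_num)
      have e : (Real.sqrt μ * lam j) ^ (-(1 / 2) : ℝ) = 4 * (Real.sqrt μ * lam (j + 1)) ^ (-(1 / 2) : ℝ) := by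
        rw [lam, lam, pow_succ, ← mul_assoc, Real.mul_rpow (x := Real.sqrt μ * 16 ^ j) (by positivity) (by norm_num)]
        have : (16 : ℝ) ^ (-(1 / 2) : ℝ) = 1 / 4 := by
          rw [show (16 : ℝ) = 4 ^ (2 : ℝ) by norm_num, ← Real.rpow_mul (by norm_num)]
          norm_num [Real.rpow_neg_one]
        rw [this]; ring
      have h1 : W0 (mulS (psi (j + 1)) (sB μ hμ.le (j + 1)) : Sch d) ≤
          E * (B * (Real.sqrt μ * lam (j + 1)) ^ (-(1 / 2) : ℝ)) :=
        (W0_mulS _ _).trans (mul_le_mul (W0_psi j) ((hB' μ hμ _).2.2 h) (W0_nonneg _) hE0)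
      have hx0 : 0 ≤ (Real.sqrt μ * lam (j + 1)) ^ (-(1 / 2) : ℝ) := by
        have := lam_pos (j + 1); positivity
      rw [pB_succ]
      rw [← mul_assoc, ← hc] at h1
      refine (W0_add _ _).trans ?_
      have hcx : 0 ≤ c * (Real.sqrt μ * lam (j + 1)) ^ (-(1 / 2) : ℝ) := by positivity
      rcases le_total 1 (Real.sqrt μ * lam j) with h2 | h2
      · have := ih h2
        rw [e] at this
        linarith
      · have := small j h2
        have h4 : c * (Real.sqrt μ * lam (j + 1)) ^ (-(1 / 2) : ℝ) ≤ c := mul_le_of_le_one_right hc0 hx1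
        linarith
  rcases le_total 1 (Real.sqrt μ * lam j) with h2 | h2
  · have := big j h2
    have hl := lam_pos j
    have : 0 ≤ c * (Real.sqrt μ * lam j) ^ (-(1 / 2) : ℝ) := by positivity
    linarith
  · have := small j h2
    linarith

/-- Schwartz version of `chiR`. -/
def chiS (k : ℕ) : Sch d := mkS (chiR k) (chiR_contDiff k) (chiR_hcs k)

lemma chiS_apply (k : ℕ) (ξ : V d) : chiS k ξ = (chiR k ξ : ℂ) := rfl

lemma W_chi (k : ℕ) : W0 (chiS k : Sch d) = W0 (chiS 0 : Sch d) ∧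
    W1 (chiS k : Sch d) = (lam k)⁻¹ * W1 (chiS 0 : Sch d) := by
  have h : ∀ ξ : V d, chiS k ξ = chiS 0 ((lam k)⁻¹ • ξ) := by
    intro ξ
    have h1 := cR_scale (ρ := 4) (lam_pos k) ξ
    have h2 := sR_scale (ρ := 1 / 64) (lam_pos k) ξ
    rw [chiS_apply, chiS_apply, chiR, chiR, mul_comm 4 (lam k), h1, div_eq_mul_one_div (lam k), h2]
    simp
  exact ⟨W0_scale (lam_pos k) h, W1_scale (lam_pos k) h⟩

lemma sg_cd {μ : ℝ} (s : ℝ) (hμ : 0 ≤ μ) : ContDiff ℝ (⊤ : ℕ∞) (fun ξ : V d => aa s ξ * bb μ ξ) :=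
  (aa_contDiff s).mul (bb_contDiff hμ)

/-- The symbol hypotheses hold uniformly in `μ`. -/
theorem hyp_sg {s : ℝ} (hs : 0 ≤ s) : ∃ C0, 0 ≤ C0 ∧ ∀ μ, 0 < μ → μ ≤ 1 →
    ∃ sL sP sX : ℕ → Sch d, Hyp s C0 (sg s μ) sL sP sX := by
  obtain ⟨DA, hDA, hA⟩ := W_pA (d := d) hs
  obtain ⟨DB, hDB, hB⟩ := W_pB (d := d)
  set E := W0 (eta 1 : Sch d) + 16 * W1 (eta 1 : Sch d) + W0 (chiS 0 : Sch d) + W1 (chiS 0 : Sch d) with hE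
  have n1 := W0_nonneg (eta 1 : Sch d)
  have n2 := W1_nonneg (eta 1 : Sch d)
  have n3 := W0_nonneg (chiS 0 : Sch d)
  have n4 := W1_nonneg (chiS 0 : Sch d)
  obtain ⟨C, hC, hW⟩ := W_loc (d := d) s E (by positivity)
  refine ⟨DA * DB + C, by positivity, fun μ hμ hμ1 => ?_⟩
  set sP : ℕ → Sch d := fun j => mkS (fun ξ => etaR j ξ * (aa s ξ * bb μ ξ))
    ((etaR_contDiff j).mul (sg_cd s hμ.le)) (etaR_hcs j).mul_right with hsP
  set sX : ℕ → Sch d := fun j => mkS (fun ξ => chiR j ξ * (aa s ξ * bb μ ξ))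
    ((chiR_contDiff j).mul (sg_cd s hμ.le)) (chiR_hcs j).mul_right with hsX
  have eP : ∀ j ξ, sP j ξ = eta j ξ * sg s μ ξ := by
    intro j ξ
    simp only [hsP, mkS_apply, eta_apply, sg]
    push_cast; rfl
  have eX : ∀ j ξ, sX j ξ = chiS j ξ * sg s μ ξ := by
    intro j ξ
    simp only [hsX, mkS_apply, chiS_apply, sg]
    push_cast; rfl
  have wP : ∀ k, _ := fun k => hW μ hμ (k + 1) (eta (k + 1)) (sP (k + 1)) (by rw [(W_eta k).1]; linarith)
    (by
      have hl := lam_pos k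
      have e : (lam (k + 1))⁻¹ = (lam k)⁻¹ / 16 := by rw [lam, pow_succ, mul_inv, div_eq_mul_inv]
      rw [(W_eta k).2, e]
      have : 0 < (lam k)⁻¹ := by positivity
      nlinarith)
    (fun ξ h => eta_X (by rw [eta_apply] at h; exact_mod_cast h)) (eP _)
  have wX : ∀ k, _ := fun k => hW μ hμ k (chiS k) (sX k) (by rw [(W_chi k).1]; linarith)
    (by
      have hl := lam_pos k
      rw [(W_chi k).2, mul_comm]
      exact mul_le_mul_of_nonneg_right (by linarith) (by positivity))
    (fun ξ h => chiR_ne (by rw [chiS_apply] at h; exact_mod_cast h)) (eX _)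
  have hle : C ≤ DA * DB + C := by nlinarith [mul_nonneg hDA hDB]
  refine ⟨fun j => mulS (pA s j) (pB μ hμ.le (j + 1)), sP, sX, ?_⟩
  refine { hC := by positivity, eL := ?_, eP := eP, L0 := ?_, P0 := ?_, P1 := ?_, eX := eX, X1 := ?_, bd := sg_bd hμ.le }
  · intro j ξ
    rw [mulS_apply, pA_apply, pB_apply, phi_apply, sg]
    by_cases h : phiR j ξ = 0
    · rw [h]; simp
    · have h1 := phiR_ne h
      have e : lam (j + 1) = 16 * lam j := by rw [lam, pow_succ]; ring
      have hl := lam_pos j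
      rw [phiR_one (k := j + 1) (by linarith)]
      push_cast; ring
  · intro j
    have hl := lam_pos j
    have hp : 0 ≤ lam j ^ s := by positivity
    calc _ ≤ _ := W0_mulS _ _
      _ ≤ (DA * lam j ^ s) * DB := mul_le_mul (hA j) (hB μ hμ hμ1 _) (W0_nonneg _) (by positivity)
      _ = (DA * DB) * lam j ^ s := by ring
      _ ≤ _ := mul_le_mul_of_nonneg_right (by linarith) hp
  · intro k
    have hl := lam_pos (k + 1)
    exact (wP k).1.trans (mul_le_mul_of_nonneg_right hle (by positivity))
  · intro k
    have hl := lam_pos (k + 1)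
    exact (wP k).2.trans (mul_le_mul_of_nonneg_right hle (by positivity))
  · intro k
    have hl := lam_pos (k + 2)
    exact (wX (k + 2)).2.trans (mul_le_mul_of_nonneg_right hle (by positivity))

end KP

namespace KP

variable {d : ℕ}

open Filter Topology

lemma phi_event (ξ : V d) : ∀ᶠ N in atTop, phi N ξ = 1 := by
  have h : Tendsto (fun N : ℕ => (16 : ℝ) ^ N) atTop atTop := tendsto_pow_atTop_atTop_of_one_lt (by norm_num)
  filter_upwards [h.eventually_ge_atTop ‖ξ‖] with N hN
  rw [phi_apply, phiR_one hN]; simp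

lemma phi_event' (p : ℕ) (ξ : V d) : ∀ᶠ N in atTop, phi (N + p) ξ = 1 :=
  (tendsto_add_atTop_nat p).eventually (phi_event ξ)

lemma norm_phi_one (N : ℕ) (ξ : V d) : ‖phi N ξ‖ ≤ 1 := by
  rw [phi_apply, Complex.norm_real, Real.norm_of_nonneg (phiR_nonneg _ _)]; exact phiR_le _ _

lemma Op_inv (m u : Sch d) (x : V d) : Op m u x = 𝓕⁻ (fun ξ => m ξ * 𝓕 u ξ) x := by
  rw [Op, SchwartzMap.fourierInv_coe]; rfl

lemma tendsto_Op {m u : ℕ → Sch d} {p : ℕ} {σ : V d → ℂ} {v : Sch d} {b : V d → ℝ} (hb : Integrable b)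
    (hm : ∀ N ξ, m N ξ = phi (N + p) ξ * σ ξ) (hbd : ∀ N ξ, ‖σ ξ‖ * ‖𝓕 (u N) ξ‖ ≤ b ξ)
    (hl : ∀ ξ, Tendsto (fun N => 𝓕 (u N) ξ) atTop (𝓝 (𝓕 v ξ))) (x : V d) :
    Tendsto (fun N => Op (m N) (u N) x) atTop (𝓝 (𝓕⁻ (fun ξ => σ ξ * 𝓕 v ξ) x)) := by
  simp_rw [Op_inv, Real.fourierInv_eq]
  apply tendsto_integral_of_dominated_convergence b
  · intro N
    apply Continuous.aestronglyMeasurable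
    have h1 := (m N).continuous
    have h2 := (𝓕 (u N)).continuous
    have h3 : Continuous (fun v : V d => Real.fourierChar (inner ℝ v x)) := by fun_prop
    exact h3.smul (h1.mul h2)
  · exact hb
  · intro N
    filter_upwards with ξ
    rw [Circle.norm_smul, norm_mul, hm, norm_mul]
    refine le_trans ?_ (hbd N ξ)
    apply mul_le_mul_of_nonneg_right _ (norm_nonneg _)
    exact mul_le_of_le_one_left (norm_nonneg _) (norm_phi_one _ _)
  · filter_upwards with ξ
    apply Tendsto.const_smul
    apply Tendsto.mul _ (hl ξ)
    apply tendsto_const_nhds.congr'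
    filter_upwards [phi_event' p ξ] with N hN
    rw [hm, hN, one_mul]

lemma fourier_S (k : ℕ) (u : Sch d) (ξ : V d) : 𝓕 (S k u) ξ = phi k ξ * 𝓕 u ξ := fourier_Op_apply _ _ _

lemma norm_fourier_S (k : ℕ) (u : Sch d) (ξ : V d) : ‖𝓕 (S k u) ξ‖ ≤ ‖𝓕 u ξ‖ := by
  rw [fourier_S, norm_mul]
  exact mul_le_of_le_one_left (norm_nonneg _) (norm_phi_one _ _)

lemma tend_fourier_S (p : ℕ) (u : Sch d) (ξ : V d) :
    Tendsto (fun N => 𝓕 (S (N + p) u) ξ) atTop (𝓝 (𝓕 u ξ)) := by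
  apply tendsto_const_nhds.congr'
  filter_upwards [phi_event' p ξ] with N hN
  rw [fourier_S, hN, one_mul]

lemma tend_S (p : ℕ) (u : Sch d) (x : V d) : Tendsto (fun N => S (N + p) u x) atTop (𝓝 (u x)) := by
  have h := tendsto_Op (m := fun N => phi (N + p)) (u := fun _ => u) (p := p) (σ := fun _ => 1) (v := u)
    (b := fun ξ => ‖𝓕 u ξ‖) (𝓕 u).integrable.norm (by intro N ξ; simp) (by intro N ξ; simp)
    (fun ξ => tendsto_const_nhds) x
  have e : 𝓕⁻ (fun ξ => (1 : ℂ) * 𝓕 u ξ) x = u x := by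
    simp only [one_mul]
    have : 𝓕⁻ (⇑(𝓕 u : Sch d)) = ⇑u := by rw [← SchwartzMap.fourierInv_coe]; simp
    rw [← this]
  rw [e] at h
  exact h

lemma aa_mul_fourier (s : ℝ) (u : Sch d) (ξ : V d) : aa s ξ * ‖𝓕 u ξ‖ = ‖𝓕 (Jb s u) ξ‖ := by
  rw [fourier_Jb, norm_mul, Complex.norm_real, Real.norm_of_nonneg (by positivity)]; rfl

lemma peetre {s : ℝ} (hs : 0 ≤ s) (ξ η : V d) : aa s ξ ≤ 2 ^ (s / 2) * (aa s η * aa s (ξ - η)) := by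
  unfold aa
  rw [← Real.mul_rpow (by positivity) (by positivity), ← Real.mul_rpow (by positivity) (by positivity)]
  apply Real.rpow_le_rpow (by positivity) _ (by linarith)
  have h : ‖ξ‖ ≤ ‖η‖ + ‖ξ - η‖ := by
    have := norm_add_le η (ξ - η)
    rwa [add_sub_cancel] at this
  have h0 := norm_nonneg ξ
  nlinarith [sq_nonneg (‖η‖ - ‖ξ - η‖), norm_nonneg η, norm_nonneg (ξ - η), sq_nonneg (‖η‖ * ‖ξ - η‖)]

lemma tend_comm {s μ : ℝ} (hs : 0 ≤ s) (hμ : 0 ≤ μ) {sL : ℕ → Sch d}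
    (hL : ∀ j ξ, sL j ξ = phi j ξ * sg s μ ξ) (f g : Sch d) (x : V d) :
    Tendsto (fun M => comm (sL (M + 2 + 3)) (S (M + 2) f) (S (M + 2 + 1) g) x) atTop
      (𝓝 (𝓕⁻ (fun ξ => sg s μ ξ * 𝓕 (mulS f g) ξ) x - f x * 𝓕⁻ (fun ξ => sg s μ ξ * 𝓕 g ξ) x)) := by
  have hsb : ∀ ξ : V d, ‖sg s μ ξ‖ ≤ aa s ξ := sg_bd hμ
  have e : ∀ M, comm (sL (M + 2 + 3)) (S (M + 2) f) (S (M + 2 + 1) g) x =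
      Op (sL (M + 2 + 3)) (mulS (S (M + 2) f) (S (M + 2 + 1) g)) x
        - S (M + 2) f x * Op (sL (M + 2 + 3)) (S (M + 2 + 1) g) x := by
    intro M
    rw [comm, _root_.sub_apply, mulS_apply]
  simp_rw [e]
  have hci := conv_int (𝓕 (Jb s f)).integrable.norm (𝓕 (Jb s g)).integrable.norm
  obtain ⟨Bg, hBg0, hBg⟩ := exists_bdd (𝓕 g)
  obtain ⟨Bj, hBj0, hBj⟩ := exists_bdd (𝓕 (Jb s g))
  apply Tendsto.sub
  · apply tendsto_Op (p := 5) (b := fun ξ => 2 ^ (s / 2) * ∫ η, ‖𝓕 (Jb s f) η‖ * ‖𝓕 (Jb s g) (ξ - η)‖)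
    · exact hci.1.const_mul _
    · intro N ξ; exact hL _ _
    · intro N ξ
      rw [fourier_mulS]
      calc _ ≤ aa s ξ * ∫ η, ‖𝓕 (S (N + 2) f) η * 𝓕 (S (N + 2 + 1) g) (ξ - η)‖ :=
            mul_le_mul (hsb ξ) (norm_integral_le_integral_norm _) (norm_nonneg _) (aa_pos s ξ).le
        _ = ∫ η, aa s ξ * ‖𝓕 (S (N + 2) f) η * 𝓕 (S (N + 2 + 1) g) (ξ - η)‖ := by rw [integral_const_mul]
        _ ≤ ∫ η, 2 ^ (s / 2) * (‖𝓕 (Jb s f) η‖ * ‖𝓕 (Jb s g) (ξ - η)‖) := by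
          apply integral_mono_of_nonneg
          · filter_upwards with η
            have := aa_pos s ξ
            positivity
          · apply Integrable.const_mul
            refine (𝓕 (Jb s f)).integrable.norm.mul_bdd (c := Bj) ?_ ?_
            · have := (𝓕 (Jb s g)).continuous
              exact Continuous.aestronglyMeasurable (by fun_prop)
            · filter_upwards with y
              rw [norm_norm]; exact hBj _
          · filter_upwards with η
            rw [norm_mul, ← aa_mul_fourier, ← aa_mul_fourier]
            calc _ ≤ (2 ^ (s / 2) * (aa s η * aa s (ξ - η))) * (‖𝓕 f η‖ * ‖𝓕 g (ξ - η)‖) := by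
                  apply mul_le_mul (peetre hs ξ η) _ (by positivity)
                  · have := aa_pos s η
                    have := aa_pos s (ξ - η)
                    positivity
                  · exact mul_le_mul (norm_fourier_S _ _ _) (norm_fourier_S _ _ _) (norm_nonneg _) (norm_nonneg _)
              _ = _ := by ring
        _ = _ := by rw [integral_const_mul]
    · intro ξ
      simp_rw [fourier_mulS]
      apply tendsto_integral_of_dominated_convergence (fun η => ‖𝓕 f η‖ * Bg)
      · intro N
        apply Continuous.aestronglyMeasurable
        have h1 := (𝓕 (S (N + 2) f)).continuous
        have h2 := (𝓕 (S (N + 2 + 1) g)).continuous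
        fun_prop
      · exact (𝓕 f).integrable.norm.mul_const _
      · intro N
        filter_upwards with η
        rw [norm_mul]
        exact mul_le_mul (norm_fourier_S _ _ _) ((norm_fourier_S _ _ _).trans (hBg _)) (norm_nonneg _) (norm_nonneg _)
      · filter_upwards with η
        exact (tend_fourier_S 2 f η).mul (tend_fourier_S 3 g (ξ - η))
  · apply (tend_S 2 f x).mul
    apply tendsto_Op (p := 5) (b := fun ξ => ‖𝓕 (Jb s g) ξ‖)
    · exact (𝓕 (Jb s g)).integrable.norm
    · intro N ξ; exact hL _ _
    · intro N ξ
      rw [← aa_mul_fourier]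
      exact mul_le_mul (hsb ξ) (norm_fourier_S _ _ _) (norm_nonneg _) (aa_pos s ξ).le
    · intro ξ
      exact tend_fourier_S 3 g ξ

lemma eLpNorm_n2 (u : Sch d) : eLpNorm (⇑u) 2 volume = ENNReal.ofReal (n2 u) := by
  rw [n2, SchwartzMap.norm_toLp, ENNReal.ofReal_toReal (u.memLp 2 volume).eLpNorm_ne_top]

lemma jap_rpow (s r : ℝ) : jap r ^ s = (1 + r ^ 2) ^ (s / 2) := by
  rw [jap, ← Real.rpow_mul (by positivity)]; congr 1; ring

lemma besselD_eq (s : ℝ) (u : Sch d) : besselD d s ⇑u = ⇑(Jb s u) := by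
  have h : Jb s u = 𝓕⁻ (𝓕 (Jb s u)) := by simp
  rw [h, SchwartzMap.fourierInv_coe, besselD, fmulD]
  congr 1
  ext ξ
  rw [fourier_Jb, jap_rpow, SchwartzMap.fourier_coe]

lemma JsqrtT_eq {s μ : ℝ} (hμ : 0 < μ) (u : Sch d) (x : V d) :
    JsqrtT d μ s ⇑u x = 𝓕⁻ (fun ξ => sg s μ ξ * 𝓕 u ξ) x := by
  have e : (fun ξ : V d => ((jap ‖ξ‖ ^ s * Real.sqrt (Tsymb μ ‖ξ‖) : ℝ) : ℂ) * 𝓕 (⇑u) ξ)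
      = fun ξ => sg s μ ξ * 𝓕 u ξ := by
    funext ξ
    rw [jap_rpow, ← tt_Tsymb hμ (norm_nonneg _), SchwartzMap.fourier_coe]
    rfl
  rw [JsqrtT, fmulD, e]

lemma sup_le {E : Type*} [NormedAddCommGroup E] {u : V d → E} (hu : Continuous u)
    (hm : eLpNorm u ⊤ volume ≠ ⊤) (x : V d) : ‖u x‖ ≤ (eLpNorm u ⊤ volume).toReal := by
  set c := (eLpNorm u ⊤ volume).toReal with hc
  have hae : ∀ᵐ y ∂(volume : Measure (V d)), ‖u y‖ ≤ c := by
    have h1 : ∀ᵐ y ∂(volume : Measure (V d)), ‖u y‖ₑ ≤ eLpNormEssSup u volume := ae_le_eLpNormEssSup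
    filter_upwards [h1] with y hy
    rw [← eLpNorm_exponent_top] at hy
    have := ENNReal.toReal_mono hm hy
    rw [toReal_enorm] at this
    exact this
  have ho : IsOpen {y | c < ‖u y‖} := isOpen_lt continuous_const hu.norm
  have hz : volume {y | c < ‖u y‖} = 0 := by
    have := ae_iff.1 hae
    simpa using this
  have he := (ho.measure_eq_zero_iff volume).1 hz
  by_contra hcon
  push Not at hcon
  have : x ∈ {y | c < ‖u y‖} := hcon
  rw [he] at this
  exact this

theorem final (s : ℝ) (hs : 0 ≤ s) : ∃ C : ℝ, 0 < C ∧ ∀ μ : ℝ, 0 < μ → μ ≤ 1 → ∀ f g : Sch d,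
    eLpNorm (fun x => JsqrtT d μ s (fun y => f y * g y) x - f x * JsqrtT d μ s ⇑g x) 2 volume ≤
      ENNReal.ofReal C * (eLpNorm (fun x => ‖fderiv ℝ ⇑f x‖) ⊤ volume * eLpNorm (besselD d (s - 1) ⇑g) 2 volume
        + eLpNorm (besselD d s ⇑f) 2 volume * eLpNorm ⇑g ⊤ volume) := by
  obtain ⟨K, hK, hcore⟩ := core (d := d) hs
  obtain ⟨C0, hC0, hhyp⟩ := hyp_sg (d := d) hs
  refine ⟨K * (C0 + 1), by positivity, ?_⟩
  intro μ hμ hμ1 f g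
  obtain ⟨sL, sP, sX, H⟩ := hhyp μ hμ hμ1
  have hfd : (fun x => fderiv ℝ ⇑f x) = ⇑(SchwartzMap.fderivCLM ℝ (V d) ℂ f) := by
    ext x; rw [SchwartzMap.fderivCLM_apply]
  have hAt : eLpNorm (fun x => fderiv ℝ ⇑f x) ⊤ volume ≠ ⊤ := by
    rw [hfd]; exact (SchwartzMap.memLp _ ⊤ volume).eLpNorm_ne_top
  have hBt : eLpNorm ⇑g ⊤ volume ≠ ⊤ := (g.memLp ⊤ volume).eLpNorm_ne_top
  have hfc : Continuous (fun x => fderiv ℝ ⇑f x) := by rw [hfd]; exact SchwartzMap.continuous _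
  rw [eLpNorm_norm, besselD_eq, besselD_eq, eLpNorm_n2, eLpNorm_n2]
  set A := (eLpNorm (fun x => fderiv ℝ ⇑f x) ⊤ volume).toReal with hA
  set B := (eLpNorm ⇑g ⊤ volume).toReal with hB
  have hA0 : 0 ≤ A := ENNReal.toReal_nonneg
  have hB0 : 0 ≤ B := ENNReal.toReal_nonneg
  rw [← ENNReal.ofReal_toReal hAt, ← ENNReal.ofReal_toReal hBt, ← hA, ← hB,
    ← ENNReal.ofReal_mul hA0, ← ENNReal.ofReal_mul (n2_nonneg _),
    ← ENNReal.ofReal_add (mul_nonneg hA0 (n2_nonneg _)) (mul_nonneg (n2_nonneg _) hB0),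
    ← ENNReal.ofReal_mul (by positivity)]
  have hlip : ∀ x y, ‖f x - f y‖ ≤ A * ‖x - y‖ := by
    intro x y
    exact Convex.norm_image_sub_le_of_norm_fderiv_le (𝕜 := ℝ) (s := Set.univ)
      (fun z _ => f.differentiableAt) (fun z _ => sup_le hfc hAt z) convex_univ (Set.mem_univ y) (Set.mem_univ x)
  have hsup : ∀ x, ‖g x‖ ≤ B := sup_le g.continuous hBt
  apply Lp.eLpNorm_le_of_ae_tendsto (u := atTop)
    (f := fun M : ℕ => ⇑(comm (sL (M + 2 + 3)) (S (M + 2) f) (S (M + 2 + 1) g)))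
  · filter_upwards with M
    rw [eLpNorm_n2]
    apply ENNReal.ofReal_le_ofReal
    have := hcore C0 _ sL sP sX H M f g A B hA0 hlip hB0 hsup
    rw [Hs, Hs] at this
    rw [mul_comm (n2 (Jb s f)) B]
    exact this
  · intro M
    exact (SchwartzMap.continuous _).aestronglyMeasurable
  · filter_upwards with x
    have h := tend_comm hs hμ.le H.eL f g x
    have e1 : JsqrtT d μ s (fun y => f y * g y) x = 𝓕⁻ (fun ξ => sg s μ ξ * 𝓕 (mulS f g) ξ) x :=
      JsqrtT_eq hμ (mulS f g) x
    rw [e1, JsqrtT_eq hμ g x]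
    exact h

end KP

/-- Commutator estimate (Lemma 5.5): for `d ∈ {1,2}`, `s ≥ 0`, there is
`C = C(s,d)`, independent of `μ ∈ (0,1]`, such that for Schwartz `f, g`,
`‖[J^s √T_μ(D), f] g‖_{L²} ≤ C (‖∇f‖_{L^∞} ‖J^{s−1} g‖_{L²} + ‖J^s f‖_{L²} ‖g‖_{L^∞})`. -/
theorem commutator_JsqrtT (d : ℕ) (hd : d = 1 ∨ d = 2) (s : ℝ) (hs : 0 ≤ s) :
    ∃ C : ℝ, 0 < C ∧
      ∀ μ : ℝ, 0 < μ → μ ≤ 1 →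
        ∀ f g : 𝓢(EuclideanSpace ℝ (Fin d), ℂ),
          eLpNorm
              (fun x => JsqrtT d μ s (fun y => f y * g y) x - f x * JsqrtT d μ s (⇑g) x)
              2 volume
            ≤ ENNReal.ofReal C *
              (eLpNorm (fun x => ‖fderiv ℝ (⇑f) x‖) ⊤ volume *
                  eLpNorm (besselD d (s - 1) (⇑g)) 2 volume +
                eLpNorm (besselD d s (⇑f)) 2 volume * eLpNorm (⇑g) ⊤ volume) := by
  exact KP.final s hs
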